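/- Let G be a planar graph with n ≥ 4 vertices. Then fix(G) ≥ √(((log₂ n) − 1)/(log₂ log₂ n)). -/

import Mathlib

/-- A straight-line drawing `δ` of a simple graph `G` is *plane* if it is injective,
no vertex image lies on the segment of an edge except as one of its endpoints, and
any two distinct edges intersect only in images of common endpoints. -/
def IsPlaneDrawing {V : Type*} (G : SimpleGraph V) (δ : V → ℝ × ℝ) : Prop :=
  Function.Injective δ ∧
  (∀ u v w : V, G.Adj u v → δ w ∈ segment ℝ (δ u) (δ v) → w = u ∨ w = v) ∧
  (∀ u v a b : V, G.Adj u v → G.Adj a b → ({u, v} : Set V) ≠ ({a, b} : Set V) →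
    ∀ p : ℝ × ℝ, p ∈ segment ℝ (δ u) (δ v) → p ∈ segment ℝ (δ a) (δ b) →
      ∃ w : V, (w = u ∨ w = v) ∧ (w = a ∨ w = b) ∧ p = δ w)

namespace FP

noncomputable section

open Classical

def PlaneD {V : Type*} (G : SimpleGraph V) (δ : V → ℝ × ℝ) : Prop :=
  Function.Injective δ ∧
  (∀ u v w : V, G.Adj u v → δ w ∈ segment ℝ (δ u) (δ v) → w = u ∨ w = v) ∧
  (∀ u v a b : V, G.Adj u v → G.Adj a b → u ≠ a → u ≠ b → v ≠ a → v ≠ b →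
    ∀ p : ℝ × ℝ, p ∈ segment ℝ (δ u) (δ v) → p ∈ segment ℝ (δ a) (δ b) → False)

lemma mem_seg_iff {a b p : ℝ × ℝ} : p ∈ segment ℝ a b ↔
    ∃ t : ℝ, 0 ≤ t ∧ t ≤ 1 ∧ p.1 = (1 - t) * a.1 + t * b.1 ∧ p.2 = (1 - t) * a.2 + t * b.2 := by
  rw [segment_eq_image]
  constructor
  · rintro ⟨t, ⟨h0, h1⟩, rfl⟩
    exact ⟨t, h0, h1, by simp, by simp⟩
  · rintro ⟨t, h0, h1, hx, hy⟩
    exact ⟨t, ⟨h0, h1⟩, by ext <;> simp [hx, hy]⟩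

lemma shared_edge {u v b p : ℝ × ℝ} (h1 : p ∈ segment ℝ u v) (h2 : p ∈ segment ℝ u b)
    (hp : p ≠ u) : v ∈ segment ℝ u b ∨ b ∈ segment ℝ u v := by
  have key : ∀ v b : ℝ × ℝ, ∀ s t : ℝ, 0 ≤ t → t ≤ s → p.1 = (1 - s) * u.1 + s * v.1 →
      p.2 = (1 - s) * u.2 + s * v.2 → p.1 = (1 - t) * u.1 + t * b.1 →
      p.2 = (1 - t) * u.2 + t * b.2 → v ∈ segment ℝ u b := by
    intro v b s t h0 hts a1 a2 b1 b2
    have hs : 0 < s := by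
      rcases (le_trans h0 hts).lt_or_eq with h | h
      · exact h
      · exfalso; apply hp; subst h; ext <;> linarith
    refine mem_seg_iff.2 ⟨t / s, by positivity, (div_le_one hs).2 hts, ?_, ?_⟩
    · field_simp; linarith
    · field_simp; linarith
  obtain ⟨s, s0, s1, a1, a2⟩ := mem_seg_iff.1 h1
  obtain ⟨t, t0, t1, b1, b2⟩ := mem_seg_iff.1 h2
  rcases le_total t s with h | h
  · exact Or.inl (key v b s t t0 h a1 a2 b1 b2)
  · exact Or.inr (key b v t s s0 h b1 b2 a1 a2)

lemma PlaneD.isPlane {V : Type*} {G : SimpleGraph V} {δ : V → ℝ × ℝ} (h : PlaneD G δ) :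
    IsPlaneDrawing G δ := by
  obtain ⟨hi, h1, h2⟩ := h
  refine ⟨hi, h1, ?_⟩
  have main : ∀ u v b p, G.Adj u v → G.Adj u b → v ≠ b → p ∈ segment ℝ (δ u) (δ v) →
      p ∈ segment ℝ (δ u) (δ b) → p = δ u := by
    intro u v b p huv hub hvb hp1 hp2
    by_contra hpu
    rcases shared_edge hp1 hp2 hpu with h | h
    · rcases h1 _ _ _ hub h with h | h
      · exact huv.ne h.symm
      · exact hvb h
    · rcases h1 _ _ _ huv h with h | h
      · exact hub.ne h.symm
      · exact hvb h.symm
  intro u v a b huv hab hne p hp hq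
  by_cases e1 : u = a
  · subst e1
    have : v ≠ b := by rintro rfl; exact hne rfl
    exact ⟨u, Or.inl rfl, Or.inl rfl, main u v b p huv hab this hp hq⟩
  by_cases e2 : u = b
  · subst e2
    have : v ≠ a := by rintro rfl; exact hne (Set.pair_comm _ _)
    rw [segment_symm ℝ (δ a)] at hq
    exact ⟨u, Or.inl rfl, Or.inr rfl, main u v a p huv hab.symm this hp hq⟩
  by_cases e3 : v = a
  · subst e3
    rw [segment_symm] at hp
    exact ⟨v, Or.inr rfl, Or.inl rfl, main v u b p huv.symm hab e2 hp hq⟩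
  by_cases e4 : v = b
  · subst e4
    rw [segment_symm] at hp
    rw [segment_symm ℝ (δ a)] at hq
    exact ⟨v, Or.inr rfl, Or.inr rfl, main v u a p huv.symm hab.symm e1 hp hq⟩
  exact (h2 u v a b huv hab e1 e2 e3 e4 p hp hq).elim

lemma PlaneD.of_isPlane {V : Type*} {G : SimpleGraph V} {δ : V → ℝ × ℝ}
    (h : IsPlaneDrawing G δ) : PlaneD G δ := by
  obtain ⟨hi, h1, h2⟩ := h
  refine ⟨hi, h1, ?_⟩
  intro u v a b huv hab e1 e2 e3 e4 p hp hq
  have : ({u, v} : Set V) ≠ {a, b} := by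
    intro h
    have : u ∈ ({a, b} : Set V) := by rw [← h]; simp
    simp at this; tauto
  obtain ⟨w, hw1, hw2, -⟩ := h2 u v a b huv hab this p hp hq
  rcases hw1 with rfl | rfl <;> rcases hw2 with h | h <;> tauto

/-- transport along affine maps -/
lemma PlaneD.affine {V : Type*} {G : SimpleGraph V} {δ : V → ℝ × ℝ} (h : PlaneD G δ)
    (f : (ℝ × ℝ) →ᵃ[ℝ] (ℝ × ℝ)) (hf : Function.Injective f) : PlaneD G (fun v => f (δ v)) := by
  obtain ⟨hi, h1, h2⟩ := h
  refine ⟨hf.comp hi, ?_, ?_⟩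
  · intro u v w huv hw
    rw [← image_segment] at hw
    obtain ⟨z, hz, he⟩ := hw
    exact h1 u v w huv (by rw [← hf he]; exact hz)
  · intro u v a b huv hab e1 e2 e3 e4 p hp hq
    rw [← image_segment] at hp hq
    obtain ⟨z, hz, rfl⟩ := hp
    obtain ⟨z', hz', he⟩ := hq
    rw [hf he] at hz'
    exact h2 u v a b huv hab e1 e2 e3 e4 z hz hz'

def orient (a b p : ℝ × ℝ) : ℝ := (b.1 - a.1) * (p.2 - a.2) - (b.2 - a.2) * (p.1 - a.1)

structure Step (W : Type*) where
  A : List W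
  l : W
  M : List W
  r : W
  C : List W
  w : W

def Step.B {W : Type*} (s : Step W) : List W := s.l :: (s.M ++ [s.r])
def Step.pre {W : Type*} (s : Step W) : List W := s.A ++ s.l :: (s.M ++ s.r :: s.C)
def Step.post {W : Type*} (s : Step W) : List W := s.A ++ s.l :: s.w :: s.r :: s.C

def dn {W : Type*} (f0 f1 : W) (st : ℕ → Step W) (k : ℕ) (x : W) : Prop :=
  x = f0 ∨ x = f1 ∨ ∃ j < k, x = (st j).w

structure IsCan {W : Type*} (E : SimpleGraph W) (f0 f1 : W) (n : ℕ) (st : ℕ → Step W)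
    (H : ℕ → List W) : Prop where
  ne : f0 ≠ f1
  h0 : H 0 = [f0, f1]
  hpre : ∀ k < n, H k = (st k).pre
  hpost : ∀ k < n, H (k + 1) = (st k).post
  wnew : ∀ k < n, ¬ dn f0 f1 st k (st k).w
  nb : ∀ k < n, ∀ x, dn f0 f1 st k x → E.Adj (st k).w x → x ∈ (st k).B
  all : ∀ x, dn f0 f1 st n x

lemma dn_succ {W : Type*} {f0 f1 : W} {st : ℕ → Step W} {k : ℕ} {x : W} :
    dn f0 f1 st (k + 1) x ↔ dn f0 f1 st k x ∨ x = (st k).w := by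
  unfold dn
  constructor
  · rintro (h | h | ⟨j, hj, h⟩)
    · tauto
    · tauto
    · rcases Nat.lt_succ_iff_lt_or_eq.1 hj with h' | rfl
      · exact Or.inl (Or.inr (Or.inr ⟨j, h', h⟩))
      · exact Or.inr h
  · rintro ((h | h | ⟨j, hj, h⟩) | h)
    · tauto
    · tauto
    · exact Or.inr (Or.inr ⟨j, by omega, h⟩)
    · exact Or.inr (Or.inr ⟨k, by omega, h⟩)

lemma IsCan.mem_dn {W : Type*} {E : SimpleGraph W} {f0 f1 : W} {n : ℕ} {st : ℕ → Step W}
    {H : ℕ → List W} (h : IsCan E f0 f1 n st H) : ∀ k ≤ n, ∀ x ∈ H k, dn f0 f1 st k x := by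
  intro k
  induction k with
  | zero => intro _ x hx; rw [h.h0] at hx; simp at hx; unfold dn; tauto
  | succ k ih =>
    intro hk x hx
    rw [h.hpost k (by omega)] at hx
    rw [dn_succ]
    have := ih (by omega) x
    rw [h.hpre k (by omega)] at this
    simp [Step.pre, Step.post] at this hx
    tauto

lemma IsCan.mirror {W : Type*} {E : SimpleGraph W} {f0 f1 : W} {n : ℕ} {st : ℕ → Step W}
    {H : ℕ → List W} (h : IsCan E f0 f1 n st H) :
    IsCan E f1 f0 n (fun k => ⟨(st k).C.reverse, (st k).r, (st k).M.reverse, (st k).l,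
      (st k).A.reverse, (st k).w⟩) (fun k => (H k).reverse) := by
  have hd : ∀ k x, dn f1 f0 (fun k => (⟨(st k).C.reverse, (st k).r, (st k).M.reverse, (st k).l,
      (st k).A.reverse, (st k).w⟩ : Step W)) k x ↔ dn f0 f1 st k x := by
    intro k x; unfold dn; tauto
  refine ⟨h.ne.symm, by simp [h.h0], ?_, ?_, ?_, ?_, ?_⟩
  · intro k hk; simp only [h.hpre k hk]; simp [Step.pre]
  · intro k hk; simp only [h.hpost k hk]; simp [Step.post]
  · intro k hk; rw [hd]; exact h.wnew k hk
  · intro k hk x; rw [hd]; intro hx ha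
    have := h.nb k hk x hx ha
    simp [Step.B] at this ⊢; tauto
  · intro x; rw [hd]; exact h.all x

end

end FP


namespace FP

noncomputable section

open Classical

def Bel (p : ℝ × ℝ) (L : List (ℝ × ℝ)) : Prop :=
  L.IsChain (fun a b => a.1 ≤ p.1 → p.1 ≤ b.1 → orient a b p ≤ 0)

lemma walk (w p : ℝ × ℝ) : ∀ (L : List (ℝ × ℝ)) (b0 p0 : ℝ × ℝ) (t : ℝ),
    (b0 :: L).IsChain (fun a b => a.1 < b.1) → (b0 :: L).IsChain (fun a b => 0 < orient a b w) →
    p0.1 = b0.1 → b0.2 ≤ p0.2 → b0.1 ≤ w.1 → 0 ≤ t → t ≤ 1 → p.1 = (1 - t) * p0.1 + t * w.1 →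
    (1 - t) * p0.2 + t * w.2 ≤ p.2 → (0 < t ∨ (1 - t) * p0.2 + t * w.2 < p.2) →
    (∃ z ∈ b0 :: L, p.1 < z.1) → ¬ Bel p (b0 :: L) := by
  intro L
  induction L with
  | nil =>
    intro b0 p0 t _ _ h1 h2 h3 h4 h5 h6 h7 h8 ⟨z, hz, hz'⟩
    simp at hz; subst hz
    rw [h1] at h6
    nlinarith
  | cons b1 L ih =>
    intro b0 p0 t hs ho h1 h2 h3 h4 h5 h6 h7 h8 ⟨z, hz, hz'⟩ hB
    have hz2 : z ∈ b1 :: L := by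
      rcases List.mem_cons.1 hz with rfl | h
      · rw [h1] at h6; nlinarith
      · exact h
    rw [List.isChain_cons_cons] at hs ho
    unfold Bel at hB
    rw [List.isChain_cons_cons] at hB
    obtain ⟨hs1, hs2⟩ := hs
    obtain ⟨ho1, ho2⟩ := ho
    obtain ⟨hB1, hB2⟩ := hB
    have hp0 : b0.1 ≤ p.1 := by rw [h6, h1]; nlinarith
    rcases le_or_gt p.1 b1.1 with hle | hgt
    · have := hB1 hp0 hle
      have e : orient b0 b1 p = (1 - t) * ((b1.1 - b0.1) * (p0.2 - b0.2)) + t * orient b0 b1 w +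
          (b1.1 - b0.1) * (p.2 - ((1 - t) * p0.2 + t * w.2)) := by
        unfold orient; rw [h6, h1]; ring
      have i1 : 0 ≤ (1 - t) * ((b1.1 - b0.1) * (p0.2 - b0.2)) :=
        mul_nonneg (by linarith) (mul_nonneg (by linarith) (by linarith))
      have i2 : 0 ≤ t * orient b0 b1 w := mul_nonneg h4 ho1.le
      have i3 : 0 ≤ (b1.1 - b0.1) * (p.2 - ((1 - t) * p0.2 + t * w.2)) :=
        mul_nonneg (by linarith) (by linarith)
      rcases h8 with h8 | h8
      · have := mul_pos h8 ho1
        linarith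
      · have := mul_pos (sub_pos.2 hs1) (sub_pos.2 h8)
        linarith
    · have hpw : p.1 ≤ w.1 := by rw [h6, h1]; nlinarith
      have hd : 0 < w.1 - b0.1 := by linarith
      have hd' : 0 < w.1 - b1.1 := by linarith
      have ht : p.1 - b0.1 = t * (w.1 - b0.1) := by rw [h6, h1]; ring
      have key : ∀ y : ℝ, (1 - (p.1 - b1.1) / (w.1 - b1.1)) *
          ((1 - (b1.1 - b0.1) / (w.1 - b0.1)) * p0.2 + (b1.1 - b0.1) / (w.1 - b0.1) * w.2) +
          (p.1 - b1.1) / (w.1 - b1.1) * w.2 = (1 - t) * p0.2 + t * w.2 := by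
        intro _
        have : t = (p.1 - b0.1) / (w.1 - b0.1) := by field_simp; linarith
        rw [this]
        field_simp
        ring
      refine ih b1 (b1.1, (1 - (b1.1 - b0.1) / (w.1 - b0.1)) * p0.2 +
        (b1.1 - b0.1) / (w.1 - b0.1) * w.2) ((p.1 - b1.1) / (w.1 - b1.1)) hs2 ho2 rfl ?_
        (by linarith) (div_nonneg (by linarith) hd'.le) ((div_le_one hd').2 (by linarith)) ?_ ?_ ?_
        ⟨z, hz2, hz'⟩ hB2
      · have e : ((1 - (b1.1 - b0.1) / (w.1 - b0.1)) * p0.2 +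
            (b1.1 - b0.1) / (w.1 - b0.1) * w.2 - b1.2) * (w.1 - b0.1) =
            (w.1 - b1.1) * (p0.2 - b0.2) + orient b0 b1 w := by
          unfold orient; field_simp; ring
        have : 0 ≤ (w.1 - b1.1) * (p0.2 - b0.2) + orient b0 b1 w := by
          have := mul_nonneg hd'.le (sub_nonneg.2 h2); linarith
        rw [← e] at this
        have := nonneg_of_mul_nonneg_left this hd
        simpa using this
      · field_simp; ring
      · simpa [key 0] using h7
      · left; exact div_pos (by linarith) hd'

def sg (p : ℝ × ℝ) : ℝ × ℝ := (-p.1, p.2)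

lemma orient_sg (a b p : ℝ × ℝ) : orient (sg b) (sg a) (sg p) = orient a b p := by
  unfold orient sg; simp; ring

lemma Bel_sg (p : ℝ × ℝ) (L : List (ℝ × ℝ)) : Bel (sg p) ((L.map sg).reverse) ↔ Bel p L := by
  unfold Bel
  rw [List.isChain_reverse, List.isChain_map]
  simp only [orient_sg]
  constructor <;> intro h <;> refine h.imp ?_ <;> intro a b h1 h2 h3 <;>
    exact h1 (by simpa [sg] using h3) (by simpa [sg] using h2)

lemma srt_pw {L : List (ℝ × ℝ)} (hs : L.IsChain (fun a b => a.1 < b.1)) :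
    L.Pairwise (fun a b => a.1 < b.1) := by
  have : Trans (fun a b : ℝ × ℝ => a.1 < b.1) (fun a b : ℝ × ℝ => a.1 < b.1)
    (fun a b : ℝ × ℝ => a.1 < b.1) := ⟨fun h1 h2 => lt_trans h1 h2⟩
  exact List.isChain_iff_pairwise.1 hs

/-- a point on a new edge is strictly above the contour -/
lemma seg_above {B1 B2 : List (ℝ × ℝ)} {u w p : ℝ × ℝ}
    (hs : (B1 ++ u :: B2).IsChain (fun a b => a.1 < b.1))
    (ho : (B1 ++ u :: B2).IsChain (fun a b => 0 < orient a b w))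
    (t : ℝ) (t0 : 0 ≤ t) (t1 : t ≤ 1) (hp1 : p.1 = (1 - t) * u.1 + t * w.1)
    (hp2 : (1 - t) * u.2 + t * w.2 ≤ p.2) (hp3 : 0 < t ∨ (1 - t) * u.2 + t * w.2 < p.2)
    (hp4 : u.1 ≤ w.1 → ∃ z ∈ B1 ++ u :: B2, p.1 < z.1)
    (hp5 : w.1 < u.1 → ∃ z ∈ B1 ++ u :: B2, z.1 < p.1) :
    ¬ Bel p (B1 ++ u :: B2) := by
  intro hB
  have hpw := srt_pw hs
  rw [List.pairwise_append] at hpw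
  obtain ⟨_, q2, q3⟩ := hpw
  rw [List.pairwise_cons] at q2
  rcases le_or_gt u.1 w.1 with h | h
  · have hup : u.1 ≤ p.1 := by rw [hp1]; nlinarith
    refine walk w p B2 u u t hs.right_of_append ho.right_of_append rfl le_rfl h t0 t1 hp1 hp2 hp3
      ?_ hB.right_of_append
    obtain ⟨z, hz, hzp⟩ := hp4 h
    rcases List.mem_append.1 hz with hm | hm
    · have := q3 z hm u (by simp); linarith
    · exact ⟨z, hm, hzp⟩
  · have hup : p.1 ≤ u.1 := by rw [hp1]; nlinarith
    have hB' := (Bel_sg p _).2 hB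
    have e : ((B1 ++ u :: B2).map sg).reverse =
      (B2.map sg).reverse ++ (sg u :: (B1.map sg).reverse) := by simp
    rw [e] at hB'
    have hs' : (((B1 ++ u :: B2).map sg).reverse).IsChain (fun a b => a.1 < b.1) := by
      rw [List.isChain_reverse, List.isChain_map]
      exact hs.imp (by intro a b h; simpa [sg] using h)
    have ho' : (((B1 ++ u :: B2).map sg).reverse).IsChain (fun a b => 0 < orient a b (sg w)) := by
      rw [List.isChain_reverse, List.isChain_map]
      exact ho.imp (by intro a b h; rw [orient_sg]; exact h)
    rw [e] at hs' ho'
    refine walk (sg w) (sg p) _ (sg u) (sg u) t hs'.right_of_append ho'.right_of_append rfl le_rfl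
      (by simp [sg]; linarith) t0 t1 (by simp [sg]; rw [hp1]; ring) hp2 hp3 ?_ hB'.right_of_append
    obtain ⟨z, hz, hzp⟩ := hp5 h
    rcases List.mem_append.1 hz with hm | hm
    · exact ⟨sg z, by simp; right; exact ⟨z.1, z.2, hm, rfl⟩, by simpa [sg] using hzp⟩
    · rcases List.mem_cons.1 hm with rfl | hm
      · linarith
      · have := q2.1 z hm; linarith

section crit

variable {l w r : ℝ × ℝ} {M : List (ℝ × ℝ)}
  (hs : (l :: (M ++ [r])).IsChain (fun a b => a.1 < b.1))
  (ho : (l :: (M ++ [r])).IsChain (fun a b => 0 < orient a b w))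
  (hlw : l.1 < w.1) (hwr : w.1 < r.1)

lemma B_bds (hs : (l :: (M ++ [r])).IsChain (fun a b => a.1 < b.1)) :
    ∀ u ∈ l :: (M ++ [r]), l.1 ≤ u.1 ∧ u.1 ≤ r.1 := by
  have h1 := srt_pw hs
  have h2 : ((l :: M) ++ [r]).Pairwise (fun a b => a.1 < b.1) := by simpa using h1
  rw [List.pairwise_append] at h2
  rw [List.pairwise_cons] at h1
  have hlr := h1.1 r (by simp)
  intro u hu
  simp at hu
  rcases hu with rfl | hu | rfl
  · exact ⟨le_rfl, hlr.le⟩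
  · exact ⟨(h1.1 u (by simp [hu])).le, (h2.2.2 u (by simp [hu]) r (by simp)).le⟩
  · exact ⟨hlr.le, le_rfl⟩

include hs ho hlw hwr

lemma F1 {u p : ℝ × ℝ} (hu : u ∈ l :: (M ++ [r])) (t : ℝ) (t0 : 0 < t) (t1 : t ≤ 1)
    (hp1 : p.1 = (1 - t) * u.1 + t * w.1) (hp2 : p.2 = (1 - t) * u.2 + t * w.2) :
    l.1 < p.1 ∧ p.1 < r.1 ∧ ¬ Bel p (l :: (M ++ [r])) := by
  obtain ⟨b1, b2⟩ := B_bds hs u hu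
  have c1 : l.1 < p.1 := by rw [hp1]; nlinarith
  have c2 : p.1 < r.1 := by rw [hp1]; nlinarith
  refine ⟨c1, c2, ?_⟩
  obtain ⟨B1, B2, e⟩ := List.append_of_mem hu
  have hl : l ∈ B1 ++ u :: B2 := by rw [← e]; simp
  have hr : r ∈ B1 ++ u :: B2 := by rw [← e]; simp
  rw [e] at hs ho ⊢
  exact seg_above hs ho t t0.le t1 hp1 hp2.ge (Or.inl t0) (fun _ => ⟨r, hr, c2⟩)
    (fun _ => ⟨l, hl, c1⟩)

lemma F2 {p : ℝ × ℝ} (hB : Bel p (l :: (M ++ [r]))) (h1 : l.1 ≤ p.1) (h2 : p.1 ≤ w.1) :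
    orient l w p ≤ 0 := by
  by_contra hc
  push Not at hc
  have hd : 0 < w.1 - l.1 := by linarith
  refine seg_above (B1 := []) hs ho ((p.1 - l.1) / (w.1 - l.1)) (div_nonneg (by linarith) hd.le)
    ((div_le_one hd).2 (by linarith)) (by field_simp; ring) ?_ (Or.inr ?_)
    (fun _ => ⟨r, by simp, by linarith⟩) (fun h => by linarith) hB
  all_goals
    have e : (1 - (p.1 - l.1) / (w.1 - l.1)) * l.2 + (p.1 - l.1) / (w.1 - l.1) * w.2 =
      p.2 - orient l w p / (w.1 - l.1) := by unfold orient; field_simp; ring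
    have := div_pos hc hd
    linarith

lemma F3 {p : ℝ × ℝ} (hB : Bel p (l :: (M ++ [r]))) (h1 : w.1 ≤ p.1) (h2 : p.1 ≤ r.1) :
    orient w r p ≤ 0 := by
  by_contra hc
  push Not at hc
  have hd : 0 < r.1 - w.1 := by linarith
  refine seg_above (B1 := l :: M) (u := r) (B2 := []) hs ho ((r.1 - p.1) / (r.1 - w.1))
    (div_nonneg (by linarith) hd.le)
    ((div_le_one hd).2 (by linarith)) (by field_simp; ring) ?_ (Or.inr ?_)
    (fun h => by linarith) (fun h => ⟨l, by simp, by linarith⟩) hB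
  all_goals
    have e : (1 - (r.1 - p.1) / (r.1 - w.1)) * r.2 + (r.1 - p.1) / (r.1 - w.1) * w.2 =
      p.2 - orient w r p / (r.1 - w.1) := by unfold orient; field_simp; ring
    have := div_pos hc hd
    linarith

end crit

lemma chain_pre {α : Type*} {R : α → α → Prop} {A M C : List α} {l r : α} :
    (A ++ l :: (M ++ r :: C)).IsChain R ↔
      (A ++ [l]).IsChain R ∧ (l :: (M ++ [r])).IsChain R ∧ (r :: C).IsChain R := by
  rw [List.isChain_split]
  have : l :: (M ++ r :: C) = (l :: M) ++ r :: C := by simp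
  rw [this, List.isChain_split (l₁ := l :: M)]; simp

lemma chain_post {α : Type*} {R : α → α → Prop} {A C : List α} {l w r : α} :
    (A ++ l :: w :: r :: C).IsChain R ↔
      (A ++ [l]).IsChain R ∧ R l w ∧ R w r ∧ (r :: C).IsChain R := by
  rw [List.isChain_split]; simp

structure CInv {W : Type*} (E : SimpleGraph W) (f0 f1 : W) (st : ℕ → Step W)
    (H : ℕ → List W) (δ : W → ℝ × ℝ) (k : ℕ) : Prop where
  srt : ((H k).map δ).IsChain (fun a b => a.1 < b.1)
  bel : ∀ u v p, dn f0 f1 st k u → dn f0 f1 st k v → (u = v ∨ E.Adj u v) →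
    p ∈ segment ℝ (δ u) (δ v) → Bel p ((H k).map δ)
  inj : ∀ u v, dn f0 f1 st k u → dn f0 f1 st k v → δ u = δ v → u = v
  vx : ∀ u v w, dn f0 f1 st k u → dn f0 f1 st k v → dn f0 f1 st k w → E.Adj u v →
    δ w ∈ segment ℝ (δ u) (δ v) → w = u ∨ w = v
  ed : ∀ u v a b, dn f0 f1 st k u → dn f0 f1 st k v → dn f0 f1 st k a → dn f0 f1 st k b →
    E.Adj u v → E.Adj a b → u ≠ a → u ≠ b → v ≠ a → v ≠ b →
    ∀ p : ℝ × ℝ, p ∈ segment ℝ (δ u) (δ v) → p ∈ segment ℝ (δ a) (δ b) → False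

theorem criterion {W : Type*} {E : SimpleGraph W} {f0 f1 : W} {n : ℕ} {st : ℕ → Step W}
    {H : ℕ → List W} (hc : IsCan E f0 f1 n st H) (δ : W → ℝ × ℝ)
    (hx : (δ f0).1 < (δ f1).1)
    (hw : ∀ k < n, (δ (st k).l).1 < (δ (st k).w).1 ∧ (δ (st k).w).1 < (δ (st k).r).1)
    (ho : ∀ k < n, (st k).B.IsChain (fun a b => 0 < orient (δ a) (δ b) (δ (st k).w))) :
    PlaneD E δ := by
  have main : ∀ k ≤ n, CInv E f0 f1 st H δ k := by
    intro k
    induction k with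
    | zero =>
      intro _
      have d0 : ∀ x, dn f0 f1 st 0 x ↔ x = f0 ∨ x = f1 := by intro x; simp [dn]
      have hne : δ f0 ≠ δ f1 := by intro h; rw [h] at hx; exact lt_irrefl _ hx
      have o : ∀ p, p ∈ segment ℝ (δ f0) (δ f1) → orient (δ f0) (δ f1) p = 0 := by
        intro p hp
        obtain ⟨t, -, -, h1, h2⟩ := mem_seg_iff.1 hp
        unfold orient; rw [h1, h2]; ring
      refine ⟨by simp [hc.h0, hx], ?_, ?_, ?_, ?_⟩
      · intro u v p hu hv _ hp
        have : p ∈ segment ℝ (δ f0) (δ f1) := by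
          rw [d0] at hu hv
          rcases hu with rfl | rfl <;> rcases hv with rfl | rfl
          · rw [segment_same] at hp; rw [Set.mem_singleton_iff.1 hp]; exact left_mem_segment _ _ _
          · exact hp
          · rw [segment_symm]; exact hp
          · rw [segment_same] at hp; rw [Set.mem_singleton_iff.1 hp]; exact right_mem_segment _ _ _
        simp [hc.h0, Bel, o p this]
      · intro u v hu hv h
        rw [d0] at hu hv
        rcases hu with rfl | rfl <;> rcases hv with rfl | rfl <;> first | rfl | exact (hne h).elim | exact (hne h.symm).elim
      · intro u v w hu hv hw' huv _
        rw [d0] at hu hv hw'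
        have := huv.ne
        grind
      · intro u v a b hu hv ha hb huv hab h1 h2 h3 h4
        rw [d0] at hu hv ha hb
        have := hab.ne
        grind
    | succ k ih =>
      intro hk
      obtain ⟨srt, bel, inj, vx, ed⟩ := ih (by omega)
      have hkn : k < n := by omega
      have hH := hc.hpre k hkn
      have hH' := hc.hpost k hkn
      have hnew := hc.wnew k hkn
      have hnb := hc.nb k hkn
      obtain ⟨hlw, hwr⟩ := hw k hkn
      have hok := ho k hkn
      have hmem : ∀ x ∈ (st k).B, dn f0 f1 st k x := by
        intro x hx
        apply hc.mem_dn k (by omega) x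
        rw [hH]; simp [Step.B, Step.pre] at hx ⊢; tauto
      generalize hst : st k = s at *
      obtain ⟨A, l, M, r, C, w⟩ := s
      simp only [Step.B, Step.pre, Step.post] at *
      rw [hH] at srt bel
      have ho' : (δ l :: (M.map δ ++ [δ r])).IsChain (fun a b => 0 < orient a b (δ w)) := by
        have : (δ l :: (M.map δ ++ [δ r])) = (l :: (M ++ [r])).map δ := by simp
        rw [this, List.isChain_map]; exact hok
      have srt0 := srt
      simp only [List.map_append, List.map_cons] at srt bel
      obtain ⟨s1, s2, s3⟩ := chain_pre.1 srt
      have bel' : ∀ u v p, dn f0 f1 st k u → dn f0 f1 st k v → (u = v ∨ E.Adj u v) →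
          p ∈ segment ℝ (δ u) (δ v) → Bel p (A.map δ ++ [δ l]) ∧ Bel p (δ l :: (M.map δ ++ [δ r])) ∧
          Bel p (δ r :: C.map δ) := by
        intro u v p h1 h2 h3 h4
        exact chain_pre.1 (bel u v p h1 h2 h3 h4)
      have memB : ∀ u ∈ l :: (M ++ [r]), δ u ∈ δ l :: (M.map δ ++ [δ r]) := by
        intro u hu
        have : (δ l :: (M.map δ ++ [δ r])) = (l :: (M ++ [r])).map δ := by simp
        rw [this]; exact List.mem_map_of_mem hu
      -- points on new edges
      have N : ∀ u ∈ l :: (M ++ [r]), ∀ p ∈ segment ℝ (δ u) (δ w), p ≠ δ u →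
          (δ l).1 < p.1 ∧ p.1 < (δ r).1 ∧ ¬ Bel p (δ l :: (M.map δ ++ [δ r])) := by
        intro u hu p hp hpu
        obtain ⟨t, t0, t1, e1, e2⟩ := mem_seg_iff.1 hp
        have : 0 < t := by
          rcases t0.lt_or_eq with h | h
          · exact h
          · exfalso; apply hpu; subst h; ext <;> linarith
        exact F1 s2 ho' hlw hwr (memB u hu) t this t1 e1 e2
      have selfseg : ∀ x : W, δ x ∈ segment ℝ (δ x) (δ x) := fun x => by simp
      have lmem : l ∈ l :: (M ++ [r]) := by simp
      have wl : δ w ≠ δ l := by intro h; rw [h] at hlw; exact lt_irrefl _ hlw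
      have wNB := N l lmem (δ w) (right_mem_segment _ _ _) wl
      -- w is not on the old drawing
      have wold : ∀ u v, dn f0 f1 st k u → dn f0 f1 st k v → (u = v ∨ E.Adj u v) →
          δ w ∉ segment ℝ (δ u) (δ v) := by
        intro u v h1 h2 h3 h4
        exact wNB.2.2 (bel' u v _ h1 h2 h3 h4).2.1
      have woldv : ∀ u, dn f0 f1 st k u → δ w ≠ δ u := by
        intro u hu h
        apply wold u u hu hu (Or.inl rfl); rw [h]; exact selfseg u
      have newp : ∀ u ∈ l :: (M ++ [r]), ∀ p ∈ segment ℝ (δ u) (δ w),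
          Bel p (((A ++ l :: w :: r :: C)).map δ) := by
        intro u hu p hp
        simp only [List.map_append, List.map_cons]
        have hul := bel' u u (δ u) (hmem u hu) (hmem u hu) (Or.inl rfl) (selfseg u)
        have hub := B_bds s2 (δ u) (memB u hu)
        obtain ⟨t, t0, t1, e1, e2⟩ := mem_seg_iff.1 hp
        have q1 : Bel p (A.map δ ++ [δ l]) ∧ Bel p (δ r :: C.map δ) := by
          by_cases hpu : p = δ u
          · rw [hpu]; exact ⟨hul.1, hul.2.2⟩
          · obtain ⟨n1, n2, -⟩ := N u hu p hp hpu
            constructor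
            · have h1 := srt_pw s1
              have h2 := (List.pairwise_append.1 h1).2.2
              refine (h1.imp_of_mem (S := fun a b : ℝ × ℝ => a.1 ≤ p.1 → p.1 ≤ b.1 → orient a b p ≤ 0) ?_).isChain
              intro a b _ hb _ _ h4
              exfalso
              rcases List.mem_append.1 hb with hb | hb
              · have := h2 b hb (δ l) (by simp); linarith
              · simp at hb; subst hb; linarith
            · have h1 := srt_pw s3
              have h2 := (List.pairwise_cons.1 h1).1
              refine (h1.imp_of_mem (S := fun a b : ℝ × ℝ => a.1 ≤ p.1 → p.1 ≤ b.1 → orient a b p ≤ 0) ?_).isChain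
              intro a b ha _ _ h4 _
              exfalso
              rcases List.mem_cons.1 ha with rfl | ha
              · linarith
              · have := h2 a ha; linarith
        refine chain_post.2 ⟨q1.1, ?_, ?_, q1.2⟩
        · intro _ h2
          have e : orient (δ l) (δ w) p = (1 - t) * orient (δ l) (δ w) (δ u) := by
            unfold orient; rw [e1, e2]; ring
          rw [e]
          rcases le_or_gt (δ u).1 (δ w).1 with h | h
          · have := F2 s2 ho' hlw hwr hul.2.1 hub.1 h
            exact mul_nonpos_of_nonneg_of_nonpos (by linarith) this
          · have : (1 - t) * ((δ u).1 - (δ w).1) ≤ 0 := by linarith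
            have : 1 - t ≤ 0 := by
              by_contra hh; push Not at hh
              have := mul_pos hh (sub_pos.2 h); linarith
            have : t = 1 := by linarith
            rw [this]; simp
        · intro h2 _
          have e : orient (δ w) (δ r) p = (1 - t) * orient (δ w) (δ r) (δ u) := by
            unfold orient; rw [e1, e2]; ring
          rw [e]
          rcases le_or_gt (δ w).1 (δ u).1 with h | h
          · have := F3 s2 ho' hlw hwr hul.2.1 h hub.2
            exact mul_nonpos_of_nonneg_of_nonpos (by linarith) this
          · have : (1 - t) * ((δ w).1 - (δ u).1) ≤ 0 := by linarith
            have : 1 - t ≤ 0 := by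
              by_contra hh; push Not at hh
              have := mul_pos hh (sub_pos.2 h); linarith
            have : t = 1 := by linarith
            rw [this]; simp
      have dsucc : ∀ x, dn f0 f1 st (k + 1) x ↔ dn f0 f1 st k x ∨ x = w := by
        intro x; rw [dn_succ, hst]
      have edw : ∀ a b, dn f0 f1 st k a → dn f0 f1 st k b → ∀ u ∈ l :: (M ++ [r]), E.Adj a b →
          u ≠ a → u ≠ b → ∀ p : ℝ × ℝ, p ∈ segment ℝ (δ u) (δ w) → p ∈ segment ℝ (δ a) (δ b) →
          False := by
        intro a b ha hb u hu hab h1 h2 p hp hq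
        by_cases hpu : p = δ u
        · subst hpu
          rcases vx a b u ha hb (hmem u hu) hab hq with h | h
          · exact h1 h
          · exact h2 h
        · exact (N u hu p hp hpu).2.2 (bel' a b p ha hb (Or.inr hab) hq).2.1
      have vxw : ∀ a, dn f0 f1 st k a → ∀ u ∈ l :: (M ++ [r]), δ a ∈ segment ℝ (δ u) (δ w) →
          a = u := by
        intro a ha u hu hp
        by_cases hpu : δ a = δ u
        · exact inj a u ha (hmem u hu) hpu
        · exact ((N u hu _ hp hpu).2.2 (bel' a a _ ha ha (Or.inl rfl) (selfseg a)).2.1).elim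
      refine ⟨?_, ?_, ?_, ?_, ?_⟩
      · rw [hH']; simp only [List.map_append, List.map_cons]
        exact chain_post.2 ⟨s1, hlw, hwr, s3⟩
      · intro u v p hu hv huv hp
        rw [hH']
        rw [dsucc] at hu hv
        rcases hu with hu | rfl <;> rcases hv with hv | rfl
        · have := bel' u v p hu hv huv hp
          simp only [List.map_append, List.map_cons]
          exact chain_post.2 ⟨this.1, F2 s2 ho' hlw hwr this.2.1, F3 s2 ho' hlw hwr this.2.1, this.2.2⟩
        · rcases huv with rfl | huv
          · exact (hnew hu).elim
          · exact newp u (hnb u hu huv.symm) p hp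
        · rcases huv with rfl | huv
          · exact (hnew hv).elim
          · rw [segment_symm] at hp
            exact newp v (hnb v hv huv) p hp
        · simp only [segment_same, Set.mem_singleton_iff] at hp; subst hp
          exact newp l lmem _ (right_mem_segment _ _ _)
      · intro u v hu hv h
        rw [dsucc] at hu hv
        rcases hu with hu | rfl <;> rcases hv with hv | rfl
        · exact inj u v hu hv h
        · exact (woldv u hu h.symm).elim
        · exact (woldv v hv h).elim
        · rfl
      · intro u v x hu hv hx' huv hp
        rw [dsucc] at hu hv hx'
        rcases hu with hu | rfl <;> rcases hv with hv | rfl <;> rcases hx' with hx' | rfl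
        · exact vx u v x hu hv hx' huv hp
        · exact (wold u v hu hv (Or.inr huv) hp).elim
        · exact Or.inl (vxw x hx' u (hnb u hu huv.symm) hp)
        · exact Or.inr rfl
        · rw [segment_symm] at hp
          exact Or.inr (vxw x hx' v (hnb v hv huv) hp)
        · exact Or.inl rfl
        · exact (huv.ne rfl).elim
        · exact Or.inl rfl
      · intro u v a b hu hv ha hb huv hab h1 h2 h3 h4 p hp hq
        rw [dsucc] at hu hv ha hb
        have hp' := hp
        have hq' := hq
        rw [segment_symm] at hp' hq'
        rcases hu with hu | rfl
        · rcases hv with hv | rfl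
          · rcases ha with ha | rfl
            · rcases hb with hb | rfl
              · exact ed u v a b hu hv ha hb huv hab h1 h2 h3 h4 p hp hq
              · exact edw u v hu hv a (hnb a ha hab.symm) huv h1.symm h3.symm p hq hp
            · have hb : dn f0 f1 st k b := by
                rcases hb with hb | rfl
                · exact hb
                · exact (hab.ne rfl).elim
              exact edw u v hu hv b (hnb b hb hab) huv h2.symm h4.symm p hq' hp
          · have ha := ha.resolve_right h3.symm
            have hb := hb.resolve_right h4.symm
            exact edw a b ha hb u (hnb u hu huv.symm) hab h1 h2 p hp hq
        · have ha := ha.resolve_right h1.symm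
          have hb := hb.resolve_right h2.symm
          have hv := hv.resolve_right huv.ne.symm
          exact edw a b ha hb v (hnb v hv huv) hab h3 h4 p hp' hq
  obtain ⟨_, _, inj, vx, ed⟩ := main n le_rfl
  refine ⟨fun u v => inj u v (hc.all u) (hc.all v), fun u v w => vx u v w (hc.all _) (hc.all _) (hc.all _),
    fun u v a b => ed u v a b (hc.all _) (hc.all _) (hc.all _) (hc.all _)⟩

end

end FP


namespace FP

noncomputable section

open Classical

lemma pw_iff {W : Type*} (ξ : W → ℝ) {L : List W} :
    L.IsChain (fun a b => ξ a < ξ b) ↔ L.Pairwise (fun a b => ξ a < ξ b) := by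
  have : Trans (fun a b : W => ξ a < ξ b) (fun a b : W => ξ a < ξ b)
    (fun a b : W => ξ a < ξ b) := ⟨fun h1 h2 => lt_trans h1 h2⟩
  exact List.isChain_iff_pairwise

section
variable {W : Type*} {E : SimpleGraph W} {f0 f1 : W} {n : ℕ} {st : ℕ → Step W} {H : ℕ → List W}

lemma dn_mono {k k' : ℕ} (h : k ≤ k') {x : W} (hx : dn f0 f1 st k x) : dn f0 f1 st k' x := by
  rcases hx with h1 | h1 | ⟨j, hj, h1⟩
  · exact Or.inl h1
  · exact Or.inr (Or.inl h1)
  · exact Or.inr (Or.inr ⟨j, by omega, h1⟩)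

lemma IsCan.memB (hc : IsCan E f0 f1 n st H) {k : ℕ} (hk : k < n) {x : W} (hx : x ∈ (st k).B) :
    dn f0 f1 st k x := by
  apply hc.mem_dn k hk.le x
  rw [hc.hpre k hk]; simp [Step.B, Step.pre] at hx ⊢; tauto

lemma IsCan.w_lt (hc : IsCan E f0 f1 n st H) {j k : ℕ} (hj : j < n) 
    (h : dn f0 f1 st k (st j).w) : j < k := by
  by_contra hcon
  exact hc.wnew j hj (dn_mono (by omega) h)

lemma can_rec {α : Type*} (hc : IsCan E f0 f1 n st H) (a0 a1 : α) (F : ℕ → (W → α) → α)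
    (hloc : ∀ k < n, ∀ d d' : W → α, (∀ x ∈ (st k).B, d x = d' x) → F k d = F k d') :
    ∃ d : W → α, d f0 = a0 ∧ d f1 = a1 ∧ ∀ k < n, d (st k).w = F k d := by
  have main : ∀ k ≤ n, ∃ d : W → α, d f0 = a0 ∧ d f1 = a1 ∧ ∀ j < k, d (st j).w = F j d := by
    intro k
    induction k with
    | zero =>
      intro _
      exact ⟨fun x => if x = f0 then a0 else a1, by simp, by simp [hc.ne.symm], by simp⟩
    | succ k ih =>
      intro hk
      obtain ⟨d, h0, h1, h2⟩ := ih (by omega)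
      have hn := hc.wnew k (by omega)
      have hu : ∀ x, dn f0 f1 st k x → Function.update d (st k).w (F k d) x = d x := by
        intro x hx
        apply Function.update_of_ne
        rintro rfl; exact hn hx
      refine ⟨Function.update d (st k).w (F k d), ?_, ?_, ?_⟩
      · rw [hu _ (Or.inl rfl), h0]
      · rw [hu _ (Or.inr (Or.inl rfl)), h1]
      · intro j hj
        have e : F j (Function.update d (st k).w (F k d)) = F j d := by
          apply hloc j (by omega)
          intro x hx
          exact hu x (dn_mono (by omega) (hc.memB (by omega) hx))
        rw [e]
        rcases Nat.lt_succ_iff_lt_or_eq.1 hj with h | rfl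
        · rw [hu _ (Or.inr (Or.inr ⟨j, h, rfl⟩)), h2 j h]
        · simp
  exact main n le_rfl

structure Xi (f0 f1 : W) (st : ℕ → Step W) (H : ℕ → List W) (n : ℕ) (ξ : W → ℝ) : Prop where
  inj : ∀ u v, dn f0 f1 st n u → dn f0 f1 st n v → ξ u = ξ v → u = v
  bd : ∀ u, dn f0 f1 st n u → ξ f0 ≤ ξ u ∧ ξ u ≤ ξ f1
  lt : ξ f0 < ξ f1
  srt : ∀ j ≤ n, (H j).Pairwise (fun a b => ξ a < ξ b)
  lw : ∀ k < n, ξ (st k).l < ξ (st k).w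
  wr : ∀ k < n, ξ (st k).w < ξ (st k).r

lemma xi_exists [Finite W] (hc : IsCan E f0 f1 n st H) : ∃ ξ : W → ℝ, Xi f0 f1 st H n ξ := by
  have main : ∀ k ≤ n, ∃ ξ : W → ℝ, Xi f0 f1 st H k ξ := by
    intro k
    induction k with
    | zero =>
      intro _
      have d0 : ∀ x, dn f0 f1 st 0 x ↔ x = f0 ∨ x = f1 := by intro x; simp [dn]
      have hne := hc.ne
      refine ⟨fun x => if x = f0 then 0 else 1, ?_, ?_, ?_, ?_, by simp, by simp⟩
      · intro u v; rw [d0, d0]; rintro (rfl | rfl) (rfl | rfl) <;> simp [hne, hne.symm]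
      · intro u; rw [d0]; rintro (rfl | rfl) <;> simp [hne.symm]
      · simp [hne.symm]
      · intro j hj
        obtain rfl : j = 0 := by omega
        rw [hc.h0]; simp [hne.symm]
    | succ k ih =>
      intro hk
      obtain ⟨ξ, inj, bd, lt, srt, lw, wr⟩ := ih (by omega)
      have hkn : k < n := by omega
      have hn := hc.wnew k hkn
      have s := srt k le_rfl
      rw [hc.hpre k hkn, Step.pre, ← pw_iff, chain_pre] at s
      have slr : ξ (st k).l < ξ (st k).r := by
        have := pw_iff ξ |>.1 s.2.1
        exact (List.pairwise_cons.1 this).1 _ (by simp)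
      obtain ⟨v, hv1, hv2⟩ := (Set.Ioo_infinite slr).exists_notMem_finite (Set.finite_range ξ)
      have hu : ∀ x, dn f0 f1 st k x → Function.update ξ (st k).w v x = ξ x := by
        intro x hx
        apply Function.update_of_ne
        rintro rfl; exact hn hx
      have hl : dn f0 f1 st k (st k).l := hc.memB hkn (by simp [Step.B])
      have hr : dn f0 f1 st k (st k).r := hc.memB hkn (by simp [Step.B])
      have e0 := hu f0 (Or.inl rfl)
      have e1 := hu f1 (Or.inr (Or.inl rfl))
      have LW : ∀ j < k + 1, Function.update ξ (st k).w v (st j).l < Function.update ξ (st k).w v (st j).w := by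
        intro j hj
        rcases Nat.lt_succ_iff_lt_or_eq.1 hj with h | rfl
        · rw [hu _ (Or.inr (Or.inr ⟨j, h, rfl⟩)), hu _ (dn_mono h.le (hc.memB (by omega) (by simp [Step.B])))]
          exact lw j h
        · rw [hu _ hl]; simp; exact hv1.1
      have WR : ∀ j < k + 1, Function.update ξ (st k).w v (st j).w < Function.update ξ (st k).w v (st j).r := by
        intro j hj
        rcases Nat.lt_succ_iff_lt_or_eq.1 hj with h | rfl
        · rw [hu _ (Or.inr (Or.inr ⟨j, h, rfl⟩)), hu _ (dn_mono h.le (hc.memB (by omega) (by simp [Step.B])))]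
          exact wr j h
        · rw [hu _ hr]; simp; exact hv1.2
      have SR : ∀ j ≤ k, (H j).Pairwise (fun a b => Function.update ξ (st k).w v a < Function.update ξ (st k).w v b) := by
        intro j hj
        refine (srt j hj).imp_of_mem ?_
        intro a b ha hb hab
        rw [hu a (dn_mono hj (hc.mem_dn j (by omega) a ha)), hu b (dn_mono hj (hc.mem_dn j (by omega) b hb))]
        exact hab
      refine ⟨Function.update ξ (st k).w v, ?_, ?_, ?_, ?_, LW, WR⟩
      · intro a b ha hb
        rw [dn_succ] at ha hb
        rcases ha with ha | rfl <;> rcases hb with hb | rfl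
        · rw [hu a ha, hu b hb]; exact inj a b ha hb
        · rw [hu a ha]; simp; intro h; exact (hv2 ⟨a, h⟩).elim
        · rw [hu b hb]; simp; intro h; exact (hv2 ⟨b, h.symm⟩).elim
        · simp
      · intro a ha
        rw [e0, e1]
        rw [dn_succ] at ha
        rcases ha with ha | rfl
        · rw [hu a ha]; exact bd a ha
        · have := bd _ hl
          have := bd _ hr
          have := hv1.1
          have := hv1.2
          simp; constructor <;> linarith
      · rw [e0, e1]; exact lt
      · intro j hj
        rcases Nat.le_succ_iff.1 hj with h | rfl
        · exact SR j h
        · have s' := SR k le_rfl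
          rw [hc.hpre k hkn, Step.pre, ← pw_iff, chain_pre] at s'
          rw [hc.hpost k hkn, Step.post, ← pw_iff, chain_post]
          exact ⟨s'.1, LW k (by omega), WR k (by omega), s'.2.2⟩
  exact main n le_rfl

lemma IsCan.nodup [Finite W] (hc : IsCan E f0 f1 n st H) {k : ℕ} (hk : k ≤ n) : (H k).Nodup := by
  obtain ⟨ξ, h⟩ := xi_exists hc
  refine (h.srt k hk).imp ?_
  rintro a b hab rfl
  exact lt_irrefl _ hab

lemma IsCan.f0_eq [Finite W] (hc : IsCan E f0 f1 n st H) {k : ℕ} (hk : k < n)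
    (h : f0 ∈ (st k).B) : f0 = (st k).l := by
  obtain ⟨ξ, h'⟩ := xi_exists hc
  have s := h'.srt k hk.le
  rw [hc.hpre k hk, Step.pre, ← pw_iff, chain_pre] at s
  have s := (pw_iff ξ).1 s.2.1
  rcases List.mem_cons.1 h with h | h
  · exact h
  · have := (List.pairwise_cons.1 s).1 _ h
    have := (h'.bd _ (hc.all (st k).l)).1
    linarith

lemma IsCan.f1_eq [Finite W] (hc : IsCan E f0 f1 n st H) {k : ℕ} (hk : k < n)
    (h : f1 ∈ (st k).B) : f1 = (st k).r := by
  have := hc.mirror.f0_eq hk (by simp [Step.B] at h ⊢; tauto)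
  simpa using this

lemma IsCan.l_ne [Finite W] (hc : IsCan E f0 f1 n st H) {k : ℕ} (hk : k < n) : (st k).l ≠ f1 := by
  intro h
  have := hc.f1_eq hk (by simp [Step.B, h])
  have := (hc.nodup hk.le)
  rw [hc.hpre k hk] at this
  simp [Step.pre, List.nodup_append] at this
  have := this.2.1.1.2.1
  rw [h] at this
  exact this ‹_›

lemma IsCan.alive (hc : IsCan E f0 f1 n st H) {k k' : ℕ} (hk : k ≤ k') (hk' : k' ≤ n) {x : W}
    (hd : dn f0 f1 st k x) (hx : x ∈ H k') : x ∈ H k := by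
  induction k' , hk using Nat.le_induction with
  | base => exact hx
  | succ m hm ih =>
    apply ih (by omega)
    rw [hc.hpost m (by omega)] at hx
    rw [hc.hpre m (by omega)]
    have : x ≠ (st m).w := by rintro rfl; exact hc.wnew m (by omega) (dn_mono hm hd)
    simp [Step.pre, Step.post, this] at hx ⊢
    tauto

structure IsPath (f0 f1 : W) (n : ℕ) (st : ℕ → Step W) (N : ℕ) (y : ℕ → W) (σ : ℕ → ℕ) : Prop where
  y0 : y 0 = f0 ∨ y 0 = f1
  lt : ∀ j < N, σ j < n
  yw : ∀ j < N, y (j + 1) = (st (σ j)).w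
  mem : ∀ j < N, y j ∈ (st (σ j)).B

lemma IsPath.extend {N : ℕ} {y : ℕ → W} {σ : ℕ → ℕ} (hp : IsPath f0 f1 n st N y σ) {k : ℕ}
    (hk : k < n) (hy : y N ∈ (st k).B) :
    IsPath f0 f1 n st (N + 1) (fun j => if j ≤ N then y j else (st k).w)
      (fun j => if j < N then σ j else k) := by
  refine ⟨by simpa using hp.y0, ?_, ?_, ?_⟩
  · intro j hj
    by_cases h : j < N
    · simp [h, hp.lt j h]
    · simp [h, hk]
  · intro j hj
    by_cases h : j < N
    · simp [h, hp.yw j h, Nat.succ_le_of_lt h]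
    · simp [h]
  · intro j hj
    by_cases h : j < N
    · simp [h, hp.mem j h, h.le]
    · obtain rfl : j = N := by omega
      simp [hy]

lemma IsPath.smono (hc : IsCan E f0 f1 n st H) {N : ℕ} {y : ℕ → W} {σ : ℕ → ℕ}
    (hp : IsPath f0 f1 n st N y σ) {i j : ℕ} (hij : i < j) (hj : j < N) : σ i < σ j := by
  induction j, hij using Nat.le_induction with
  | base =>
    apply hc.w_lt (hp.lt i (by omega))
    rw [← hp.yw i (by omega)]
    exact hc.memB (hp.lt _ hj) (hp.mem _ hj)
  | succ m hm ih =>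
    refine (ih (by omega)).trans ?_
    apply hc.w_lt (hp.lt m (by omega))
    rw [← hp.yw m (by omega)]
    exact hc.memB (hp.lt _ hj) (hp.mem _ hj)

/-- number of middle indices -/
def midSet (st : ℕ → Step W) (N : ℕ) (y : ℕ → W) (σ : ℕ → ℕ) : Finset ℕ :=
  (Finset.range N).filter (fun j => y j ∈ (st (σ j)).M)

@[elab_as_elim]
lemma can_cases (hc : IsCan E f0 f1 n st H) {P : W → Prop} (h0 : P f0) (h1 : P f1)
    (hs : ∀ k < n, (∀ x ∈ (st k).B, P x) → P (st k).w)  (x : W) : P x := by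
  have main : ∀ k ≤ n, ∀ x, dn f0 f1 st k x → P x := by
    intro k
    induction k with
    | zero => intro _ x hx; rcases hx with rfl | rfl | ⟨j, hj, -⟩
              · exact h0
              · exact h1
              · omega
    | succ k ih =>
      intro hk x hx
      rw [dn_succ] at hx
      rcases hx with hx | rfl
      · exact ih (by omega) x hx
      · exact hs k (by omega) (fun x hx => ih (by omega) x (hc.memB (by omega) hx))
  exact main n le_rfl x (hc.all x)

/-- the trichotomy -/
theorem tricho [Finite W] (hc : IsCan E f0 f1 n st H) (K : ℕ) :
    (∃ Ψ : W → ℕ, (∀ k < n, ∀ b ∈ (st k).B, Ψ b < Ψ (st k).w) ∧ ∀ x, Ψ x < K * (2 * K + 1)) ∨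
    (∃ N y σ, IsPath f0 f1 n st N y σ ∧ K ≤ (midSet st N y σ).card) ∨
    (∃ N y σ, IsPath f0 f1 n st N y σ ∧ K ≤ N ∧ y 0 ≠ f1 ∧ ∀ j < N, y j = (st (σ j)).l) ∨
    (∃ N y σ, IsPath f0 f1 n st N y σ ∧ K ≤ N ∧ y 0 ≠ f0 ∧ ∀ j < N, y j = (st (σ j)).r) := by
  have hlB : ∀ k, (st k).l ∈ (st k).B := fun k => by simp [Step.B]
  have hrB : ∀ k, (st k).r ∈ (st k).B := fun k => by simp [Step.B]
  have hMB : ∀ k, ∀ x ∈ (st k).M, x ∈ (st k).B := fun k x hx => by simp [Step.B, hx]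
  -- left and right parents
  obtain ⟨lf, -, -, hlf⟩ := can_rec hc f0 f0 (fun k _ => (st k).l) (by intros; rfl)
  obtain ⟨rf, -, -, hrf⟩ := can_rec hc f0 f0 (fun k _ => (st k).r) (by intros; rfl)
  obtain ⟨d1, d1a, d1b, hd1⟩ := can_rec hc 0 0 (fun k d => d (st k).l + 1)
    (by intro k hk d d' h; simp [h _ (hlB k)])
  obtain ⟨d2, d2a, d2b, hd2⟩ := can_rec hc 0 0 (fun k d => d (st k).r + 1)
    (by intro k hk d d' h; simp [h _ (hrB k)])
  obtain ⟨ρ, ρa, ρb, hρ⟩ := can_rec hc 0 0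
    (fun k d => max (((st k).M.toFinset.sup fun x => d x + 1)) (max (d (st k).l) (d (st k).r)))
    (by
      intro k hk d d' h
      have : ((st k).M.toFinset.sup fun x => d x + 1) = ((st k).M.toFinset.sup fun x => d' x + 1) := by
        apply Finset.sup_congr rfl
        intro x hx; rw [h x (hMB k x (by simpa using hx))]
      simp only [this, h _ (hlB k), h _ (hrB k)])
  have ρM : ∀ k < n, ∀ x ∈ (st k).M, ρ x < ρ (st k).w := by
    intro k hk x hx
    rw [hρ k hk]
    apply lt_of_lt_of_le _ (le_max_left _ _)
    have := Finset.le_sup (f := fun x => ρ x + 1) (List.mem_toFinset.2 hx)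
    omega
  have ρl : ∀ k < n, ρ (st k).l ≤ ρ (st k).w := by
    intro k hk; rw [hρ k hk]; exact (le_max_left _ _).trans (le_max_right _ _)
  have ρr : ∀ k < n, ρ (st k).r ≤ ρ (st k).w := by
    intro k hk; rw [hρ k hk]; exact (le_max_right _ _).trans (le_max_right _ _)
  by_cases hB : ∃ x, K ≤ ρ x
  · right; left
    obtain ⟨x, hx⟩ := hB
    have key : ∀ x, ∃ N y σ, IsPath f0 f1 n st N y σ ∧ y N = x ∧ ρ x ≤ (midSet st N y σ).card := by
      intro x
      refine can_cases hc ?_ ?_ ?_ x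
      · exact ⟨0, fun _ => f0, fun _ => 0, ⟨Or.inl rfl, by simp, by simp, by simp⟩, rfl, by simp [ρa]⟩
      · exact ⟨0, fun _ => f1, fun _ => 0, ⟨Or.inr rfl, by simp, by simp, by simp⟩, rfl, by simp [ρb]⟩
      · intro k hk ih
        have : ∃ x ∈ (st k).B, ρ (st k).w ≤ ρ x + (if x ∈ (st k).M then 1 else 0) := by
          rw [hρ k hk]
          rcases max_choice (((st k).M.toFinset.sup fun x => ρ x + 1)) (max (ρ (st k).l) (ρ (st k).r)) with h | h
          · rw [h]
            by_cases hne : (st k).M.toFinset.Nonempty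
            · obtain ⟨x, hx, he⟩ := Finset.exists_mem_eq_sup _ hne (fun x => ρ x + 1)
              rw [he]
              rw [List.mem_toFinset] at hx
              exact ⟨x, hMB k x hx, by simp [hx]⟩
            · rw [Finset.not_nonempty_iff_eq_empty] at hne
              rw [hne]; exact ⟨_, hlB k, by simp⟩
          · rw [h]
            rcases max_choice (ρ (st k).l) (ρ (st k).r) with h | h
            · rw [h]; exact ⟨_, hlB k, by simp⟩
            · rw [h]; exact ⟨_, hrB k, by simp⟩
        obtain ⟨x, hxB, hx⟩ := this
        obtain ⟨N, y, σ, hp, rfl, hcard⟩ := ih x hxB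
        refine ⟨N + 1, _, _, hp.extend hk hxB, by simp, hx.trans ?_⟩
        have hsub : midSet st N y σ ⊆ midSet st (N + 1) (fun j => if j ≤ N then y j else (st k).w)
            (fun j => if j < N then σ j else k) := by
          intro j hj
          simp [midSet] at hj ⊢
          refine ⟨by omega, ?_⟩
          simp [hj.1, hj.1.le, hj.2]
        by_cases hm : y N ∈ (st k).M
        · have : insert N (midSet st N y σ) ⊆ midSet st (N + 1) (fun j => if j ≤ N then y j else (st k).w)
            (fun j => if j < N then σ j else k) := by
            apply Finset.insert_subset _ hsub
            simp [midSet, hm]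
          have := Finset.card_le_card this
          rw [Finset.card_insert_of_notMem (by simp [midSet])] at this
          simp [hm]; omega
        · have := Finset.card_le_card hsub
          simp [hm]; omega
    obtain ⟨N, y, σ, hp, -, hN⟩ := key x
    exact ⟨N, y, σ, hp, hx.trans hN⟩
  by_cases hC : ∃ x, x ≠ f1 ∧ K ≤ d1 x
  · right; right; left
    obtain ⟨x, hx1, hx⟩ := hC
    have key : ∀ x, x ≠ f1 → ∃ N y σ, IsPath f0 f1 n st N y σ ∧ y N = x ∧ d1 x = N ∧ y 0 ≠ f1 ∧
        ∀ j < N, y j = (st (σ j)).l := by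
      intro x
      refine can_cases hc ?_ ?_ ?_ x
      · intro h
        exact ⟨0, fun _ => f0, fun _ => 0, ⟨Or.inl rfl, by simp, by simp, by simp⟩, rfl, d1a, h, by simp⟩
      · intro h; exact (h rfl).elim
      · intro k hk ih _
        obtain ⟨N, y, σ, hp, hy, hcard, hne, hj⟩ := ih (st k).l (hlB k) (hc.l_ne hk)
        refine ⟨N + 1, _, _, hp.extend hk (by rw [hy]; exact hlB k), by simp, by rw [hd1 k hk, hcard], by simpa using hne, ?_⟩
        intro j hj'
        by_cases h : j < N
        · simp [h, h.le, hj j h]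
        · obtain rfl : j = N := by omega
          simp [hy]
    obtain ⟨N, y, σ, hp, -, hN, h1, h2⟩ := key x hx1
    exact ⟨N, y, σ, hp, hN ▸ hx, h1, h2⟩
  have l_ne0 : ∀ k < n, (st k).r ≠ f0 := fun k hk => hc.mirror.l_ne hk
  by_cases hD : ∃ x, x ≠ f0 ∧ K ≤ d2 x
  · right; right; right
    obtain ⟨x, hx1, hx⟩ := hD
    have key : ∀ x, x ≠ f0 → ∃ N y σ, IsPath f0 f1 n st N y σ ∧ y N = x ∧ d2 x = N ∧ y 0 ≠ f0 ∧
        ∀ j < N, y j = (st (σ j)).r := by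
      intro x
      refine can_cases hc ?_ ?_ ?_ x
      · intro h; exact (h rfl).elim
      · intro h
        exact ⟨0, fun _ => f1, fun _ => 0, ⟨Or.inr rfl, by simp, by simp, by simp⟩, rfl, d2b, h, by simp⟩
      · intro k hk ih _
        obtain ⟨N, y, σ, hp, hy, hcard, hne, hj⟩ := ih (st k).r (hrB k) (l_ne0 k hk)
        refine ⟨N + 1, _, _, hp.extend hk (by rw [hy]; exact hrB k), by simp, by rw [hd2 k hk, hcard], by simpa using hne, ?_⟩
        intro j hj'
        by_cases h : j < N
        · simp [h, h.le, hj j h]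
        · obtain rfl : j = N := by omega
          simp [hy]
    obtain ⟨N, y, σ, hp, -, hN, h1, h2⟩ := key x hx1
    exact ⟨N, y, σ, hp, hN ▸ hx, h1, h2⟩
  left
  push Not at hB hC hD
  have wf0 : ∀ k < n, (st k).w ≠ f0 := fun k hk h => hc.wnew k hk (Or.inl h)
  have wf1 : ∀ k < n, (st k).w ≠ f1 := fun k hk h => hc.wnew k hk (Or.inr (Or.inl h))
  -- invariants
  have I : ∀ k ≤ n, (H k).IsChain (fun u x =>
      (u ≠ f0 → ρ (rf u) ≤ ρ x ∧ (ρ (rf u) < ρ x ∨ d2 (rf u) ≤ d2 x)) ∧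
      (x ≠ f1 → ρ (lf x) ≤ ρ u ∧ (ρ (lf x) < ρ u ∨ d1 (lf x) ≤ d1 u))) := by
    intro k
    induction k with
    | zero => intro _; rw [hc.h0]; simp
    | succ k ih =>
      intro hk
      have hkn : k < n := by omega
      have ih := ih (by omega)
      rw [hc.hpre k hkn, Step.pre, chain_pre] at ih
      rw [hc.hpost k hkn, Step.post, chain_post]
      refine ⟨ih.1, ⟨?_, ?_⟩, ⟨?_, ?_⟩, ih.2.2⟩
      · intro hl
        have i2 := ih.2.1
        rcases hM : (st k).M with _ | ⟨x, M'⟩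
        · simp [hM] at i2
          have := i2.1 hl
          have := ρr k hkn
          have := hd2 k hkn
          omega
        · simp [hM] at i2
          have := i2.1.1 hl
          have := ρM k hkn x (by simp [hM])
          omega
      · intro _
        rw [hlf k hkn]; exact ⟨le_rfl, Or.inr le_rfl⟩
      · intro _
        rw [hrf k hkn]; exact ⟨le_rfl, Or.inr le_rfl⟩
      · intro hr
        have i2 := ih.2.1
        rcases List.eq_nil_or_concat (st k).M with hM | ⟨M', x, hM⟩
        · simp [hM] at i2
          have := i2.2 hr
          have := ρl k hkn
          have := hd1 k hkn
          omega
        · have e : (st k).l :: ((st k).M ++ [(st k).r]) = ((st k).l :: M') ++ x :: [(st k).r] := by simp [hM]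
          rw [e, List.isChain_split] at i2
          simp at i2
          have := i2.2.2 hr
          have := ρM k hkn x (by simp [hM])
          omega
  let α : W → ℕ := fun z => if z = f0 ∨ z = f1 then 0 else if ρ (lf z) = ρ z then d1 (lf z) + 1 else 0
  let β : W → ℕ := fun z => if z = f0 ∨ z = f1 then 0 else if ρ (rf z) = ρ z then d2 (rf z) + 1 else 0
  have αw : ∀ k < n, α (st k).w = if ρ (st k).l = ρ (st k).w then d1 (st k).l + 1 else 0 := by
    intro k hk; simp [α, wf0 k hk, wf1 k hk, hlf k hk]
  have βw : ∀ k < n, β (st k).w = if ρ (st k).r = ρ (st k).w then d2 (st k).r + 1 else 0 := by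
    intro k hk; simp [β, wf0 k hk, wf1 k hk, hrf k hk]
  have αK : ∀ x, α x ≤ K := by
    intro x
    rcases hc.all x with rfl | rfl | ⟨k, hk, rfl⟩
    · simp [α]
    · simp [α]
    · rw [αw k hk]
      have := hC (st k).l (hc.l_ne hk)
      split_ifs <;> omega
  have βK : ∀ x, β x ≤ K := by
    intro x
    rcases hc.all x with rfl | rfl | ⟨k, hk, rfl⟩
    · simp [β]
    · simp [β]
    · rw [βw k hk]
      have := hD (st k).r (l_ne0 k hk)
      split_ifs <;> omega
  have αd : ∀ x, x ≠ f1 → α x ≤ d1 x := by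
    intro x hx
    rcases hc.all x with rfl | rfl | ⟨k, hk, rfl⟩
    · simp [α]
    · simp [α]
    · rw [αw k hk, hd1 k hk]; split_ifs <;> omega
  have βd : ∀ x, x ≠ f0 → β x ≤ d2 x := by
    intro x hx
    rcases hc.all x with rfl | rfl | ⟨k, hk, rfl⟩
    · simp [β]
    · simp [β]
    · rw [βw k hk, hd2 k hk]; split_ifs <;> omega
  have step : ∀ a b : ℕ, a < b → a * (2 * K + 1) + (2 * K + 1) ≤ b * (2 * K + 1) := by
    intro a b hab; nlinarith
  refine ⟨fun x => ρ x * (2 * K + 1) + α x + β x, ?_, ?_⟩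
  · intro k hk b hb
    rcases (show ρ b ≤ ρ (st k).w from by
      simp [Step.B] at hb
      rcases hb with rfl | hb | rfl
      · exact ρl k hk
      · exact (ρM k hk b hb).le
      · exact ρr k hk).lt_or_eq with hlt | heq
    · have := step _ _ hlt
      have := αK b
      have := βK b
      simp only; omega
    have i2 := I k hk.le
    rw [hc.hpre k hk, Step.pre, chain_pre] at i2
    have i2 := i2.2.1
    simp [Step.B] at hb
    rcases hb with rfl | hb | rfl
    · have h1 : α (st k).l < α (st k).w := by
        rw [αw k hk, if_pos heq]; have := αd _ (hc.l_ne hk); omega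
      have h2 : β (st k).l ≤ β (st k).w := by
        by_cases hl0 : (st k).l = f0
        · simp [hl0, β]
        rcases hM : (st k).M with _ | ⟨x, M'⟩
        · simp [hM] at i2
          have i3 := i2.1 hl0
          rw [βw k hk]
          simp only [β, hl0, hc.l_ne hk, or_self, if_false]
          have := ρr k hk
          split_ifs <;> omega
        · simp [hM] at i2
          have i3 := i2.1.1 hl0
          have := ρM k hk x (by simp [hM])
          simp only [β, hl0, hc.l_ne hk, or_self, if_false]
          split_ifs <;> omega
      simp only [heq]; omega
    · exact absurd heq (ρM k hk b hb).ne
    · have h1 : β (st k).r < β (st k).w := by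
        rw [βw k hk, if_pos heq]; have := βd _ (l_ne0 k hk); omega
      have h2 : α (st k).r ≤ α (st k).w := by
        by_cases hr0 : (st k).r = f1
        · simp [hr0, α]
        rcases List.eq_nil_or_concat (st k).M with hM | ⟨M', x, hM⟩
        · simp [hM] at i2
          have i3 := i2.2 hr0
          rw [αw k hk]
          simp only [α, hr0, l_ne0 k hk, or_self, if_false]
          have := ρl k hk
          split_ifs <;> omega
        · have e : (st k).l :: ((st k).M ++ [(st k).r]) = ((st k).l :: M') ++ x :: [(st k).r] := by simp [hM]
          rw [e, List.isChain_split] at i2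
          simp at i2
          have i3 := i2.2.2 hr0
          have := ρM k hk x (by simp [hM])
          simp only [α, hr0, l_ne0 k hk, or_self, if_false]
          split_ifs <;> omega
      simp only [heq]; omega
  · intro x
    have h1 := step _ _ (hB x)
    have h2 := αK x
    have h3 := βK x
    simp only; omega

end

end

end FP


namespace FP

noncomputable section

open Classical Filter

lemma ext_mono {ι : Type*} (T : Finset ι) (k v : ι → ℝ) (hk : ∀ a ∈ T, ∀ b ∈ T, k a = k b → a = b)
    (h : ∀ a ∈ T, ∀ b ∈ T, k a < k b → v a < v b) :
    ∃ g : ℝ → ℝ, StrictMono g ∧ ∀ a ∈ T, g (k a) = v a := by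
  induction T using Finset.induction_on_max_value k with
  | empty => exact ⟨id, strictMono_id, by simp⟩
  | insert a s ha hmax ih =>
    obtain ⟨g, hg, hgv⟩ := ih (fun a ha b hb => hk a (by simp [ha]) b (by simp [hb]))
      (fun a ha b hb => h a (by simp [ha]) b (by simp [hb]))
    rcases s.eq_empty_or_nonempty with rfl | hne
    · refine ⟨fun x => x + (v a - k a), fun x y hxy => by simp; exact hxy, ?_⟩
      intro b hb; simp at hb; subst hb; simp
    · obtain ⟨b, hb, hbm⟩ := Finset.exists_max_image s k hne
      have hlt : k b < k a := by
        rcases (hmax b hb).lt_or_eq with h' | h'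
        · exact h'
        · have := hk b (by simp [hb]) a (by simp) h'
          subst this; exact (ha hb).elim
      have hv := h b (by simp [hb]) a (by simp) hlt
      have hsl : 0 < (v a - v b) / (k a - k b) := div_pos (by linarith) (by linarith)
      refine ⟨fun x => if x ≤ k b then g x else v b + (x - k b) * ((v a - v b) / (k a - k b)), ?_, ?_⟩
      · intro x y hxy
        simp only
        split_ifs with h1 h2 h2
        · exact hg hxy
        · have : g x ≤ v b := by rw [← hgv b hb]; exact hg.monotone h1
          have := mul_pos (sub_pos.2 (not_le.1 h2)) hsl
          linarith
        · exact (h1 (hxy.le.trans h2)).elim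
        · have := mul_lt_mul_of_pos_right (sub_lt_sub_right hxy (k b)) hsl
          linarith
      · intro c hc
        rcases Finset.mem_insert.1 hc with rfl | hc
        · have : k c - k b ≠ 0 := by linarith
          simp only [not_le.2 hlt, if_false]
          field_simp; ring
        · simp only [hbm c hc, if_true]; exact hgv c hc

section
variable {W : Type*} {E : SimpleGraph W} {f0 f1 : W} {n : ℕ} {st : ℕ → Step W} {H : ℕ → List W}

lemma posA {D R C Λ x0 x1 xw c0 c1 cw : ℝ} {p p0 p1 : ℕ} (hD : D = x1 - x0) (hD0 : 0 < D)
    (hR : |xw - x0| ≤ R) (h0 : |c0| ≤ C) (h1 : |c1| ≤ C) (hw : |cw| ≤ C) (hΛ1 : 1 ≤ Λ)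
    (hΛ : (1 + 2 * C) * R + D * (1 + 2 * C) < D * Λ) (e0 : p0 < p) (e1 : p1 < p) :
    0 < orient (x0, Λ ^ p0 + c0) (x1, Λ ^ p1 + c1) (xw, Λ ^ p + cw) := by
  obtain ⟨m, rfl⟩ : ∃ m, p = m + 1 := ⟨p - 1, by omega⟩
  have hC : 0 ≤ C := (abs_nonneg _).trans h0
  have hR0 : 0 ≤ R := (abs_nonneg _).trans hR
  have a0 : Λ ^ p0 ≤ Λ ^ m := pow_le_pow_right₀ hΛ1 (by omega)
  have a1 : Λ ^ p1 ≤ Λ ^ m := pow_le_pow_right₀ hΛ1 (by omega)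
  have b0 : 1 ≤ Λ ^ p0 := one_le_pow₀ hΛ1
  have b1 : 1 ≤ Λ ^ p1 := one_le_pow₀ hΛ1
  have b2 : 1 ≤ Λ ^ m := one_le_pow₀ hΛ1
  rw [abs_le] at h0 h1 hw
  have k1 : |Λ ^ p1 + c1 - (Λ ^ p0 + c0)| ≤ Λ ^ m * (1 + 2 * C) := by
    rw [abs_le]; constructor <;> nlinarith
  have k2 : (Λ ^ p1 + c1 - (Λ ^ p0 + c0)) * (xw - x0) ≤ Λ ^ m * (1 + 2 * C) * R := by
    refine (le_abs_self _).trans ?_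
    rw [abs_mul]
    exact mul_le_mul k1 hR (abs_nonneg _) (by positivity)
  have k3 : Λ ^ m * (Λ - 1 - 2 * C) ≤ Λ ^ (m + 1) + cw - (Λ ^ p0 + c0) := by
    rw [pow_succ]; nlinarith
  have k4 : D * (Λ ^ m * (Λ - 1 - 2 * C)) ≤ D * (Λ ^ (m + 1) + cw - (Λ ^ p0 + c0)) :=
    mul_le_mul_of_nonneg_left k3 hD0.le
  have k5 : 0 < Λ ^ m * (D * Λ - ((1 + 2 * C) * R + D * (1 + 2 * C))) :=
    mul_pos (by linarith) (by linarith)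
  unfold orient
  simp only
  rw [← hD]
  nlinarith

theorem drawA [Finite W] (hc : IsCan E f0 f1 n st H) {ξ0 : W → ℝ} (hξ : Xi f0 f1 st H n ξ0)
    {Ψ : W → ℕ} (hΨ : ∀ k < n, ∀ b ∈ (st k).B, Ψ b < Ψ (st k).w) (T : Finset W) (m : ℕ)
    (hT : ∀ v ∈ T, Ψ v = m) (q : W → ℝ × ℝ)
    (hq : ∀ a ∈ T, ∀ b ∈ T, ξ0 a < ξ0 b → (q a).1 < (q b).1) :
    ∃ (δ : W → ℝ × ℝ) (c0 : ℝ), PlaneD E δ ∧ ∀ v ∈ T, δ v = ((q v).1, (q v).2 + c0) := by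
  obtain ⟨g, hg, hgv⟩ := ext_mono T ξ0 (fun v => (q v).1)
    (fun a _ b _ => hξ.inj a b (hc.all a) (hc.all b)) hq
  let c : W → ℝ := fun v => if v ∈ T then (q v).2 else 0
  obtain ⟨C, hC⟩ := (Set.finite_range (fun v => |c v|)).bddAbove
  obtain ⟨R, hR⟩ := (Set.finite_range (fun v : W × W => |g (ξ0 v.1) - g (ξ0 v.2)|)).bddAbove
  have ev : ∀ᶠ Λ : ℝ in atTop, ∀ v : W × W, g (ξ0 v.1) < g (ξ0 v.2) →
      (1 + 2 * C) * R + (g (ξ0 v.2) - g (ξ0 v.1)) * (1 + 2 * C) < (g (ξ0 v.2) - g (ξ0 v.1)) * Λ := by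
    rw [eventually_all]
    intro v
    by_cases h : g (ξ0 v.1) < g (ξ0 v.2)
    · have hd := sub_pos.2 h
      filter_upwards [eventually_gt_atTop (((1 + 2 * C) * R + (g (ξ0 v.2) - g (ξ0 v.1)) * (1 + 2 * C)) / (g (ξ0 v.2) - g (ξ0 v.1)))] with Λ hΛ _
      rw [div_lt_iff₀ hd] at hΛ; linarith
    · simp [h]
  obtain ⟨Λ, h1, h2⟩ := (ev.and (eventually_ge_atTop 1)).exists
  refine ⟨fun v => (g (ξ0 v), Λ ^ Ψ v + c v), Λ ^ m, ?_, ?_⟩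
  · apply criterion hc
    · exact hg hξ.lt
    · intro k hk; exact ⟨hg (hξ.lw k hk), hg (hξ.wr k hk)⟩
    · intro k hk
      have s := hξ.srt k hk.le
      rw [hc.hpre k hk, Step.pre, ← pw_iff, chain_pre] at s
      have s := (pw_iff _).1 s.2.1
      refine (s.imp_of_mem ?_).isChain
      intro a b ha hb hab
      exact posA rfl (sub_pos.2 (hg hab)) (hR ⟨((st k).w, a), rfl⟩) (hC ⟨a, rfl⟩) (hC ⟨b, rfl⟩)
        (hC ⟨_, rfl⟩) h2 (h1 (a, b) (hg hab)) (hΨ k hk a ha) (hΨ k hk b hb)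
  · intro v hv
    ext
    · exact hgv v hv
    · simp [hT v hv, c, hv]; ring

end

end

end FP


namespace FP

noncomputable section

open Classical Filter Topology

def Ab (a b P : ℝ × ℝ) : Prop := 0 < (b.1 - a.1) * orient a b P

lemma Ab_symm {a b P : ℝ × ℝ} : Ab a b P ↔ Ab b a P := by
  unfold Ab orient
  have : (b.1 - a.1) * ((b.1 - a.1) * (P.2 - a.2) - (b.2 - a.2) * (P.1 - a.1)) =
    (a.1 - b.1) * ((a.1 - b.1) * (P.2 - b.2) - (a.2 - b.2) * (P.1 - b.1)) := by ring
  rw [this]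

lemma Ab_sg {a b P : ℝ × ℝ} : Ab (sg a) (sg b) (sg P) ↔ Ab a b P := by
  unfold Ab orient sg
  simp only
  have : (-b.1 - -a.1) * ((-b.1 - -a.1) * (P.2 - a.2) - (b.2 - a.2) * (-P.1 - -a.1)) =
    (b.1 - a.1) * ((b.1 - a.1) * (P.2 - a.2) - (b.2 - a.2) * (P.1 - a.1)) := by ring
  rw [this]

lemma Ab_pos {a b P : ℝ × ℝ} (h : a.1 < b.1) : Ab a b P ↔ 0 < orient a b P := by
  unfold Ab
  exact mul_pos_iff_of_pos_left (sub_pos.2 h)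

/-- the supremum of the relevant lines -/
lemma top_line (e : ℝ × ℝ) : ∀ (L : List (ℝ × ℝ)) (c : ℝ × ℝ),
    (c :: L).IsChain (fun a b => a.1 < b.1) →
    ∃ L0 : ℝ, e.2 ≤ L0 ∧ (L0 = e.2 ∨ ∃ a ∈ c :: L, ∃ b ∈ c :: L, a.1 < b.1 ∧ orient a b (e.1, L0) = 0) ∧
      (c :: L).IsChain (fun a b => 0 ≤ orient a b (e.1, L0)) := by
  intro L
  induction L with
  | nil => intro c _; exact ⟨e.2, le_rfl, Or.inl rfl, by simp⟩
  | cons d L ih =>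
    intro c hs
    rw [List.isChain_cons_cons] at hs
    obtain ⟨L0, h1, h2, h3⟩ := ih d hs.2
    have hd : 0 < d.1 - c.1 := sub_pos.2 hs.1
    have hor : ∀ y : ℝ, orient c d (e.1, y) = (d.1 - c.1) * (y - (c.2 + (d.2 - c.2) * (e.1 - c.1) / (d.1 - c.1))) := by
      intro y; unfold orient; simp only; field_simp; ring
    by_cases h : 0 ≤ orient c d (e.1, L0)
    · refine ⟨L0, h1, ?_, List.isChain_cons_cons.2 ⟨h, h3⟩⟩
      rcases h2 with h2 | ⟨a, ha, b, hb, hab⟩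
      · exact Or.inl h2
      · exact Or.inr ⟨a, List.mem_cons_of_mem _ ha, b, List.mem_cons_of_mem _ hb, hab⟩
    · push Not at h
      rw [hor] at h
      have h' := neg_of_mul_neg_right h hd.le
      refine ⟨c.2 + (d.2 - c.2) * (e.1 - c.1) / (d.1 - c.1), by linarith, Or.inr ⟨c, by simp, d, by simp, hs.1, by rw [hor]; simp⟩, ?_⟩
      rw [List.isChain_cons_cons]
      refine ⟨by rw [hor]; simp, ?_⟩
      have hp := srt_pw hs.2
      have : (d :: L).IsChain (fun a b => a.1 < b.1 ∧ 0 ≤ orient a b (e.1, L0)) := by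
        rw [List.isChain_iff_getElem] at h3 ⊢
        have hs2 := List.isChain_iff_getElem.1 hs.2
        exact fun i hi => ⟨hs2 i hi, h3 i hi⟩
      refine this.imp ?_
      intro a b ⟨hab, ho⟩
      have : orient a b (e.1, c.2 + (d.2 - c.2) * (e.1 - c.1) / (d.1 - c.1)) = orient a b (e.1, L0) +
          (b.1 - a.1) * (c.2 + (d.2 - c.2) * (e.1 - c.1) / (d.1 - c.1) - L0) := by
        unfold orient; simp only; ring
      rw [this]
      have := mul_pos (sub_pos.2 hab) (show 0 < c.2 + (d.2 - c.2) * (e.1 - c.1) / (d.1 - c.1) - L0 by linarith)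
      linarith

lemma lineE {a e c d P : ℝ × ℝ} {L0 : ℝ} (hcd : c.1 < d.1) (hde : d.1 ≤ e.1) (heP : e.1 < P.1)
    (hL : e.2 ≤ L0) (h0 : orient c d (e.1, L0) = 0) (hP : Ab c d P)
    (hae : Ab a e P) (had : a ≠ d → Ab a d P)
    (ha : a.1 ≤ c.1 ∨ e.1 < a.1) : Ab a (e.1, L0) P := by
  rw [Ab_pos hcd] at hP
  have id1 : (d.1 - c.1) * orient a (e.1, L0) P = (e.1 - a.1) * orient c d P + orient c d a * (P.1 - e.1)
      + orient c d (e.1, L0) * (a.1 - P.1) := by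
    unfold orient; simp only; ring
  rw [h0] at id1
  have id2 : (d.1 - c.1) * orient a d P = (d.1 - a.1) * orient c d P + orient c d a * (P.1 - d.1) := by
    unfold orient; ring
  have hcd' := sub_pos.2 hcd
  rcases ha with ha | ha
  · rw [Ab_pos (by simp; linarith)]
    have hd := had (by rintro rfl; linarith)
    rw [Ab_pos (by linarith)] at hd
    suffices h : 0 < (d.1 - c.1) * orient a (e.1, L0) P from (mul_pos_iff_of_pos_left hcd').1 h
    have hd' := mul_pos hcd' hd
    rw [id2] at hd'
    rw [id1]
    rcases le_or_gt 0 (orient c d a) with h | h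
    · have := mul_nonneg h (sub_nonneg.2 heP.le)
      have := mul_pos (sub_pos.2 (show a.1 < e.1 by linarith)) hP
      linarith
    · nlinarith
  · have hlt : (e.1, L0).1 < a.1 := ha
    rw [Ab_symm, Ab_pos hlt]
    have hsw : ∀ b : ℝ × ℝ, orient b a P = - orient a b P := by intro b; unfold orient; ring
    have hd := had (by rintro rfl; linarith)
    rw [Ab_symm, Ab_pos (by linarith), hsw] at hd
    rw [Ab_symm, Ab_pos ha, hsw] at hae
    rw [hsw]
    rcases le_or_gt a.1 P.1 with hPa | hPa
    · have : orient a (e.1, L0) P = orient a e P - (L0 - e.2) * (P.1 - a.1) := by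
        unfold orient; simp only; ring
      rw [this]
      have := mul_nonneg (sub_nonneg.2 hL) (sub_nonneg.2 hPa)
      linarith
    · suffices h : (d.1 - c.1) * orient a (e.1, L0) P < 0 by
        have := neg_of_mul_neg_right h hcd'.le
        linarith
      have hd' : (d.1 - c.1) * orient a d P < 0 := by
        have := mul_pos hcd' hd; linarith
      rw [id2] at hd'
      rw [id1]
      rcases le_or_gt (orient c d a) (orient c d P) with h | h
      · nlinarith
      · nlinarith

lemma Ab_cont {a v0 P : ℝ × ℝ} (h : Ab a v0 P) {f : ℝ → ℝ × ℝ} (hf : Continuous f) (h0 : f 0 = v0) :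
    ∀ᶠ t in 𝓝[>] (0 : ℝ), Ab a (f t) P := by
  have : ContinuousAt (fun t => ((f t).1 - a.1) * orient a (f t) P) 0 := by
    apply Continuous.continuousAt
    unfold orient
    fun_prop
  have h' : 0 < ((f 0).1 - a.1) * orient a (f 0) P := by rw [h0]; exact h
  exact (this.eventually_const_lt h').filter_mono nhdsWithin_le_nhds

lemma insL {l r : ℝ × ℝ} {M : List (ℝ × ℝ)}
    (hs : (l :: (M ++ [r])).IsChain (fun a b => a.1 < b.1))
    (Con : Set ((ℝ × ℝ) × (ℝ × ℝ))) (hfin : Con.Finite)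
    (h1 : ∀ x ∈ Con, ∀ c ∈ l :: M, c.1 < x.2.1)
    (h2 : ∀ x ∈ Con, ∀ c ∈ l :: M, c ≠ x.1 → Ab x.1 c x.2)
    (h3 : ∀ x ∈ Con, ∀ c ∈ l :: M, ∀ d ∈ l :: M, c ≠ d → Ab c d x.2)
    (h4 : ∀ x ∈ Con, x.1 = l → Ab l r x.2)
    (h5 : ∀ x ∈ Con, x.1 ∉ M ∧ (x.1.1 ≤ l.1 ∨ ∀ c ∈ l :: M, c.1 < x.1.1)) :
    ∃ v : ℝ × ℝ, l.1 < v.1 ∧ v.1 < r.1 ∧ (∀ x ∈ Con, v.1 < x.2.1 ∧ Ab x.1 v x.2) ∧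
      (l :: (M ++ [r])).IsChain (fun a b => 0 < orient a b v) := by
  rcases List.eq_nil_or_concat M with rfl | ⟨M0, e, hMe⟩
  · have hlr : l.1 < r.1 := by simpa using hs
    let f : ℝ → ℝ × ℝ := fun t => (l.1 + t * (r.1 - l.1), l.2 + t * (r.2 - l.2) + t ^ 2)
    have hf : Continuous f := by unfold f; fun_prop
    have hf0 : f 0 = l := by ext <;> simp [f]
    have ev : ∀ᶠ t in 𝓝[>] (0 : ℝ), ∀ x ∈ Con, (f t).1 < x.2.1 ∧ Ab x.1 (f t) x.2 := by
      rw [hfin.eventually_all]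
      intro x hx
      have hA : ∀ᶠ t in 𝓝[>] (0 : ℝ), (f t).1 < x.2.1 := by
        have : ContinuousAt (fun t => (f t).1) 0 := by
          apply Continuous.continuousAt; fun_prop
        have h' : (f 0).1 < x.2.1 := by rw [hf0]; exact h1 x hx l (by simp)
        exact (this.eventually_lt_const h').filter_mono nhdsWithin_le_nhds
      refine hA.and ?_
      by_cases hxl : x.1 = l
      · have h := h4 x hx hxl
        rw [Ab_pos hlr] at h
        have : ContinuousAt (fun t : ℝ => orient l r x.2 - t * (x.2.1 - l.1)) 0 := by
          apply Continuous.continuousAt; fun_prop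
        have h' : 0 < orient l r x.2 - 0 * (x.2.1 - l.1) := by simpa using h
        filter_upwards [(this.eventually_const_lt h').filter_mono nhdsWithin_le_nhds, self_mem_nhdsWithin] with t ht ht0
        have ht0 : 0 < t := ht0
        rw [hxl]
        have e : (f t).1 - l.1 = t * (r.1 - l.1) := by simp [f]
        have e2 : orient l (f t) x.2 = t * (orient l r x.2 - t * (x.2.1 - l.1)) := by
          simp [f, orient]; ring
        unfold Ab
        rw [e, e2]
        exact mul_pos (mul_pos ht0 (sub_pos.2 hlr)) (mul_pos ht0 ht)
      · exact Ab_cont (h2 x hx l (by simp) (fun h => hxl h.symm)) hf hf0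
    have ev1 : ∀ᶠ t in 𝓝[>] (0 : ℝ), t < 1 :=
      (eventually_lt_nhds (by norm_num : (0:ℝ) < 1)).filter_mono nhdsWithin_le_nhds
    obtain ⟨t, ⟨ht1, ht2⟩, ht0⟩ := ((ev.and ev1).and self_mem_nhdsWithin).exists
    have ht0 : 0 < t := ht0
    have hd := sub_pos.2 hlr
    refine ⟨f t, ?_, ?_, ht1, ?_⟩
    · simp [f]; positivity
    · simp [f]; nlinarith
    · have e2 : orient l r (f t) = (r.1 - l.1) * t ^ 2 := by simp [f, orient]; ring
      simp [e2]; positivity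
  · subst hMe
    simp only [List.concat_eq_append] at *
    have hs1 : (l :: (M0 ++ [e])).IsChain (fun a b => a.1 < b.1) ∧ e.1 < r.1 := by
      have e' : l :: (M0 ++ [e] ++ [r]) = (l :: M0) ++ e :: [r] := by simp
      rw [e', List.isChain_split] at hs
      simpa using hs
    obtain ⟨hs1, her⟩ := hs1
    have hle : l.1 < e.1 := (List.pairwise_cons.1 (srt_pw hs1)).1 e (by simp)
    have hce : ∀ c ∈ l :: (M0 ++ [e]), c.1 ≤ e.1 := fun c hc => (B_bds hs1 c hc).2
    have hlc : ∀ c ∈ l :: (M0 ++ [e]), l.1 ≤ c.1 := fun c hc => (B_bds hs1 c hc).1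
    obtain ⟨L0, hL1, hL2, hL3⟩ := top_line e _ _ hs1
    let f : ℝ → ℝ × ℝ := fun t => (e.1, L0 + t)
    have hf : Continuous f := by unfold f; fun_prop
    have hf0 : f 0 = (e.1, L0) := by ext <;> simp [f]
    have ev : ∀ᶠ t in 𝓝[>] (0 : ℝ), ∀ x ∈ Con, Ab x.1 (f t) x.2 := by
      rw [hfin.eventually_all]
      intro x hx
      refine Ab_cont ?_ hf hf0
      obtain ⟨h5a, h5b⟩ := h5 x hx
      have hxe : Ab x.1 e x.2 := h2 x hx e (by simp) (by rintro rfl; exact h5a (by simp))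
      rcases hL2 with h | ⟨c, hc, d, hd, hcd, h0⟩
      · rw [h]; exact hxe
      · refine lineE hcd (hce d hd) (h1 x hx e (by simp)) hL1 h0 (h3 x hx c hc d hd ?_) hxe
          (fun hne => h2 x hx d hd hne.symm) ?_
        · rintro rfl; exact lt_irrefl _ hcd
        · rcases h5b with h | h
          · exact Or.inl (h.trans (hlc c hc))
          · exact Or.inr (h e (by simp))
    obtain ⟨t, ht, ht0⟩ := (ev.and self_mem_nhdsWithin).exists
    have ht0 : 0 < t := ht0
    refine ⟨f t, hle, her, fun x hx => ⟨h1 x hx e (by simp), ht x hx⟩, ?_⟩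
    have e' : l :: (M0 ++ [e] ++ [r]) = (l :: M0) ++ e :: [r] := by simp
    rw [e', List.isChain_split]
    constructor
    · have : (l :: (M0 ++ [e])).IsChain (fun a b => a.1 < b.1 ∧ 0 ≤ orient a b (e.1, L0)) := by
        rw [List.isChain_iff_getElem] at hL3 ⊢
        have hs2 := List.isChain_iff_getElem.1 hs1
        exact fun i hi => ⟨hs2 i hi, hL3 i hi⟩
      simp only [List.cons_append]
      refine this.imp ?_
      intro a b ⟨hab, ho⟩
      have e : orient a b (f t) = orient a b (e.1, L0) + (b.1 - a.1) * t := by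
        simp [f, orient]; ring
      rw [e]
      have := mul_pos (sub_pos.2 hab) ht0
      linarith
    · have e2 : orient e r (f t) = (r.1 - e.1) * (L0 - e.2 + t) := by simp only [f, orient]; ring
      simp [e2]
      exact mul_pos (sub_pos.2 her) (by linarith)

lemma sg_sg (p : ℝ × ℝ) : sg (sg p) = p := by ext <;> simp [sg]

lemma insR {l r : ℝ × ℝ} {M : List (ℝ × ℝ)}
    (hs : (l :: (M ++ [r])).IsChain (fun a b => a.1 < b.1))
    (Con : Set ((ℝ × ℝ) × (ℝ × ℝ))) (hfin : Con.Finite)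
    (h1 : ∀ x ∈ Con, ∀ c ∈ r :: M, x.2.1 < c.1)
    (h2 : ∀ x ∈ Con, ∀ c ∈ r :: M, c ≠ x.1 → Ab x.1 c x.2)
    (h3 : ∀ x ∈ Con, ∀ c ∈ r :: M, ∀ d ∈ r :: M, c ≠ d → Ab c d x.2)
    (h4 : ∀ x ∈ Con, x.1 = r → Ab r l x.2)
    (h5 : ∀ x ∈ Con, x.1 ∉ M ∧ (r.1 ≤ x.1.1 ∨ ∀ c ∈ r :: M, x.1.1 < c.1)) :
    ∃ v : ℝ × ℝ, l.1 < v.1 ∧ v.1 < r.1 ∧ (∀ x ∈ Con, x.2.1 < v.1 ∧ Ab x.1 v x.2) ∧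
      (l :: (M ++ [r])).IsChain (fun a b => 0 < orient a b v) := by
  have e : (sg r :: ((M.map sg).reverse ++ [sg l])) = ((l :: (M ++ [r])).map sg).reverse := by simp
  have hmem : ∀ c ∈ sg r :: (M.map sg).reverse, ∃ c' ∈ r :: M, c = sg c' := by
    intro c hc
    rcases List.mem_cons.1 hc with rfl | hc
    · exact ⟨r, by simp, rfl⟩
    · rw [List.mem_reverse, List.mem_map] at hc
      obtain ⟨c', hc', rfl⟩ := hc
      exact ⟨c', by simp [hc'], rfl⟩
  have := @insL (sg r) (sg l) ((M.map sg).reverse) (by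
      rw [e, List.isChain_reverse, List.isChain_map]
      exact hs.imp (by intro a b h; simpa [sg] using h))
    ((fun x => (sg x.1, sg x.2)) '' Con) (hfin.image _)
    (by
      rintro _ ⟨x, hx, rfl⟩ c hc
      obtain ⟨c', hc', rfl⟩ := hmem c hc
      simpa [sg] using h1 x hx c' hc')
    (by
      rintro _ ⟨x, hx, rfl⟩ c hc hne
      obtain ⟨c', hc', rfl⟩ := hmem c hc
      rw [Ab_sg]
      exact h2 x hx c' hc' (by rintro rfl; exact hne rfl))
    (by
      rintro _ ⟨x, hx, rfl⟩ c hc d hd hne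
      obtain ⟨c', hc', rfl⟩ := hmem c hc
      obtain ⟨d', hd', rfl⟩ := hmem d hd
      rw [Ab_sg]
      exact h3 x hx c' hc' d' hd' (by rintro rfl; exact hne rfl))
    (by
      rintro _ ⟨x, hx, rfl⟩ h
      rw [Ab_sg]
      apply h4 x hx
      have := congrArg sg h
      simpa [sg_sg] using this)
    (by
      rintro _ ⟨x, hx, rfl⟩
      obtain ⟨h5a, h5b⟩ := h5 x hx
      refine ⟨?_, ?_⟩
      · intro h
        rw [List.mem_reverse, List.mem_map] at h
        obtain ⟨c', hc', h'⟩ := h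
        have := congrArg sg h'
        simp only [sg_sg] at this
        rw [this] at hc'; exact h5a hc'
      · rcases h5b with h | h
        · left; simpa [sg] using h
        · right
          intro c hc
          obtain ⟨c', hc', rfl⟩ := hmem c hc
          simpa [sg] using h c' hc')
  obtain ⟨v, v1, v2, v3, v4⟩ := this
  refine ⟨sg v, by simp [sg] at *; linarith, by simp [sg] at *; linarith, ?_, ?_⟩
  · intro x hx
    obtain ⟨q1, q2⟩ := v3 _ ⟨x, hx, rfl⟩
    refine ⟨by simp [sg] at *; linarith, ?_⟩
    rw [← Ab_sg, sg_sg]; exact q2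
  · rw [e, List.isChain_reverse, List.isChain_map] at v4
    refine v4.imp ?_
    intro a b h
    rw [← orient_sg, sg_sg]; exact h

lemma insU {l r : ℝ × ℝ} {M : List (ℝ × ℝ)}
    (hs : (l :: (M ++ [r])).IsChain (fun a b => a.1 < b.1)) :
    ∃ v : ℝ × ℝ, l.1 < v.1 ∧ v.1 < r.1 ∧
      (l :: (M ++ [r])).IsChain (fun a b => 0 < orient a b v) := by
  obtain ⟨v, h1, h2, -, h3⟩ := insL hs ∅ Set.finite_empty (by simp) (by simp) (by simp) (by simp) (by simp)
  exact ⟨v, h1, h2, h3⟩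

end

end FP


namespace FP

noncomputable section

open Classical

section pathdraw

structure PFut {W : Type*} (H : List W) (N : ℕ) (y : ℕ → W) (st : ℕ → Step W) (σ : ℕ → ℕ) (mC : Prop)
    (ex : ℕ → Prop) (Q : ℕ → ℝ × ℝ) (δ : W → ℝ × ℝ) (j : ℕ) : Prop where
  V1 : ∀ i, j ≤ i → i < N → ∀ a ∈ H, ∀ b ∈ H, a ≠ b → (mC → (δ (y j)).1 ≤ (δ a).1) →
    (mC → (δ (y j)).1 ≤ (δ b).1) → Ab (δ a) (δ b) (Q i)
  V2 : ∀ i i', j ≤ i → i < i' → i' < N → ∀ a ∈ H, (mC → (δ (y j)).1 ≤ (δ a).1) →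
    ¬ (a = y j ∧ ex j) → Ab (δ a) (Q i) (Q i')
  X1 : ∀ i, j ≤ i → i < N → ∀ c ∈ H, (mC → (δ (y j)).1 ≤ (δ c).1) → (δ c).1 < (δ (y j)).1 →
    (δ c).1 < (Q i).1
  X2 : ∀ i, j ≤ i → i < N → ∀ c ∈ H, (mC → (δ (y j)).1 ≤ (δ c).1) → (δ (y j)).1 < (δ c).1 →
    (Q i).1 < (δ c).1
  X3 : ∀ i, j ≤ i → i < N → y j = (st (σ j)).l → (δ (y j)).1 < (Q i).1
  X4 : ∀ i, j ≤ i → i < N → y j = (st (σ j)).r → (Q i).1 < (δ (y j)).1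

structure PPre {W : Type*} (f0 f1 : W) (H : List W) (y : ℕ → W) (st : ℕ → Step W)
    (Q : ℕ → ℝ × ℝ) (p0 p1 : ℝ × ℝ) (δ : W → ℝ × ℝ) (k j : ℕ) : Prop where
  cw : ∀ m < k, (δ (st m).l).1 < (δ (st m).w).1 ∧ (δ (st m).w).1 < (δ (st m).r).1
  co : ∀ m < k, (st m).B.IsChain (fun a b => 0 < orient (δ a) (δ b) (δ (st m).w))
  d0 : δ f0 = p0
  d1 : δ f1 = p1
  dq : ∀ i < j, δ (y (i + 1)) = Q i
  srt : H.IsChain (fun a b => (δ a).1 < (δ b).1)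

variable {W : Type*} [Finite W] {E : SimpleGraph W} {f0 f1 : W} {n : ℕ} {st : ℕ → Step W}
    {H : ℕ → List W} 

lemma pre_step (hc : IsCan E f0 f1 n st H) {N : ℕ} {y : ℕ → W} {σ : ℕ → ℕ}
    (hp : IsPath f0 f1 n st N y σ) {Q : ℕ → ℝ × ℝ} {p0 p1 : ℝ × ℝ}  {δ : W → ℝ × ℝ}
    {k j : ℕ} (hk : k < n) (hj : j ≤ N) (s1 : ∀ i < j, σ i < k)
    (h : PPre f0 f1 (H k) y st Q p0 p1 δ k j) (v : ℝ × ℝ)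
    (v1 : (δ (st k).l).1 < v.1) (v2 : v.1 < (δ (st k).r).1)
    (v3 : (st k).B.IsChain (fun a b => 0 < orient (δ a) (δ b) v)) :
    PPre f0 f1 (H (k + 1)) y st Q p0 p1 (Function.update δ (st k).w v) (k + 1) j ∧
    (∀ a ∈ H k, Function.update δ (st k).w v a = δ a) := by
  have hold : ∀ x, dn f0 f1 st k x → Function.update δ (st k).w v x = δ x := by
    intro x hx
    apply Function.update_of_ne
    rintro rfl; exact hc.wnew k hk hx
  have hw : Function.update δ (st k).w v (st k).w = v := Function.update_self ..
  have hB : ∀ x ∈ (st k).B, Function.update δ (st k).w v x = δ x := fun x hx => hold x (hc.memB hk hx)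
  have hH : ∀ a ∈ H k, Function.update δ (st k).w v a = δ a :=
    fun a ha => hold a (hc.mem_dn k hk.le a ha)
  refine ⟨⟨?_, ?_, ?_, ?_, ?_, ?_⟩, hH⟩
  · intro m hm
    rcases Nat.lt_succ_iff_lt_or_eq.1 hm with hm | rfl
    · have hB' : ∀ x ∈ (st m).B, Function.update δ (st k).w v x = δ x := fun x hx =>
        hold x (dn_mono hm.le (hc.memB (hm.trans hk) hx))
      rw [hB' (st m).l (by simp [Step.B]), hB' (st m).r (by simp [Step.B]), hold (st m).w (Or.inr (Or.inr ⟨m, hm, rfl⟩))]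
      exact h.cw m hm
    · rw [hB (st m).l (by simp [Step.B]), hB (st m).r (by simp [Step.B]), hw]
      exact ⟨v1, v2⟩
  · intro m hm
    rcases Nat.lt_succ_iff_lt_or_eq.1 hm with hm | rfl
    · have hB' : ∀ x ∈ (st m).B, Function.update δ (st k).w v x = δ x := fun x hx =>
        hold x (dn_mono hm.le (hc.memB (hm.trans hk) hx))
      rw [hold (st m).w (Or.inr (Or.inr ⟨m, hm, rfl⟩))]
      refine (h.co m hm).imp_of_mem_imp ?_
      intro a b ha hb hab
      rw [hB' a ha, hB' b hb]; exact hab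
    · rw [hw]
      refine v3.imp_of_mem_imp ?_
      intro a b ha hb hab
      rw [hB a ha, hB b hb]; exact hab
  · rw [hold _ (Or.inl rfl)]; exact h.d0
  · rw [hold _ (Or.inr (Or.inl rfl))]; exact h.d1
  · intro i hi
    rw [hold]; · exact h.dq i hi
    exact Or.inr (Or.inr ⟨σ i, s1 i hi, hp.yw i (by omega)⟩)
  · have hs := h.srt
    have e1 : (H k).IsChain (fun a b => (Function.update δ (st k).w v a).1 < (Function.update δ (st k).w v b).1) :=
      hs.imp_of_mem_imp (fun a b ha hb hab => by rw [hH a ha, hH b hb]; exact hab)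
    rw [hc.hpre k hk, Step.pre, chain_pre] at e1
    rw [hc.hpost k hk, Step.post, chain_post]
    refine ⟨e1.1, ?_, ?_, e1.2.2⟩
    · rw [hB (st k).l (by simp [Step.B]), hw]; exact v1
    · rw [hB (st k).r (by simp [Step.B]), hw]; exact v2

lemma fut_off (hc : IsCan E f0 f1 n st H) {N : ℕ} {y : ℕ → W} {σ : ℕ → ℕ}
    {mC : Prop} {ex : ℕ → Prop} {Q : ℕ → ℝ × ℝ} {δ : W → ℝ × ℝ}
    {k j : ℕ} (hk : k < n) 
    (h : PFut (H k) N y st σ mC ex Q δ j) (v : ℝ × ℝ)  (hy : y j ∈ H k)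
    (hup : ∀ a ∈ H k, Function.update δ (st k).w v a = δ a)
    (c1 : (mC → (δ (y j)).1 ≤ v.1) → ∀ i, j ≤ i → i < N → 
      (∀ a ∈ (st k).A ++ [(st k).l] ++ (st k).r :: (st k).C, (mC → (δ (y j)).1 ≤ (δ a).1) → Ab (δ a) v (Q i)) ∧
      (∀ i', i < i' → i' < N → Ab v (Q i) (Q i')) ∧
      (v.1 < (δ (y j)).1 → v.1 < (Q i).1) ∧ ((δ (y j)).1 < v.1 → (Q i).1 < v.1)) :
    PFut (H (k + 1)) N y st σ mC ex Q (Function.update δ (st k).w v) j := by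
  have hw : Function.update δ (st k).w v (st k).w = v := Function.update_self ..
  have hyw : y j ≠ (st k).w := by
    intro e; rw [e] at hy; exact hc.wnew k hk (hc.mem_dn k hk.le _ hy)
  have hm : ∀ a ∈ H (k + 1), a = (st k).w ∨ (a ≠ (st k).w ∧ a ∈ H k ∧ a ∈ (st k).A ++ [(st k).l] ++ (st k).r :: (st k).C) := by
    intro a ha
    by_cases e : a = (st k).w
    · exact Or.inl e
    refine Or.inr ⟨e, ?_⟩
    rw [hc.hpost k hk, Step.post] at ha
    rw [hc.hpre k hk, Step.pre]
    simp at ha ⊢; tauto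
  have hyu := hup _ hy
  constructor
  · intro i hi hiN a ha b hb hab
    rw [hyu]
    rcases hm a ha with rfl | ⟨_, ha1, ha2⟩ <;> rcases hm b hb with rfl | ⟨_, hb1, hb2⟩
    · exact absurd rfl hab
    · rw [hw, hup b hb1]; intro r1 r2
      exact Ab_symm.1 ((c1 r1 i hi hiN).1 b hb2 r2)
    · rw [hw, hup a ha1]; intro r1 r2
      exact ((c1 r2 i hi hiN).1 a ha2 r1)
    · rw [hup a ha1, hup b hb1]; exact h.V1 i hi hiN a ha1 b hb1 hab
  · intro i i' hi hii hiN a ha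
    rw [hyu]
    rcases hm a ha with rfl | ⟨_, ha1, ha2⟩
    · rw [hw]; intro r1 _; exact (c1 r1 i hi (by omega)).2.1 i' hii hiN
    · rw [hup a ha1]; exact h.V2 i i' hi hii hiN a ha1
  · intro i hi hiN a ha
    rw [hyu]
    rcases hm a ha with rfl | ⟨_, ha1, ha2⟩
    · rw [hw]; intro r1; exact (c1 r1 i hi (by omega)).2.2.1
    · rw [hup a ha1]; exact h.X1 i hi hiN a ha1
  · intro i hi hiN a ha
    rw [hyu]
    rcases hm a ha with rfl | ⟨_, ha1, ha2⟩
    · rw [hw]; intro r1; exact (c1 r1 i hi (by omega)).2.2.2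
    · rw [hup a ha1]; exact h.X2 i hi hiN a ha1
  · rw [hyu]; exact h.X3
  · rw [hyu]; exact h.X4

end pathdraw

end

end FP


namespace FP

noncomputable section

open Classical

structure Ord {W : Type*} (s : Step W) (X : W → ℝ) : Prop where
  Al : ∀ a ∈ s.A ++ [s.l], X a ≤ X s.l
  rC : ∀ a ∈ s.r :: s.C, X s.r ≤ X a
  lM : ∀ a ∈ s.M, X s.l < X a
  Mr : ∀ a ∈ s.M, X a < X s.r
  lr : X s.l < X s.r
  inj : ∀ a ∈ s.pre, ∀ b ∈ s.pre, X a = X b → a = b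

lemma mk_ord {W : Type*} {s : Step W} {X : W → ℝ} (h : s.pre.IsChain (fun a b => X a < X b)) :
    Ord s X := by
  have hp := (pw_iff X).1 h
  have hinj : ∀ a ∈ s.pre, ∀ b ∈ s.pre, X a = X b → a = b := by
    intro a ha b hb hab
    by_contra hne
    have : ∀ a ∈ s.pre, ∀ b ∈ s.pre, a ≠ b → X a ≠ X b := by
      intro a ha b hb hne
      exact List.Pairwise.forall_of_forall_of_flip (R := fun a b => a ≠ b → X a ≠ X b) (by simp) (hp.imp (fun {a b} hab _ => hab.ne)) (hp.imp (fun {a b} hab _ => hab.ne')) ha hb hne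
    exact this a ha b hb hne hab
  have hinj' := hinj
  simp only [Step.pre, List.pairwise_append, List.pairwise_cons, List.mem_append, List.mem_cons] at hp
  obtain ⟨-, ⟨h1, ⟨-, ⟨h2, -⟩, h3⟩⟩, h4⟩ := hp
  refine ⟨?_, ?_, ?_, ?_, ?_, hinj⟩
  · intro a ha; simp at ha; rcases ha with ha | rfl
    · exact (h4 a ha _ (Or.inl rfl)).le
    · exact le_rfl
  · intro a ha; simp at ha; rcases ha with rfl | ha
    · exact le_rfl
    · exact (h2 a ha).le
  · intro a ha; exact h1 a (Or.inl ha)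
  · intro a ha; exact h3 a ha _ (Or.inl rfl)
  · exact h1 _ (Or.inr (Or.inl rfl))

section pathdraw

variable {W : Type*} [Finite W] {E : SimpleGraph W} {f0 f1 : W} {n : ℕ} {st : ℕ → Step W}
    {H : ℕ → List W} 

lemma map_chain {B : List W} {δ : W → ℝ × ℝ} {R : ℝ × ℝ → ℝ × ℝ → Prop} :
    (B.map δ).IsChain R ↔ B.IsChain (fun a b => R (δ a) (δ b)) := by
  rw [List.isChain_map]

lemma fut_R (hc : IsCan E f0 f1 n st H) {N : ℕ} {y : ℕ → W} {σ : ℕ → ℕ}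
    {mC : Prop} {ex : ℕ → Prop} {Q : ℕ → ℝ × ℝ} {δ : W → ℝ × ℝ}
    {k j : ℕ} (hk : k < n) (srt : (H k).IsChain (fun a b => (δ a).1 < (δ b).1)) 
    (h : PFut (H k) N y st σ mC ex Q δ j) (hy : y j ∈ (st k).A ++ [(st k).l]) :
    ∃ v : ℝ × ℝ, (δ (st k).l).1 < v.1 ∧ v.1 < (δ (st k).r).1 ∧
    ((st k).B.IsChain (fun a b => 0 < orient (δ a) (δ b) v)) ∧
    ((mC → (δ (y j)).1 ≤ v.1) → ∀ i, j ≤ i → i < N → 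
      (∀ a ∈ (st k).A ++ [(st k).l] ++ (st k).r :: (st k).C, (mC → (δ (y j)).1 ≤ (δ a).1) → Ab (δ a) v (Q i)) ∧
      (∀ i', i < i' → i' < N → Ab v (Q i) (Q i')) ∧
      (v.1 < (δ (y j)).1 → v.1 < (Q i).1) ∧ ((δ (y j)).1 < v.1 → (Q i).1 < v.1)) := by
  rw [hc.hpre k hk] at srt
  have o : Ord (st k) (fun a => (δ a).1) := mk_ord srt
  have hpre := hc.hpre k hk
  generalize st k = s at *
  have hcur := o.Al _ hy
  have hsub : ∀ a ∈ s.A ++ [s.l] ++ s.r :: s.C, a ∈ H k := by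
    intro a ha; rw [hpre, Step.pre]; simp at ha ⊢; tauto
  have hsubM : ∀ a ∈ s.r :: s.M, a ∈ H k := by
    intro a ha; rw [hpre, Step.pre]; simp at ha ⊢; tauto
  have hgt : ∀ a ∈ s.r :: s.M, (δ s.l).1 < (δ a).1 := by
    intro a ha; rcases List.mem_cons.1 ha with rfl | ha
    · exact o.lr
    · exact o.lM a ha
  have hrel : ∀ a ∈ s.r :: s.M, mC → (δ (y j)).1 ≤ (δ a).1 := fun a ha _ => hcur.trans (hgt a ha).le
  have hrcur : ∀ a ∈ s.r :: s.M, ∀ ex : Prop, ¬ (a = y j ∧ ex) := by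
    rintro a ha _ ⟨rfl, -⟩
    linarith [hgt _ ha]
  have hinj : ∀ a ∈ H k, ∀ b ∈ H k, (δ a) = (δ b) → a = b := fun a ha b hb hab =>
    o.inj a (hpre ▸ ha) b (hpre ▸ hb) (by simp only [hab])
  let Con : Set ((ℝ × ℝ) × (ℝ × ℝ)) :=
    ((fun x : W × ℕ => (δ x.1, Q x.2)) '' {x | x.1 ∈ s.A ++ [s.l] ++ s.r :: s.C ∧ (mC → (δ (y j)).1 ≤ (δ x.1).1) ∧
      j ≤ x.2 ∧ x.2 < N}) ∪
    ((fun x : ℕ × ℕ => (Q x.1, Q x.2)) '' {x | j ≤ x.1 ∧ x.1 < x.2 ∧ x.2 < N})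
  have hConF : Con.Finite := by
    apply Set.Finite.union
    · apply Set.Finite.image
      exact (Set.finite_univ.prod (Set.finite_lt_nat N)).subset (fun x hx => ⟨trivial, hx.2.2.2⟩)
    · apply Set.Finite.image
      exact ((Set.finite_lt_nat N).prod (Set.finite_lt_nat N)).subset (fun x hx => ⟨by
        have := hx.2; simp only [Set.mem_ofPred_eq]; omega, hx.2.2⟩)
  have hCon : ∀ x ∈ Con, (∃ a ∈ s.A ++ [s.l] ++ s.r :: s.C, ∃ i, (mC → (δ (y j)).1 ≤ (δ a).1) ∧ j ≤ i ∧ i < N ∧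
      x = (δ a, Q i)) ∨ (∃ i i', j ≤ i ∧ i < i' ∧ i' < N ∧ x = (Q i, Q i')) := by
    rintro x (⟨⟨a, i⟩, ⟨h1, h2, h3, h4⟩, rfl⟩ | ⟨⟨i, i'⟩, ⟨h1, h2, h3⟩, rfl⟩)
    · exact Or.inl ⟨a, h1, i, h2, h3, h4, rfl⟩
    · exact Or.inr ⟨i, i', h1, h2, h3, rfl⟩
  have hQ : ∀ i, j ≤ i → i < N → ∀ c ∈ s.r :: s.M, (Q i).1 < (δ c).1 := fun i h1 h2 c hcc =>
    h.X2 i h1 h2 c (hsubM c hcc) (hrel c hcc) (lt_of_le_of_lt hcur (hgt c hcc))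
  have hsB : (δ s.l :: (s.M.map δ ++ [δ s.r])).IsChain (fun a b => a.1 < b.1) := by
    have : δ s.l :: (s.M.map δ ++ [δ s.r]) = (s.l :: (s.M ++ [s.r])).map δ := by simp
    rw [this, map_chain]
    exact (chain_pre.1 srt).2.1
  have hmem : ∀ c ∈ δ s.r :: s.M.map δ, ∃ c' ∈ s.r :: s.M, c = δ c' := by
    intro c hcc
    have : δ s.r :: s.M.map δ = (s.r :: s.M).map δ := by simp
    rw [this, List.mem_map] at hcc
    obtain ⟨c', h1, h2⟩ := hcc; exact ⟨c', h1, h2.symm⟩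
  refine (?_ : _ → _) (insR hsB Con hConF ?_ ?_ ?_ ?_ ?_)
  · rintro ⟨v, v1, v2, v3, v4⟩
    refine ⟨v, v1, v2, ?_, ?_⟩
    · have : δ s.l :: (s.M.map δ ++ [δ s.r]) = (s.B).map δ := by simp [Step.B]
      rw [this, map_chain] at v4; exact v4
    · intro _ i hi hiN
      refine ⟨?_, ?_, ?_, ?_⟩
      · intro a ha hra
        exact (v3 (δ a, Q i) (Or.inl ⟨(a, i), ⟨ha, hra, hi, hiN⟩, rfl⟩)).2
      · intro i' h1 h2
        exact Ab_symm.1 (v3 (Q i, Q i') (Or.inr ⟨(i, i'), ⟨hi, h1, h2⟩, rfl⟩)).2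
      · intro hlt; linarith
      · intro _
        exact (v3 (δ s.r, Q i) (Or.inl ⟨(s.r, i), ⟨by simp, hrel _ (by simp), hi, hiN⟩, rfl⟩)).1
  · intro x hx c hcc
    obtain ⟨c, hcc0, rfl⟩ := hmem c hcc; replace hcc := hcc0
    rcases hCon x hx with ⟨a, ha, i, hra, hi, hiN, rfl⟩ | ⟨i, i', hi, hii, hiN, rfl⟩
    · exact hQ i hi hiN c hcc
    · exact hQ i' (by omega) hiN c hcc
  · intro x hx c hcc hne
    obtain ⟨c, hcc0, rfl⟩ := hmem c hcc; replace hcc := hcc0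
    rcases hCon x hx with ⟨a, ha, i, hra, hi, hiN, rfl⟩ | ⟨i, i', hi, hii, hiN, rfl⟩
    · exact h.V1 i hi hiN a (hsub a ha) c (hsubM c hcc) (by rintro rfl; exact hne rfl) hra (hrel c hcc)
    · exact Ab_symm.1 (h.V2 i i' hi hii hiN c (hsubM c hcc) (hrel c hcc) (hrcur c hcc _))
  · intro x hx c hcc d hdd hne
    obtain ⟨c, hcc0, rfl⟩ := hmem c hcc; replace hcc := hcc0
    obtain ⟨d, hdd0, rfl⟩ := hmem d hdd; replace hdd := hdd0
    have hne' : c ≠ d := by rintro rfl; exact hne rfl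
    rcases hCon x hx with ⟨a, ha, i, hra, hi, hiN, rfl⟩ | ⟨i, i', hi, hii, hiN, rfl⟩
    · exact h.V1 i hi hiN c (hsubM c hcc) d (hsubM d hdd) hne' (hrel c hcc) (hrel d hdd)
    · exact h.V1 i' (by omega) hiN c (hsubM c hcc) d (hsubM d hdd) hne' (hrel c hcc) (hrel d hdd)
  · intro x hx hxr
    rcases hCon x hx with ⟨a, ha, i, hra, hi, hiN, rfl⟩ | ⟨i, i', hi, hii, hiN, rfl⟩
    · exact h.V1 i hi hiN _ (hsubM _ (by simp)) s.l (hsub _ (by simp)) (by intro e; have := o.lr; simp [e] at this) (hrel _ (by simp))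
        (fun _ => hcur)
    · have := hQ i hi (by omega) s.r (by simp)
      simp only at hxr
      rw [hxr] at this; exact absurd this (lt_irrefl _)
  · intro x hx
    rcases hCon x hx with ⟨a, ha, i, hra, hi, hiN, rfl⟩ | ⟨i, i', hi, hii, hiN, rfl⟩
    · have hd : a ∈ s.A ++ [s.l] ∨ a ∈ s.r :: s.C := by simp at ha ⊢; tauto
      constructor
      · intro hm
        obtain ⟨m, hm, he⟩ := List.mem_map.1 hm
        rcases hd with hd | hd
        · have := o.Al a hd; have := o.lM m hm; simp only [he] at *; linarith
        · have := o.rC a hd; have := o.Mr m hm; simp only [he] at *; linarith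
      · rcases hd with hd | hd
        · right; intro c hcc
          obtain ⟨c, hcc0, rfl⟩ := hmem c hcc; replace hcc := hcc0
          exact lt_of_le_of_lt (o.Al a hd) (hgt c hcc)
        · left; exact o.rC a hd
    · constructor
      · intro hm
        obtain ⟨m, hm, he⟩ := List.mem_map.1 hm
        have := hQ i hi (by omega) m (by simp [hm])
        simp only [he] at this; exact lt_irrefl _ this
      · right
        intro c hcc
        obtain ⟨c, hcc0, rfl⟩ := hmem c hcc; replace hcc := hcc0
        exact hQ i hi (by omega) c hcc

lemma fut_L (hc : IsCan E f0 f1 n st H) {N : ℕ} {y : ℕ → W} {σ : ℕ → ℕ}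
    {mC : Prop} {ex : ℕ → Prop} {Q : ℕ → ℝ × ℝ} {δ : W → ℝ × ℝ} (hmC : ¬ mC)
    {k j : ℕ} (hk : k < n) (srt : (H k).IsChain (fun a b => (δ a).1 < (δ b).1)) 
    (h : PFut (H k) N y st σ mC ex Q δ j) (hy : y j ∈ (st k).r :: (st k).C) :
    ∃ v : ℝ × ℝ, (δ (st k).l).1 < v.1 ∧ v.1 < (δ (st k).r).1 ∧
    ((st k).B.IsChain (fun a b => 0 < orient (δ a) (δ b) v)) ∧
    ((mC → (δ (y j)).1 ≤ v.1) → ∀ i, j ≤ i → i < N → 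
      (∀ a ∈ (st k).A ++ [(st k).l] ++ (st k).r :: (st k).C, (mC → (δ (y j)).1 ≤ (δ a).1) → Ab (δ a) v (Q i)) ∧
      (∀ i', i < i' → i' < N → Ab v (Q i) (Q i')) ∧
      (v.1 < (δ (y j)).1 → v.1 < (Q i).1) ∧ ((δ (y j)).1 < v.1 → (Q i).1 < v.1)) := by
  rw [hc.hpre k hk] at srt
  have o : Ord (st k) (fun a => (δ a).1) := mk_ord srt
  have hpre := hc.hpre k hk
  generalize st k = s at *
  have hcur := o.rC _ hy
  have hsub : ∀ a ∈ s.A ++ [s.l] ++ s.r :: s.C, a ∈ H k := by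
    intro a ha; rw [hpre, Step.pre]; simp at ha ⊢; tauto
  have hsubM : ∀ a ∈ s.l :: s.M, a ∈ H k := by
    intro a ha; rw [hpre, Step.pre]; simp at ha ⊢; tauto
  have hgt : ∀ a ∈ s.l :: s.M, (δ a).1 < (δ s.r).1 := by
    intro a ha; rcases List.mem_cons.1 ha with rfl | ha
    · exact o.lr
    · exact o.Mr a ha
  have hrel : ∀ a : W, mC → (δ (y j)).1 ≤ (δ a).1 := fun a hm => absurd hm hmC
  have hrcur : ∀ a ∈ s.l :: s.M, ∀ ex : Prop, ¬ (a = y j ∧ ex) := by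
    rintro a ha _ ⟨rfl, -⟩
    linarith [hgt _ ha]
  let Con : Set ((ℝ × ℝ) × (ℝ × ℝ)) :=
    ((fun x : W × ℕ => (δ x.1, Q x.2)) '' {x | x.1 ∈ s.A ++ [s.l] ++ s.r :: s.C ∧
      j ≤ x.2 ∧ x.2 < N}) ∪
    ((fun x : ℕ × ℕ => (Q x.1, Q x.2)) '' {x | j ≤ x.1 ∧ x.1 < x.2 ∧ x.2 < N})
  have hConF : Con.Finite := by
    apply Set.Finite.union
    · apply Set.Finite.image
      exact (Set.finite_univ.prod (Set.finite_lt_nat N)).subset (fun x hx => ⟨trivial, hx.2.2⟩)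
    · apply Set.Finite.image
      exact ((Set.finite_lt_nat N).prod (Set.finite_lt_nat N)).subset (fun x hx => ⟨by
        have := hx.2; simp only [Set.mem_ofPred_eq]; omega, hx.2.2⟩)
  have hCon : ∀ x ∈ Con, (∃ a ∈ s.A ++ [s.l] ++ s.r :: s.C, ∃ i, j ≤ i ∧ i < N ∧
      x = (δ a, Q i)) ∨ (∃ i i', j ≤ i ∧ i < i' ∧ i' < N ∧ x = (Q i, Q i')) := by
    rintro x (⟨⟨a, i⟩, ⟨h1, h3, h4⟩, rfl⟩ | ⟨⟨i, i'⟩, ⟨h1, h2, h3⟩, rfl⟩)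
    · exact Or.inl ⟨a, h1, i, h3, h4, rfl⟩
    · exact Or.inr ⟨i, i', h1, h2, h3, rfl⟩
  have hQ : ∀ i, j ≤ i → i < N → ∀ c ∈ s.l :: s.M, (δ c).1 < (Q i).1 := fun i h1 h2 c hcc =>
    h.X1 i h1 h2 c (hsubM c hcc) (hrel c) (lt_of_lt_of_le (hgt c hcc) hcur)
  have hsB : (δ s.l :: (s.M.map δ ++ [δ s.r])).IsChain (fun a b => a.1 < b.1) := by
    have : δ s.l :: (s.M.map δ ++ [δ s.r]) = (s.l :: (s.M ++ [s.r])).map δ := by simp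
    rw [this, map_chain]
    exact (chain_pre.1 srt).2.1
  have hmem : ∀ c ∈ δ s.l :: s.M.map δ, ∃ c' ∈ s.l :: s.M, c = δ c' := by
    intro c hcc
    have : δ s.l :: s.M.map δ = (s.l :: s.M).map δ := by simp
    rw [this, List.mem_map] at hcc
    obtain ⟨c', h1, h2⟩ := hcc; exact ⟨c', h1, h2.symm⟩
  refine (?_ : _ → _) (insL hsB Con hConF ?_ ?_ ?_ ?_ ?_)
  · rintro ⟨v, v1, v2, v3, v4⟩
    refine ⟨v, v1, v2, ?_, ?_⟩
    · have : δ s.l :: (s.M.map δ ++ [δ s.r]) = (s.B).map δ := by simp [Step.B]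
      rw [this, map_chain] at v4; exact v4
    · intro _ i hi hiN
      refine ⟨?_, ?_, ?_, ?_⟩
      · intro a ha _
        exact (v3 (δ a, Q i) (Or.inl ⟨(a, i), ⟨ha, hi, hiN⟩, rfl⟩)).2
      · intro i' h1 h2
        exact Ab_symm.1 (v3 (Q i, Q i') (Or.inr ⟨(i, i'), ⟨hi, h1, h2⟩, rfl⟩)).2
      · intro _
        exact (v3 (δ s.r, Q i) (Or.inl ⟨(s.r, i), ⟨by simp, hi, hiN⟩, rfl⟩)).1
      · intro hlt; linarith
  · intro x hx c hcc
    obtain ⟨c, hcc0, rfl⟩ := hmem c hcc; replace hcc := hcc0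
    rcases hCon x hx with ⟨a, ha, i, hi, hiN, rfl⟩ | ⟨i, i', hi, hii, hiN, rfl⟩
    · exact hQ i hi hiN c hcc
    · exact hQ i' (by omega) hiN c hcc
  · intro x hx c hcc hne
    obtain ⟨c, hcc0, rfl⟩ := hmem c hcc; replace hcc := hcc0
    rcases hCon x hx with ⟨a, ha, i, hi, hiN, rfl⟩ | ⟨i, i', hi, hii, hiN, rfl⟩
    · exact h.V1 i hi hiN a (hsub a ha) c (hsubM c hcc) (by rintro rfl; exact hne rfl) (hrel a) (hrel c)
    · exact Ab_symm.1 (h.V2 i i' hi hii hiN c (hsubM c hcc) (hrel c) (hrcur c hcc _))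
  · intro x hx c hcc d hdd hne
    obtain ⟨c, hcc0, rfl⟩ := hmem c hcc; replace hcc := hcc0
    obtain ⟨d, hdd0, rfl⟩ := hmem d hdd; replace hdd := hdd0
    have hne' : c ≠ d := by rintro rfl; exact hne rfl
    rcases hCon x hx with ⟨a, ha, i, hi, hiN, rfl⟩ | ⟨i, i', hi, hii, hiN, rfl⟩
    · exact h.V1 i hi hiN c (hsubM c hcc) d (hsubM d hdd) hne' (hrel c) (hrel d)
    · exact h.V1 i' (by omega) hiN c (hsubM c hcc) d (hsubM d hdd) hne' (hrel c) (hrel d)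
  · intro x hx hxr
    rcases hCon x hx with ⟨a, ha, i, hi, hiN, rfl⟩ | ⟨i, i', hi, hii, hiN, rfl⟩
    · exact h.V1 i hi hiN _ (hsubM _ (by simp)) s.r (hsub _ (by simp)) (by intro e; have := o.lr; simp [e] at this) (hrel _)
        (hrel _)
    · have := hQ i hi (by omega) s.l (by simp)
      simp only at hxr
      rw [hxr] at this; exact absurd this (lt_irrefl _)
  · intro x hx
    rcases hCon x hx with ⟨a, ha, i, hi, hiN, rfl⟩ | ⟨i, i', hi, hii, hiN, rfl⟩
    · have hd : a ∈ s.A ++ [s.l] ∨ a ∈ s.r :: s.C := by simp at ha ⊢; tauto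
      constructor
      · intro hm
        obtain ⟨m, hm, he⟩ := List.mem_map.1 hm
        rcases hd with hd | hd
        · have := o.Al a hd; have := o.lM m hm; simp only [he] at *; linarith
        · have := o.rC a hd; have := o.Mr m hm; simp only [he] at *; linarith
      · rcases hd with hd | hd
        · left; exact o.Al a hd
        · right; intro c hcc
          obtain ⟨c, hcc0, rfl⟩ := hmem c hcc; replace hcc := hcc0
          exact lt_of_lt_of_le (hgt c hcc) (o.rC a hd)
    · constructor
      · intro hm
        obtain ⟨m, hm, he⟩ := List.mem_map.1 hm
        have := hQ i hi (by omega) m (by simp [hm])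
        simp only [he] at this; exact lt_irrefl _ this
      · right
        intro c hcc
        obtain ⟨c, hcc0, rfl⟩ := hmem c hcc; replace hcc := hcc0
        exact hQ i hi (by omega) c hcc

end pathdraw

end

end FP


namespace FP

noncomputable section

open Classical

lemma mem_postS {W : Type*} {s : Step W} {a : W} (h : a ∈ s.post) (hn : a ≠ s.w) :
    a ∈ s.A ++ [s.l] ++ s.r :: s.C := by
  simp [Step.post] at h ⊢; tauto

lemma mem_preS {W : Type*} {s : Step W} {a : W} (h : a ∈ s.A ++ [s.l] ++ s.r :: s.C) : a ∈ s.pre := by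
  simp [Step.pre] at h ⊢; tauto

lemma mem_preB {W : Type*} {s : Step W} {a : W} (h : a ∈ s.B) : a ∈ s.pre := by
  simp [Step.pre, Step.B] at h ⊢; tauto

lemma mem_spl {W : Type*} {s : Step W} {a : W} (h : a ∈ s.A ++ [s.l] ++ s.r :: s.C) :
    a ∈ s.A ++ [s.l] ∨ a ∈ s.r :: s.C := by
  simp at h ⊢; tauto

section pathdraw

variable {W : Type*} [Finite W] {E : SimpleGraph W} {f0 f1 : W} {n : ℕ} {st : ℕ → Step W}
    {H : ℕ → List W} 

lemma IsCan.nodupS (hc : IsCan E f0 f1 n st H) {k : ℕ} (hk : k < n) {a : W}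
    (h : a ∈ (st k).A ++ [(st k).l] ++ (st k).r :: (st k).C) : a ∉ (st k).M := by
  obtain ⟨ξ, h'⟩ := xi_exists hc
  have := h'.srt k hk.le
  rw [← pw_iff, hc.hpre k hk] at this
  have o := mk_ord this
  intro hm
  have e : a ∈ (st k).A ++ [(st k).l] ∨ a ∈ (st k).r :: (st k).C := mem_spl h
  rcases e with e | e
  · linarith [o.Al a e, o.lM a hm]
  · linarith [o.rC a e, o.Mr a hm]

lemma fut_on (hc : IsCan E f0 f1 n st H) {N : ℕ} {y : ℕ → W} {σ : ℕ → ℕ}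
    (hp : IsPath f0 f1 n st N y σ)
    {mC : Prop} {ex : ℕ → Prop} {Q : ℕ → ℝ × ℝ} {δ : W → ℝ × ℝ}
    (hmC : mC → ∀ j < N, y j = (st (σ j)).l)
    (hex : ∀ j < N, ex j → mC ∨ y j ∈ (st (σ j)).M)
    {j : ℕ} (hj : j < N) (srt : (H (σ j)).IsChain (fun a b => (δ a).1 < (δ b).1))
    (h : PFut (H (σ j)) N y st σ mC ex Q δ j)
    (hup : ∀ a ∈ H (σ j), Function.update δ (st (σ j)).w (Q j) a = δ a)
    (hx3 : ∀ i, j < i → i < N → y (j + 1) = (st (σ (j + 1))).l → (Q j).1 < (Q i).1)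
    (hx4 : ∀ i, j < i → i < N → y (j + 1) = (st (σ (j + 1))).r → (Q i).1 < (Q j).1)
    (hv : ∀ i i', j < i → i < i' → i' < N → ¬ ex (j + 1) → Ab (Q j) (Q i) (Q i')) :
    ((δ (st (σ j)).l).1 < (Q j).1 ∧ (Q j).1 < (δ (st (σ j)).r).1 ∧
      (st (σ j)).B.IsChain (fun a b => 0 < orient (δ a) (δ b) (Q j))) ∧
    PFut (H (σ j + 1)) N y st σ mC ex Q (Function.update δ (st (σ j)).w (Q j)) (j + 1) := by
  have hk := hp.lt j hj
  have hym := hp.mem j hj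
  have hyw := hp.yw j hj
  have hmCj : mC → y j = (st (σ j)).l := fun h => hmC h j hj
  have hexj := hex j hj
  have hnod := fun a => hc.nodupS hk (a := a)
  have hpre := hc.hpre _ hk
  have hpost := hc.hpost _ hk
  have hwn := hc.wnew _ hk
  have hdn := hc.mem_dn _ hk.le
  rw [hpre] at srt
  have o : Ord (st (σ j)) (fun a => (δ a).1) := mk_ord srt
  have hX3 := fun i => h.X3 i
  have hX4 := fun i => h.X4 i
  have hw : Function.update δ (st (σ j)).w (Q j) (st (σ j)).w = Q j := Function.update_self ..
  generalize st (σ j) = s at *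
  have hBH : ∀ a ∈ s.B, a ∈ H (σ j) := by
    intro a ha; rw [hpre]; exact mem_preB ha
  have hBge : ∀ a ∈ s.B, (δ s.l).1 ≤ (δ a).1 ∧ (δ a).1 ≤ (δ s.r).1 := by
    intro a ha; simp [Step.B] at ha
    have := o.lr
    rcases ha with rfl | ha | rfl
    · exact ⟨le_rfl, this.le⟩
    · exact ⟨(o.lM a ha).le, (o.Mr a ha).le⟩
    · exact ⟨this.le, le_rfl⟩
  have hrel : ∀ a ∈ s.B, mC → (δ (y j)).1 ≤ (δ a).1 := by
    intro a ha hm; rw [hmCj hm]; exact (hBge a ha).1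
  have hlB : s.l ∈ s.B := by simp [Step.B]
  have hrB : s.r ∈ s.B := by simp [Step.B]
  have hinj : ∀ a ∈ H (σ j), ∀ b ∈ H (σ j), (δ a).1 = (δ b).1 → a = b := fun a ha b hb hab =>
    o.inj a (hpre ▸ ha) b (hpre ▸ hb) hab
  have hlQ : ∀ i, j ≤ i → i < N → (δ s.l).1 < (Q i).1 := by
    intro i hi hiN
    rcases (hBge _ hym).1.lt_or_eq with hlt | heq
    · exact h.X1 i hi hiN s.l (hBH _ hlB) (hrel _ hlB) hlt
    · have e := hinj _ (hBH _ hlB) _ (hBH _ hym) heq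
      rw [e]; exact hX3 i hi hiN e.symm
  have hrQ : ∀ i, j ≤ i → i < N → (Q i).1 < (δ s.r).1 := by
    intro i hi hiN
    rcases (hBge _ hym).2.lt_or_eq with hlt | heq
    · exact h.X2 i hi hiN s.r (hBH _ hrB) (hrel _ hrB) hlt
    · have e := hinj _ (hBH _ hym) _ (hBH _ hrB) heq
      rw [← e]; exact hX4 i hi hiN e
  refine ⟨⟨hlQ j le_rfl hj, hrQ j le_rfl hj, ?_⟩, ?_⟩
  · have hs := (chain_pre.1 srt).2.1
    refine List.IsChain.imp_of_mem_imp ?_ hs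
    intro a b ha hb hab
    rw [← Ab_pos hab]
    exact h.V1 j le_rfl hj a (hBH a ha) b (hBH b hb) (by rintro rfl; exact lt_irrefl _ hab) (hrel a ha) (hrel b hb)
  · have hm : ∀ a ∈ H (σ j + 1), a = s.w ∨ (a ≠ s.w ∧ a ∈ H (σ j) ∧ a ∈ s.A ++ [s.l] ++ s.r :: s.C) := by
      intro a ha
      by_cases e : a = s.w
      · exact Or.inl e
      refine Or.inr ⟨e, ?_⟩
      rw [hpost] at ha
      have := mem_postS ha e
      exact ⟨hpre ▸ mem_preS this, this⟩
    have hyu : Function.update δ s.w (Q j) (y (j + 1)) = Q j := by rw [hyw]; exact hw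
    have hrel' : ∀ a, (mC → (Q j).1 ≤ (δ a).1) → (mC → (δ (y j)).1 ≤ (δ a).1) := by
      intro a h1 h2; rw [hmCj h2]
      exact (hlQ j le_rfl hj).le.trans (h1 h2)
    have hnex : ∀ a ∈ s.A ++ [s.l] ++ s.r :: s.C, (mC → (Q j).1 ≤ (δ a).1) → ¬ (a = y j ∧ ex j) := by
      rintro a ha h1 ⟨rfl, h2⟩
      rcases hexj h2 with h3 | h3
      · have := h1 h3; rw [hmCj h3] at this
        linarith [hlQ j le_rfl hj]
      · exact hnod _ ha h3
    constructor
    · intro i hi hiN a ha b hb hab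
      rw [hyu]
      rcases hm a ha with rfl | ⟨_, ha1, ha2⟩ <;> rcases hm b hb with rfl | ⟨_, hb1, hb2⟩
      · exact absurd rfl hab
      · rw [hw, hup b hb1]; intro r1 r2
        exact Ab_symm.1 (h.V2 j i le_rfl (by omega) hiN b hb1 (hrel' b r2) (hnex b hb2 r2))
      · rw [hw, hup a ha1]; intro r1 r2
        exact (h.V2 j i le_rfl (by omega) hiN a ha1 (hrel' a r1) (hnex a ha2 r1))
      · rw [hup a ha1, hup b hb1]; intro r1 r2
        exact h.V1 i (by omega) hiN a ha1 b hb1 hab (hrel' a r1) (hrel' b r2)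
    · intro i i' hi hii hiN a ha
      rw [hyu]
      rcases hm a ha with rfl | ⟨_, ha1, ha2⟩
      · rw [hw]; intro r1 r2; exact hv i i' (by omega) hii hiN (fun e => r2 ⟨hyw.symm, e⟩)
      · rw [hup a ha1]; intro r1 _
        exact h.V2 i i' (by omega) hii hiN a ha1 (hrel' a r1) (hnex a ha2 r1)
    · intro i hi hiN a ha
      rw [hyu]
      rcases hm a ha with rfl | ⟨_, ha1, ha2⟩
      · rw [hw]; intro _ h'; exact absurd h' (lt_irrefl _)
      · rw [hup a ha1]; intro r1 h2
        have : a ∈ s.A ++ [s.l] ∨ a ∈ s.r :: s.C := mem_spl ha2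
        rcases this with h3 | h3
        · exact lt_of_le_of_lt (o.Al a h3) (hlQ i (by omega) hiN)
        · have := o.rC a h3; linarith [hrQ j le_rfl hj]
    · intro i hi hiN a ha
      rw [hyu]
      rcases hm a ha with rfl | ⟨_, ha1, ha2⟩
      · rw [hw]; intro _ h'; exact absurd h' (lt_irrefl _)
      · rw [hup a ha1]; intro r1 h2
        have : a ∈ s.A ++ [s.l] ∨ a ∈ s.r :: s.C := mem_spl ha2
        rcases this with h3 | h3
        · have := o.Al a h3; linarith [hlQ j le_rfl hj]
        · exact lt_of_lt_of_le (hrQ i (by omega) hiN) (o.rC a h3)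
    · rw [hyu]; intro i hi hiN; exact hx3 i (by omega) hiN
    · rw [hyu]; intro i hi hiN; exact hx4 i (by omega) hiN

theorem pathdraw (hc : IsCan E f0 f1 n st H) {N : ℕ} {y : ℕ → W} {σ : ℕ → ℕ}
    (hp : IsPath f0 f1 n st N y σ)
    {mC : Prop} {ex : ℕ → Prop} {Q : ℕ → ℝ × ℝ} {p0 p1 : ℝ × ℝ}
    (hmC : mC → ∀ j < N, y j = (st (σ j)).l)
    (hex : ∀ j < N, ex j → mC ∨ y j ∈ (st (σ j)).M)
    (hpp : p0.1 < p1.1)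
    (hi1 : ∀ i < N, p0.1 < (Q i).1 ∧ (Q i).1 < p1.1 ∧ Ab p0 p1 (Q i))
    (hi2 : ¬ (y 0 = f0 ∧ ex 0) → ∀ i i', i < i' → i' < N → Ab p0 (Q i) (Q i'))
    (hi3 : ¬ (y 0 = f1 ∧ ex 0) → ∀ i i', i < i' → i' < N → Ab p1 (Q i) (Q i'))
    (hx3 : ∀ j i, j < i → i < N → y (j + 1) = (st (σ (j + 1))).l → (Q j).1 < (Q i).1)
    (hx4 : ∀ j i, j < i → i < N → y (j + 1) = (st (σ (j + 1))).r → (Q i).1 < (Q j).1)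
    (hv : ∀ j i i', j < i → i < i' → i' < N → ¬ ex (j + 1) → Ab (Q j) (Q i) (Q i')) :
    ∃ δ, PlaneD E δ ∧ ∀ i < N, δ (y (i + 1)) = Q i := by
  have main : ∀ k ≤ n, ∃ δ, ∃ j ≤ N, (∀ i < j, σ i < k) ∧ (∀ i, j ≤ i → i < N → k ≤ σ i) ∧
      PPre f0 f1 (H k) y st Q p0 p1 δ k j ∧ (j < N → PFut (H k) N y st σ mC ex Q δ j) := by
    intro k
    induction k with
    | zero =>
      intro _
      have hne := hc.ne
      refine ⟨fun x => if x = f0 then p0 else p1, 0, by omega, by simp, by simp, ?_, ?_⟩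
      · refine ⟨by simp, by simp, by simp, by simp [hne.symm], by simp, ?_⟩
        rw [hc.h0]; simp [hne.symm, hpp]
      · intro hN
        have hm : ∀ a ∈ H 0, a = f0 ∨ a = f1 := by rw [hc.h0]; simp
        have e0 : (fun x => if x = f0 then p0 else p1) f0 = p0 := by simp
        have e1 : (fun x => if x = f0 then p0 else p1) f1 = p1 := by simp [hne.symm]
        generalize (fun x => if x = f0 then p0 else p1) = δ at *
        constructor
        · intro i _ hiN a ha b hb hab _ _
          rcases hm a ha with rfl | rfl <;> rcases hm b hb with rfl | rfl
          · exact absurd rfl hab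
          · rw [e0, e1]; exact (hi1 i hiN).2.2
          · rw [e0, e1]; exact Ab_symm.1 (hi1 i hiN).2.2
          · exact absurd rfl hab
        · intro i i' _ hii hiN a ha _ h2
          rcases hm a ha with rfl | rfl
          · rw [e0]; exact hi2 (fun h => h2 ⟨h.1.symm, h.2⟩) i i' hii hiN
          · rw [e1]; exact hi3 (fun h => h2 ⟨h.1.symm, h.2⟩) i i' hii hiN
        · intro i _ hiN a ha _ h2
          rcases hm a ha with rfl | rfl
          · rw [e0]; exact (hi1 i hiN).1
          · exfalso; rcases hp.y0 with h | h <;> rw [h] at h2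
            · rw [e1, e0] at h2; linarith
            · exact lt_irrefl _ h2
        · intro i _ hiN a ha _ h2
          rcases hm a ha with rfl | rfl
          · exfalso; rcases hp.y0 with h | h <;> rw [h] at h2
            · exact lt_irrefl _ h2
            · rw [e1, e0] at h2; linarith
          · rw [e1]; exact (hi1 i hiN).2.1
        · intro i _ hiN h
          rcases hp.y0 with h' | h'
          · rw [h', e0]; exact (hi1 i hiN).1
          · exact absurd (h.symm.trans h') (hc.l_ne (hp.lt 0 hN))
        · intro i _ hiN h
          rcases hp.y0 with h' | h'
          · exact absurd (h.symm.trans h') (hc.mirror.l_ne (hp.lt 0 hN))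
          · rw [h', e1]; exact (hi1 i hiN).2.1
    | succ k ih =>
      intro hk
      have hk : k < n := hk
      obtain ⟨δ, j, hj, s1, s2, hpr, hfu⟩ := ih hk.le
      rcases hj.lt_or_eq with hjN | rfl
      · have hfu := hfu hjN
        rcases (s2 j le_rfl hjN).lt_or_eq with hlt | rfl
        · -- off path
          have hyH : y j ∈ H k := by
            have h1 : y j ∈ H (σ j) := by
              rw [hc.hpre _ (hp.lt j hjN)]; exact mem_preB (hp.mem j hjN)
            refine hc.alive hlt.le (hp.lt j hjN).le ?_ h1
            rcases j with _ | j
            · rcases hp.y0 with h | h <;> rw [h]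
              · exact Or.inl rfl
              · exact Or.inr (Or.inl rfl)
            · exact Or.inr (Or.inr ⟨σ j, s1 j (by omega), hp.yw j (by omega)⟩)
          have hyH1 : y j ∈ H (k + 1) := by
            have h1 : y j ∈ H (σ j) := by
              rw [hc.hpre _ (hp.lt j hjN)]; exact mem_preB (hp.mem j hjN)
            exact hc.alive hlt (hp.lt j hjN).le (dn_mono (Nat.le_succ k) (hc.mem_dn k hk.le _ hyH)) h1
          have hyc : y j ∈ (st k).A ++ [(st k).l] ∨ y j ∈ (st k).r :: (st k).C := by
            rw [hc.hpost k hk] at hyH1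
            have : y j ≠ (st k).w := by intro e; exact hc.wnew k hk (e ▸ hc.mem_dn k hk.le _ hyH)
            exact mem_spl (mem_postS hyH1 this)
          have hv' : ∃ v : ℝ × ℝ, (δ (st k).l).1 < v.1 ∧ v.1 < (δ (st k).r).1 ∧
              ((st k).B.IsChain (fun a b => 0 < orient (δ a) (δ b) v)) ∧
              ((mC → (δ (y j)).1 ≤ v.1) → ∀ i, j ≤ i → i < N → 
                (∀ a ∈ (st k).A ++ [(st k).l] ++ (st k).r :: (st k).C, (mC → (δ (y j)).1 ≤ (δ a).1) → Ab (δ a) v (Q i)) ∧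
                (∀ i', i < i' → i' < N → Ab v (Q i) (Q i')) ∧
                (v.1 < (δ (y j)).1 → v.1 < (Q i).1) ∧ ((δ (y j)).1 < v.1 → (Q i).1 < v.1)) := by
            rcases hyc with hyc | hyc
            · exact fut_R hc hk hpr.srt hfu hyc
            · by_cases hm : mC
              · have hs := hpr.srt
                rw [hc.hpre k hk] at hs
                have o := mk_ord (X := fun a => (δ a).1) hs
                have hs := (chain_pre.1 hs).2.1
                have e : (st k).l :: ((st k).M ++ [(st k).r]) = (st k).B := rfl
                have e' : (st k).B.map δ = δ (st k).l :: ((st k).M.map δ ++ [δ (st k).r]) := by simp [Step.B]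
                rw [e, ← map_chain (R := fun a b => a.1 < b.1), e'] at hs
                obtain ⟨v, v1, v2, v3⟩ := insU hs
                rw [← e', map_chain] at v3
                refine ⟨v, v1, v2, v3, fun h => ?_⟩
                have := h hm
                have := o.rC _ hyc
                linarith
              · exact fut_L hc hm hk hpr.srt hfu hyc
          obtain ⟨v, v1, v2, v3, v4⟩ := hv'
          obtain ⟨q1, q2⟩ := pre_step hc hp hk hj s1 hpr v v1 v2 v3
          refine ⟨_, j, hj, fun i hi => (s1 i hi).trans (Nat.lt_succ_self k), ?_, q1, fun _ => fut_off hc hk hfu v hyH q2 v4⟩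
          intro i hi hiN
          rcases hi.lt_or_eq with h | rfl
          · have := hp.smono hc h hiN; omega
          · omega
        · -- on path
          have hup : ∀ a ∈ H (σ j), Function.update δ (st (σ j)).w (Q j) a = δ a := by
            intro a ha
            apply Function.update_of_ne
            rintro rfl; exact hc.wnew _ hk (hc.mem_dn _ hk.le _ ha)
          obtain ⟨⟨v1, v2, v3⟩, hfut⟩ := fut_on hc hp hmC hex hjN hpr.srt hfu hup (hx3 j) (hx4 j) (hv j)
          obtain ⟨q1, q2⟩ := pre_step hc hp hk hj s1 hpr _ v1 v2 v3
          refine ⟨_, j + 1, hjN, ?_, ?_, ⟨q1.cw, q1.co, q1.d0, q1.d1, ?_, q1.srt⟩, fun _ => hfut⟩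
          · intro i hi
            rcases Nat.lt_succ_iff_lt_or_eq.1 hi with h | rfl
            · exact (s1 i h).trans (Nat.lt_succ_self _)
            · exact Nat.lt_succ_self _
          · intro i hi hiN
            exact hp.smono hc hi hiN
          · intro i hi
            rcases Nat.lt_succ_iff_lt_or_eq.1 hi with h | rfl
            · exact q1.dq i h
            · rw [hp.yw i hjN]; exact Function.update_self ..
      · have hs := hpr.srt
        rw [hc.hpre k hk] at hs
        have hs := (chain_pre.1 hs).2.1
        have e : (st k).l :: ((st k).M ++ [(st k).r]) = (st k).B := rfl
        have e' : (st k).B.map δ = δ (st k).l :: ((st k).M.map δ ++ [δ (st k).r]) := by simp [Step.B]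
        rw [e, ← map_chain (R := fun a b => a.1 < b.1), e'] at hs
        obtain ⟨v, v1, v2, v3⟩ := insU hs
        rw [← e', map_chain] at v3
        obtain ⟨q1, q2⟩ := pre_step hc hp hk hj s1 hpr v v1 v2 v3
        refine ⟨_, j, le_rfl, fun i hi => (s1 i hi).trans (Nat.lt_succ_self k), by omega, q1, by simp⟩
  obtain ⟨δ, j, hj, s1, s2, hpr, -⟩ := main n le_rfl
  have hjN : j = N := by
    rcases hj.lt_or_eq with h | h
    · have := s2 j le_rfl h; have := hp.lt j h; omega
    · exact h
  subst hjN
  refine ⟨δ, criterion hc δ (by rw [hpr.d0, hpr.d1]; exact hpp) hpr.cw hpr.co, hpr.dq⟩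

end pathdraw

end

end FP


namespace FP

noncomputable section

open Classical Filter

lemma ev_lin (c d : ℝ) (hd : 0 < d) : ∀ᶠ Y : ℝ in atTop, 0 < c + Y * d := by
  have : Tendsto (fun Y : ℝ => c + Y * d) atTop atTop :=
    tendsto_atTop_add_const_left _ _ (tendsto_id.atTop_mul_const hd)
  exact this.eventually_gt_atTop 0

lemma ev_range {N : ℕ} {P : ℕ → ℝ → Prop} (h : ∀ i < N, ∀ᶠ Y in atTop, P i Y) :
    ∀ᶠ Y in atTop, ∀ i < N, P i Y := by
  have := (Filter.eventually_all_finset (l := atTop) (p := P) (Finset.range N)).2 (fun i hi => h i (by simpa using hi))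
  simpa using this

variable {W : Type*} [Finite W] {E : SimpleGraph W} {f0 f1 : W} {n : ℕ} {st : ℕ → Step W}
    {H : ℕ → List W} 

theorem drawC (hc : IsCan E f0 f1 n st H) {N : ℕ} {y : ℕ → W} {σ : ℕ → ℕ}
    (hp : IsPath f0 f1 n st N y σ) (hy : y 0 ≠ f1) (hl : ∀ j < N, y j = (st (σ j)).l)
    (Q : ℕ → ℝ × ℝ) (hQ : ∀ i i', i < i' → i' < N → (Q i).1 < (Q i').1) :
    ∃ δ, PlaneD E δ ∧ ∀ i < N, δ (y (i + 1)) = Q i := by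
  have hR : ∀ᶠ R : ℝ in atTop, ∀ i < N, |(Q i).1| < R := ev_range (fun i _ => eventually_gt_atTop _)
  obtain ⟨R, hR, hR1⟩ := (hR.and (eventually_gt_atTop 0)).exists
  have hR' : ∀ i < N, -R < (Q i).1 ∧ (Q i).1 < R := fun i hi => abs_lt.1 (hR i hi)
  have hY1 : ∀ᶠ Y : ℝ in atTop, ∀ i < N, 0 < 2 * R * (Q i).2 + Y * ((Q i).1 + R) :=
    ev_range (fun i hi => ev_lin _ _ (by linarith [hR' i hi]))
  have hY2 : ∀ᶠ Y : ℝ in atTop, ∀ i' < N, ∀ i < i', 0 < ((R - (Q i).1) * ((Q i').2 - (Q i).2) + (Q i).2 * ((Q i').1 - (Q i).1)) +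
      Y * ((Q i').1 - (Q i).1) :=
    ev_range (fun i' hi' => ev_range (fun i hi => ev_lin _ _ (by linarith [hQ i i' hi hi'])))
  obtain ⟨Y, hY1, hY2⟩ := (hY1.and hY2).exists
  have hy0 : y 0 = f0 := hp.y0.resolve_right hy
  refine pathdraw hc hp (mC := True) (ex := fun _ => True) (Q := Q) (p0 := (-R, 0)) (p1 := (R, -Y))
    (fun _ => hl) (by simp) (by simp; linarith) ?_ ?_ ?_ ?_ ?_ (by simp)
  · intro i hi
    refine ⟨(hR' i hi).1, (hR' i hi).2, ?_⟩
    unfold Ab orient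
    have := hY1 i hi
    apply mul_pos
    · simp only; linarith
    · simp only; linarith
  · intro h; exact absurd ⟨hy0, trivial⟩ h
  · intro _ i i' hii hi'
    rw [Ab_symm]
    have hi := hR' i (by omega)
    unfold Ab orient
    have := hY2 i' hi' i hii
    apply mul_pos
    · simp only; linarith
    · simp only; linarith
  · intro j i hj hi _
    exact hQ j i hj hi
  · intro j i hj hi h
    exfalso
    have h2 := hl (j + 1) (by omega)
    rw [h] at h2
    have hk := hp.lt (j + 1) (by omega)
    obtain ⟨ξ, h'⟩ := xi_exists hc
    have := (h'.lw _ hk).trans (h'.wr _ hk)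
    rw [h2] at this; exact lt_irrefl _ this

lemma ab_far {L x1 x2 h0 h1 h2 Λ T : ℝ} (h01 : h0 < h1) (h12 : h1 < h2) (hx1 : |x1| ≤ T) (hx2 : |x2| ≤ T)
    (hL : L = T * Λ) (hT : 0 < T) (hΛ1 : 1 < Λ) (hΛ : 2 * (h2 - h0) < Λ * (h2 - h1)) :
    Ab (-L, h0) (x1, h1) (x2, h2) := by
  unfold Ab orient
  simp only
  rw [abs_le] at hx1 hx2
  have hTL : T < L := by rw [hL]; nlinarith
  apply mul_pos
  · linarith
  · have e1 : T * (2 * (h2 - h0)) < T * (Λ * (h2 - h1)) := mul_lt_mul_of_pos_left hΛ hT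
    have e2 : -T * (h2 - h0) ≤ x1 * (h2 - h0) := mul_le_mul_of_nonneg_right hx1.1 (by linarith)
    have e3 : x2 * (h1 - h0) ≤ T * (h1 - h0) := mul_le_mul_of_nonneg_right hx2.2 (by linarith)
    have e4 : T * (h1 - h0) ≤ T * (h2 - h0) := mul_le_mul_of_nonneg_left (by linarith) hT.le
    have e5 : T * (Λ * (h2 - h1)) = L * (h2 - h1) := by rw [hL]; ring
    nlinarith

lemma ab_far' {L x1 x2 h0 h1 h2 Λ T : ℝ} (h01 : h0 < h1) (h12 : h1 < h2) (hx1 : |x1| ≤ T) (hx2 : |x2| ≤ T)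
    (hL : L = T * Λ) (hT : 0 < T) (hΛ1 : 1 < Λ) (hΛ : 2 * (h2 - h0) < Λ * (h2 - h1)) :
    Ab (L, h0) (x1, h1) (x2, h2) := by
  have := ab_far h01 h12 (by rwa [abs_neg] : |-x1| ≤ T) (by rwa [abs_neg] : |-x2| ≤ T) hL hT hΛ1 hΛ
  rw [← Ab_sg] at this
  simpa [sg] using this

theorem drawB (hc : IsCan E f0 f1 n st H) {N : ℕ} {y : ℕ → W} {σ : ℕ → ℕ}
    (hp : IsPath f0 f1 n st N y σ) (hb s : ℕ → ℝ) (hm : StrictMono hb) :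
    ∃ δ, PlaneD E δ ∧ ∀ i, i + 1 < N → y (i + 1) ∈ (st (σ (i + 1))).M → δ (y (i + 1)) = (s i, hb (i + 1)) := by
  have h1 : ∀ᶠ Λ : ℝ in atTop, ∀ i < N, |s i| ≤ Λ := ev_range (fun i _ => eventually_ge_atTop _)
  have h2 : ∀ᶠ Λ : ℝ in atTop, ∀ c < N + 2, ∀ b < c, ∀ a < b,
      0 < -(2 * (hb c - hb a)) + Λ * (hb c - hb b) :=
    ev_range (fun c _ => ev_range (fun b hbc => ev_range (fun a _ => ev_lin _ _ (sub_pos.2 (hm hbc)))))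
  obtain ⟨Λ, ⟨h1, h2⟩, hΛ⟩ := ((h1.and h2).and (eventually_gt_atTop 1)).exists
  have h2' : ∀ a b c, a < b → b < c → c < N + 2 → 2 * (hb c - hb a) < Λ * (hb c - hb b) := by
    intro a b c h h' h''; linarith [h2 c h'' b h' a h]
  let x : ℕ → ℝ := fun i => if i + 1 < N ∧ y (i + 1) = (st (σ (i + 1))).l then - Λ ^ (N - i)
    else if i + 1 < N ∧ y (i + 1) = (st (σ (i + 1))).r then Λ ^ (N - i) else s i
  have hpos : ∀ m : ℕ, 0 < Λ ^ m := fun m => pow_pos (by linarith) m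
  have hx : ∀ i < N, |x i| ≤ Λ ^ (N - i) := by
    intro i hi
    simp only [x]
    split_ifs
    · rw [abs_neg, abs_of_pos (hpos _)]
    · rw [abs_of_pos (hpos _)]
    · calc |s i| ≤ Λ := h1 i hi
        _ = Λ ^ 1 := (pow_one _).symm
        _ ≤ Λ ^ (N - i) := pow_le_pow_right₀ hΛ.le (by omega)
  have hx' : ∀ m, ∀ i < N, N - i ≤ m → |x i| ≤ Λ ^ m := fun m i hi h =>
    (hx i hi).trans (pow_le_pow_right₀ hΛ.le h)
  have hlt : ∀ m, Λ ^ m < Λ ^ (m + 1) := fun m => pow_lt_pow_right₀ hΛ (by omega)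
  have hlr : ∀ k < n, (st k).l ≠ (st k).r := by
    intro k hk e
    obtain ⟨ξ, h'⟩ := xi_exists hc
    have := (h'.lw _ hk).trans (h'.wr _ hk)
    rw [e] at this; exact lt_irrefl _ this
  have xl : ∀ j, j + 1 < N → y (j + 1) = (st (σ (j + 1))).l → x j = - Λ ^ (N - j) := by
    intro j hj h; simp only [x]; rw [if_pos ⟨hj, h⟩]
  have xr : ∀ j, j + 1 < N → y (j + 1) = (st (σ (j + 1))).r → x j = Λ ^ (N - j) := by
    intro j hj h; simp only [x]; rw [if_neg, if_pos ⟨hj, h⟩]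
    rintro ⟨_, h'⟩
    exact hlr _ (hp.lt _ hj) (h'.symm.trans h)
  refine (?_ : _ → _) (pathdraw hc hp (mC := False) (ex := fun j => y j ∈ (st (σ j)).M) (Q := fun i => (x i, hb (i + 1)))
    (p0 := (-Λ ^ (N + 1), hb 0)) (p1 := (Λ ^ (N + 1), hb 0))
    (by simp) (fun j _ h => Or.inr h) (by simp; linarith [hpos (N + 1)]) ?_ ?_ ?_ ?_ ?_ ?_)
  · rintro ⟨δ, hδ, hd⟩
    refine ⟨δ, hδ, ?_⟩
    intro i hi hM
    rw [hd i (by omega)]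
    have nl : ¬ (i + 1 < N ∧ y (i + 1) = (st (σ (i + 1))).l) := by
      rintro ⟨_, h⟩; rw [h] at hM
      exact hc.nodupS (hp.lt _ hi) (by simp) hM
    have nr : ¬ (i + 1 < N ∧ y (i + 1) = (st (σ (i + 1))).r) := by
      rintro ⟨_, h⟩; rw [h] at hM
      exact hc.nodupS (hp.lt _ hi) (by simp) hM
    simp only [x]; rw [if_neg nl, if_neg nr]
  · intro i hi
    have := abs_le.1 (hx' N i hi (by omega))
    have := hlt N
    have := hm (show 0 < i + 1 by omega)
    refine ⟨by simp only; linarith, by simp only; linarith, ?_⟩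
    unfold Ab orient
    have := hpos (N + 1)
    simp only
    apply mul_pos
    · linarith
    · have : 0 < (Λ ^ (N + 1) - -Λ ^ (N + 1)) * (hb (i + 1) - hb 0) := mul_pos (by linarith) (by linarith)
      linarith
  · intro _ i i' hii hi'
    exact ab_far (hm (by omega)) (hm (by omega)) (hx' N i (by omega) (by omega)) (hx' N i' (by omega) (by omega))
      (pow_succ _ _) (hpos N) hΛ (h2' _ _ _ (by omega) (by omega) (by omega))
  · intro _ i i' hii hi'
    exact ab_far' (hm (by omega)) (hm (by omega)) (hx' N i (by omega) (by omega)) (hx' N i' (by omega) (by omega))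
      (pow_succ _ _) (hpos N) hΛ (h2' _ _ _ (by omega) (by omega) (by omega))
  · intro j i hj hi h
    simp only
    rw [xl j (by omega) h]
    have := abs_le.1 (hx' (N - j - 1) i hi (by omega))
    have := hlt (N - j - 1)
    rw [show N - j - 1 + 1 = N - j by omega] at this
    linarith
  · intro j i hj hi h
    simp only
    rw [xr j (by omega) h]
    have := abs_le.1 (hx' (N - j - 1) i hi (by omega))
    have := hlt (N - j - 1)
    rw [show N - j - 1 + 1 = N - j by omega] at this
    linarith
  · intro j i i' hj hii hi' hne
    have hmem := hp.mem (j + 1) (by omega)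
    have hk : y (j + 1) = (st (σ (j + 1))).l ∨ y (j + 1) = (st (σ (j + 1))).r := by
      simp only [Step.B, List.mem_cons, List.mem_append, List.mem_singleton, List.not_mem_nil, or_false] at hmem
      tauto
    have hpw : Λ ^ (N - j) = Λ ^ (N - j - 1) * Λ := by
      rw [← pow_succ]; congr 1; omega
    rcases hk with h | h
    · rw [xl j (by omega) h]
      exact ab_far (hm (by omega)) (hm (by omega)) (hx' (N - j - 1) i (by omega) (by omega)) (hx' (N - j - 1) i' (by omega) (by omega))
        hpw (hpos _) hΛ (h2' _ _ _ (by omega) (by omega) (by omega))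
    · rw [xr j (by omega) h]
      exact ab_far' (hm (by omega)) (hm (by omega)) (hx' (N - j - 1) i (by omega) (by omega)) (hx' (N - j - 1) i' (by omega) (by omega))
        hpw (hpos _) hΛ (h2' _ _ _ (by omega) (by omega) (by omega))

end

end FP


namespace FP

noncomputable section

open Classical

structure Rot {W : Type*} (E : SimpleGraph W) (nx : W → W → W) (th : W → W → ℝ) (ht : W → ℝ) : Prop where
  adj : ∀ {v u}, E.Adj v u → E.Adj v (nx v u)
  adj' : ∀ {v u}, E.Adj v u → E.Adj u (nx v u)
  tri : ∀ {v u}, E.Adj v u → nx u (nx v u) = v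
  inj : ∀ {v u w}, E.Adj v u → E.Adj v w → th v u = th v w → u = w
  succ : ∀ {v u w}, E.Adj v u → E.Adj v w → th v u < th v w →
    th v u < th v (nx v u) ∧ th v (nx v u) ≤ th v w
  wrap : ∀ {v u}, E.Adj v u → (∀ w, E.Adj v w → th v w ≤ th v u) →
    ∀ w, E.Adj v w → th v (nx v u) ≤ th v w
  low : ∀ {v u}, E.Adj v u → (ht u < ht v ↔ th v u < 0)
  hinj : Function.Injective ht

variable {W : Type*} [Fintype W] {E : SimpleGraph W} {nx : W → W → W} {th : W → W → ℝ} {ht : W → ℝ}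

/-- `nx w v` is the predecessor of `w` at `v` -/
lemma Rot.inv (R : Rot E nx th ht) {v u : W} (h : E.Adj v u) : nx v (nx u v) = u := R.tri h.symm

lemma Rot.inv' (R : Rot E nx th ht) {v u : W} (h : E.Adj v u) : nx (nx v u) v = u := by
  have := R.tri (R.adj' h)
  rwa [R.tri h] at this

lemma Rot.cancel (R : Rot E nx th ht) {v u w : W} (h : E.Adj v u) (h' : E.Adj v w)
    (e : nx v u = nx v w) : u = w := by
  rw [← R.inv' h, e, R.inv' h']

lemma Rot.cyc (R : Rot E nx th ht) {v : W} {S : Set W} (hS : ∀ u ∈ S, E.Adj v u)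
    (hn : ∀ u ∈ S, nx v u ∈ S) (hne : S.Nonempty) : ∀ u, E.Adj v u → u ∈ S := by
  obtain ⟨m, hm, hmax⟩ := Set.exists_max_image S (th v) S.toFinite hne
  have hglob : ∀ w, E.Adj v w → th v w ≤ th v m := by
    intro w hw
    by_contra h
    have := R.succ (hS m hm) hw (not_le.1 h)
    linarith [hmax _ (hn m hm)]
  have hmin := R.wrap (hS m hm) hglob
  have hmS := hn m hm
  by_contra hcon
  push Not at hcon
  obtain ⟨z, hz, hzmin⟩ := Set.exists_min_image {u | E.Adj v u ∧ u ∉ S} (th v) (Set.toFinite _) hcon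
  have hlt : th v (nx v m) < th v z := lt_of_le_of_ne (hmin z hz.1) (fun e => hz.2 (by
    rw [← R.inj (R.adj (hS m hm)) hz.1 e]; exact hmS))
  obtain ⟨p, hp, hpmax⟩ := Set.exists_max_image {u | E.Adj v u ∧ th v u < th v z} (th v) (Set.toFinite _)
    ⟨_, R.adj (hS m hm), hlt⟩
  have hpS : p ∈ S := by
    by_contra h; linarith [hzmin p ⟨hp.1, h⟩, hp.2]
  have h1 := R.succ hp.1 hz.1 hp.2
  have : nx v p = z := by
    apply R.inj (R.adj hp.1) hz.1
    by_contra hne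
    have := hpmax (nx v p) ⟨R.adj hp.1, lt_of_le_of_ne h1.2 hne⟩
    linarith [h1.1]
  exact hz.2 (this ▸ hn p hpS)

lemma Rot.star (R : Rot E nx th ht) {v u : W} (h : E.Adj v u) :
    ∃ L : List W, L.Nodup ∧ L.IsChain (fun a b => nx v a = b) ∧ L.head? = some u ∧
      (∀ z, z ∈ L ↔ E.Adj v z) ∧ ∀ w ∈ L.getLast?, nx v w = u := by
  let P : ℕ → Prop := fun k => ∃ L : List W, L.length = k ∧ L.Nodup ∧ L.IsChain (fun a b => nx v a = b) ∧
    L.head? = some u ∧ (∀ z ∈ L, E.Adj v z)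
  have hP1 : P 1 := ⟨[u], rfl, by simp, by simp, by simp, by simpa using h⟩
  have hPb : ∀ k, P k → k ≤ Fintype.card W := by
    rintro k ⟨L, rfl, hn, -⟩; exact hn.length_le_card
  have hmax := Nat.findGreatest_spec (P := P) (hPb 1 hP1) hP1
  obtain ⟨L, hlen, hn, hch, hhd, hadj⟩ := hmax
  have hLne : L ≠ [] := by rintro rfl; simp at hhd
  obtain ⟨L0, l, hLl⟩ := (List.eq_nil_or_concat L).resolve_left hLne
  rw [List.concat_eq_append] at hLl
  subst hLl
  have hl : E.Adj v l := hadj l (by simp)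
  have hmem : nx v l ∈ L0 ++ [l] := by
    by_contra hcon
    have : P ((L0 ++ [l]).length + 1) := by
      refine ⟨(L0 ++ [l]) ++ [nx v l], by simp, ?_, ?_, ?_, ?_⟩
      · rw [List.nodup_append]
        refine ⟨hn, by simp, ?_⟩
        rintro a ha b hb rfl
        simp only [List.mem_singleton] at hb
        exact hcon (hb ▸ ha)
      · rw [List.isChain_append]
        exact ⟨hch, by simp, by simp⟩
      · rw [List.head?_append, hhd]; rfl
      · intro z hz
        rcases List.mem_append.1 hz with hz | hz
        · exact hadj z hz
        · simp at hz; rw [hz]; exact R.adj hl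
    have := Nat.le_findGreatest (hPb _ this) this
    omega
  have hu : nx v l = u := by
    obtain ⟨s, t, hst⟩ := List.append_of_mem hmem
    rcases List.eq_nil_or_concat s with rfl | ⟨s', y, hsy⟩
    · rw [hst] at hhd; simpa using hhd
    · exfalso
      rw [List.concat_eq_append] at hsy
      subst hsy
      rw [hst] at hch hadj
      have hy : nx v y = nx v l := by
        rw [List.isChain_append] at hch
        exact hch.2.2 y (by simp) (nx v l) (by simp)
      have := R.cancel (hadj y (by simp)) hl hy
      subst this
      have hlast : y ∈ nx v y :: t := by
        have e : (L0 ++ [y]).getLast? = some y := by simp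
        rw [hst, List.getLast?_append] at e
        cases h' : (nx v y :: t).getLast? with
        | none => simp at h'
        | some a =>
          rw [h'] at e; simp at e
          have h2 := List.mem_of_getLast? h'
          rwa [e] at h2
      rw [hst, List.nodup_append] at hn
      exact hn.2.2 y (by simp) y hlast rfl
  refine ⟨_, hn, hch, hhd, fun z => ⟨hadj z, ?_⟩, by simpa using hu⟩
  refine R.cyc (S := {z | z ∈ L0 ++ [l]}) hadj ?_ ⟨l, by simp⟩ z
  intro x hx
  obtain ⟨s, t, hst⟩ := List.append_of_mem (show x ∈ L0 ++ [l] from hx)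
  rcases t with _ | ⟨b, t⟩
  · have : x = l := by
      have := congrArg List.getLast? hst; simpa using this.symm
    rw [this]; exact hmem
  · rw [hst, List.isChain_split] at hch
    have := hch.2
    rw [List.isChain_cons_cons] at this
    show nx v x ∈ L0 ++ [l]
    rw [this.1, hst]; simp

/-- face functions for mod 2 cycles -/
lemma Rot.prefix (R : Rot E nx th ht) {v : W} {Z : W → ZMod 2} (Z0 : ∀ b, ¬ E.Adj v b → Z b = 0)
    (Zr : ∑ b, Z b = 0) {x : W} (hx : E.Adj v x) :
    (∑ w, if th v w ≤ th v (nx v x) then Z w else 0) = (∑ w, if th v w ≤ th v x then Z w else 0) + Z (nx v x) := by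
  have hy := R.adj hx
  by_cases h : ∃ w, E.Adj v w ∧ th v x < th v w
  · obtain ⟨w, hw, hlt⟩ := h
    have h1 := (R.succ hx hw hlt).1
    have e : Z (nx v x) = ∑ w, if w = nx v x then Z w else 0 := by simp
    rw [e, ← Finset.sum_add_distrib]
    apply Finset.sum_congr rfl
    intro z _
    by_cases hz : E.Adj v z
    · by_cases e1 : z = nx v x
      · subst e1; simp [not_le.2 h1]
      · simp only [e1, if_false, add_zero]
        congr 1
        apply propext
        constructor
        · intro h2; by_contra h3
          have := (R.succ hx hz (not_le.1 h3)).2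
          exact e1 (R.inj hz hy (le_antisymm h2 this))
        · intro h2; linarith
    · simp [Z0 z hz]
  · push Not at h
    have hw := R.wrap hx h
    have e1 : (∑ w, if th v w ≤ th v x then Z w else 0) = 0 := by
      refine Eq.trans (Finset.sum_congr rfl ?_) Zr
      intro z _
      by_cases hz : E.Adj v z
      · rw [if_pos (h z hz)]
      · simp [Z0 z hz]
    rw [e1, zero_add]
    rw [Finset.sum_eq_single (nx v x)]
    · simp
    · intro z _ hne
      by_cases hz : E.Adj v z
      · rw [if_neg]
        intro h2; exact hne (R.inj hz hy (le_antisymm h2 (hw z hz)))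
      · simp [Z0 z hz]
    · simp

theorem Rot.H1 (R : Rot E nx th ht) : ∀ (N : ℕ) (Z : W → W → ZMod 2), (∀ a b, Z a b = Z b a) →
    (∀ a b, ¬ E.Adj a b → Z a b = 0) → (∀ a, ∑ b, Z a b = 0) →
    (Finset.univ.filter (fun v => ∃ a b, Z a b ≠ 0 ∧ ht v ≤ ht a)).card ≤ N →
    ∃ F : W → W → ZMod 2, (∀ v u, E.Adj v u → F v u = F u (nx v u)) ∧
      (∀ v u, E.Adj v u → F v u + F u v = Z v u) := by
  intro N
  induction N with
  | zero =>
    intro Z _ _ _ hcard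
    have hZ : ∀ a b, Z a b = 0 := by
      intro a b; by_contra h
      have : a ∈ (Finset.univ.filter (fun v => ∃ a b, Z a b ≠ 0 ∧ ht v ≤ ht a)) := by
        simp; exact ⟨a, ⟨b, h⟩, le_rfl⟩
      rw [Finset.card_eq_zero.1 (Nat.le_zero.1 hcard)] at this
      simp at this
    exact ⟨fun _ _ => 0, by simp, by simp [hZ]⟩
  | succ N ih =>
    intro Z Zs Z0 Zr hcard
    by_cases hZ : ∃ a b, Z a b ≠ 0
    swap
    · push Not at hZ
      exact ⟨fun _ _ => 0, by simp, by simp [hZ]⟩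
    obtain ⟨v, hv, hvmax⟩ := Set.exists_max_image {a | ∃ b, Z a b ≠ 0} ht (Set.toFinite _) hZ
    have two : ∀ x : ZMod 2, x + x = 0 := fun x => CharTwo.add_self_eq_zero x
    let P : W → ZMod 2 := fun u => ∑ w, if th v w ≤ th v u then Z v w else 0
    have hP : ∀ x, E.Adj v x → P (nx v x) = P x + Z v (nx v x) := fun x hx =>
      R.prefix (Z0 v) (Zr v) hx
    let F : W → W → ZMod 2 := fun a b => if a = v then P b else if b = v then P (nx a v) else
      if E.Adj v a ∧ b = nx v a then P a else 0
    have hF1 : ∀ b, F v b = P b := fun b => by simp [F]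
    have hF2 : ∀ a, a ≠ v → F a v = P (nx a v) := fun a h => by simp [F, h]
    have hF3 : ∀ a b, a ≠ v → b ≠ v → F a b = if E.Adj v a ∧ b = nx v a then P a else 0 := fun a b h h' => by
      simp [F, h, h']
    have hFc : ∀ a b, E.Adj a b → F a b = F b (nx a b) := by
      intro a b hab
      by_cases ha : a = v
      · subst ha
        rw [hF1, hF3 b _ hab.ne' (R.adj hab).ne', if_pos ⟨hab, rfl⟩]
      by_cases hb : b = v
      · subst hb
        rw [hF1, hF2 a ha]
      rw [hF3 a b ha hb]
      split_ifs with h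
      · obtain ⟨h1, rfl⟩ := h
        rw [R.tri h1, hF2 _ hb, R.inv' h1]
      · by_cases hc : nx a b = v
        · exfalso; apply h
          have h1 := R.adj' hab
          have h2 := R.tri hab
          rw [hc] at h1 h2
          have h3 := R.adj hab
          rw [hc] at h3
          have := R.tri h1
          rw [h2] at this
          exact ⟨h3.symm, this.symm⟩
        · rw [hF3 b _ hb hc, if_neg]
          rintro ⟨h1, h2⟩
          have h3 := R.tri h1
          rw [← h2, R.tri hab] at h3
          exact ha h3
    have hFv : ∀ u, E.Adj v u → F v u + F u v = Z v u := by
      intro u hu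
      rw [hF1, hF2 u hu.ne']
      have h1 := hP (nx u v) (R.adj' hu.symm)
      rw [R.tri hu.symm] at h1
      rw [h1, add_assoc, add_comm (Z v u), ← add_assoc, two, zero_add]
    have hlowZ : ∀ w, Z v w ≠ 0 → E.Adj v w ∧ th v w < 0 := by
      intro w hw
      have h1 : E.Adj v w := by by_contra h; exact hw (Z0 _ _ h)
      refine ⟨h1, (R.low h1).1 ?_⟩
      apply lt_of_le_of_ne (hvmax w ⟨v, by rwa [Zs]⟩)
      intro e; exact h1.ne' (R.hinj e)
    have hPl : ∀ a, E.Adj v a → P a ≠ 0 → ht a < ht v ∧ ht (nx v a) < ht v := by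
      intro a ha hPa
      have : ∃ w, Z v w ≠ 0 ∧ th v a < th v w := by
        by_contra hcon
        push Not at hcon
        apply hPa
        refine Eq.trans (Finset.sum_congr rfl ?_) (Zr v)
        intro z _
        by_cases hz : Z v z = 0
        · simp [hz]
        · rw [if_pos (hcon z hz)]
      obtain ⟨w, hw, hlt⟩ := this
      obtain ⟨hw1, hw2⟩ := hlowZ w hw
      have := R.succ ha hw1 hlt
      exact ⟨(R.low ha).2 (by linarith), (R.low (R.adj ha)).2 (by linarith)⟩
    let Z' : W → W → ZMod 2 := fun a b => if E.Adj a b then Z a b + (F a b + F b a) else 0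
    have hZ' : ∀ a b, Z' a b ≠ 0 → ht a < ht v := by
      intro a b hab
      have hadj : E.Adj a b := by by_contra h; exact hab (by simp [Z', h])
      have e : Z' a b = Z a b + (F a b + F b a) := by simp [Z', hadj]
      rw [e] at hab
      by_cases ha : a = v
      · subst ha; rw [hFv b hadj, two] at hab; exact absurd rfl hab
      by_cases hb : b = v
      · subst hb; rw [add_comm (F a b), hFv a hadj.symm, Zs, two] at hab; exact absurd rfl hab
      by_cases h1 : Z a b = 0
      · rw [h1, zero_add, hF3 a b ha hb, hF3 b a hb ha] at hab
        by_cases h2 : E.Adj v a ∧ b = nx v a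
        · by_cases h3 : P a = 0
          · rw [if_pos h2, h3, zero_add] at hab
            split_ifs at hab with h4
            · rw [h4.2]; exact (hPl b h4.1 hab).2
            · exact absurd rfl hab
          · exact (hPl a h2.1 h3).1
        · rw [if_neg h2, zero_add] at hab
          split_ifs at hab with h4
          · rw [h4.2]; exact (hPl b h4.1 hab).2
          · exact absurd rfl hab
      · exact lt_of_le_of_ne (hvmax a ⟨b, h1⟩) (fun e => ha (R.hinj e))
    refine (?_ : _ → _) (ih Z' ?_ ?_ ?_ ?_)
    · rintro ⟨G, hG1, hG2⟩
      refine ⟨fun a b => G a b + F a b, ?_, ?_⟩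
      · intro a b hab; simp only; rw [hG1 a b hab, hFc a b hab]
      · intro a b hab
        have := hG2 a b hab
        simp only [Z', hab, if_true] at this
        have e : G a b + F a b + (G b a + F b a) = (G a b + G b a) + (F a b + F b a) := by ring
        rw [e, this, add_assoc, two, add_zero]
    · intro a b
      simp only [Z', E.adj_comm a b, Zs a b, add_comm (F a b)]
    · intro a b h; simp [Z', h]
    · intro a
      have e : ∑ b, Z' a b = ∑ b, Z a b + (∑ b ∈ Finset.univ.filter (fun b => E.Adj a b), F a b +
          ∑ b ∈ Finset.univ.filter (fun b => E.Adj a b), F b a) := by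
        rw [← Finset.sum_add_distrib, Finset.sum_filter, ← Finset.sum_add_distrib]
        apply Finset.sum_congr rfl
        intro b _
        by_cases h : E.Adj a b
        · simp [Z', h]
        · simp [Z', h, Z0 a b h]
      rw [e, Zr, zero_add]
      have e2 : ∑ b ∈ Finset.univ.filter (fun b => E.Adj a b), F b a =
          ∑ b ∈ Finset.univ.filter (fun b => E.Adj a b), F a b := by
        refine Finset.sum_bij' (fun b _ => nx b a) (fun b _ => nx a b) ?_ ?_ ?_ ?_ ?_
        · intro b hb; simp at hb ⊢; exact R.adj' hb.symm
        · intro b hb; simp at hb ⊢; exact R.adj hb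
        · intro b hb; simp at hb ⊢; exact R.tri hb.symm
        · intro b hb; simp at hb ⊢; exact R.inv' hb
        · intro b hb; simp at hb; exact hFc b a hb.symm
      rw [e2, two]
    · have : (Finset.univ.filter (fun x => ∃ a b, Z' a b ≠ 0 ∧ ht x ≤ ht a)).card <
          (Finset.univ.filter (fun x => ∃ a b, Z a b ≠ 0 ∧ ht x ≤ ht a)).card := by
        apply Finset.card_lt_card
        rw [Finset.ssubset_iff_of_subset]
        · refine ⟨v, ?_, ?_⟩
          · obtain ⟨b, hb⟩ := hv
            simp; exact ⟨v, ⟨b, hb⟩, le_rfl⟩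
          · simp only [Finset.mem_filter, Finset.mem_univ, true_and, not_exists, not_and, not_le]
            intro a b hab; exact hZ' a b hab
        · intro x hx
          simp only [Finset.mem_filter, Finset.mem_univ, true_and] at hx ⊢
          obtain ⟨a, b, hab, hx⟩ := hx
          obtain ⟨c, hc⟩ := hv
          exact ⟨v, c, hc, hx.trans (hZ' a b hab).le⟩
      omega

end

end FP


namespace FP

noncomputable section

open Classical

variable {W : Type*} [Fintype W] {E : SimpleGraph W} {nx : W → W → W} {th : W → W → ℝ} {ht : W → ℝ}

def Fan (E : SimpleGraph W) (nx : W → W → W) (D : Finset W) (c p q : W) : Prop :=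
  ∃ L : List W, L.Nodup ∧ L.IsChain (fun a b => nx c a = b) ∧ L.head? = some p ∧
    L.getLast? = some q ∧ ∀ z, z ∈ L ↔ E.Adj c z ∧ z ∈ D

def Tri (E : SimpleGraph W) (nx : W → W → W) (D : Finset W) : List W → Prop
  | p :: c :: q :: B => Fan E nx D c p q ∧ Tri E nx D (c :: q :: B)
  | _ => True

lemma Tri_split {D : Finset W} {x y : W} {B : List W} : ∀ A : List W,
    Tri E nx D (A ++ x :: y :: B) ↔ Tri E nx D (A ++ [x, y]) ∧ Tri E nx D (x :: y :: B)
  | [] => by simp [Tri]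
  | [a] => by simp [Tri]
  | [a, b] => by simp [Tri, and_assoc]
  | a :: b :: d :: A => by
    have := Tri_split (D := D) (x := x) (y := y) (B := B) (b :: d :: A)
    simp only [List.cons_append, Tri] at this ⊢
    rw [this, and_assoc]

lemma Fan.erase {D : Finset W} {c p q w : W} (h : Fan E nx D c p q) (hw : ¬ E.Adj c w) :
    Fan E nx (D.erase w) c p q := by
  obtain ⟨L, h1, h2, h3, h4, h5⟩ := h
  refine ⟨L, h1, h2, h3, h4, fun z => ?_⟩
  rw [h5, Finset.mem_erase]
  exact ⟨fun h => ⟨h.1, fun e => hw (e ▸ h.1), h.2⟩, fun h => ⟨h.1, h.2.2⟩⟩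

lemma Tri_erase {D : Finset W} {w : W} : ∀ Y : List W, Tri E nx D Y →
    (∀ m ∈ Y.tail.dropLast, ¬ E.Adj m w) → Tri E nx (D.erase w) Y
  | [], _, _ => trivial
  | [_], _, _ => trivial
  | [_, _], _, _ => trivial
  | p :: c :: q :: B, h, hm => by
    refine ⟨h.1.erase (hm c (by simp)), Tri_erase (c :: q :: B) h.2 ?_⟩
    intro m hm'
    exact hm m (by simp only [List.tail_cons, List.dropLast_cons_cons, List.mem_cons] at hm' ⊢; exact Or.inr hm')

lemma Tri_get {D : Finset W} : ∀ (X : List W), Tri E nx D X → ∀ i (h : i + 2 < X.length),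
    Fan E nx D X[i+1] X[i] X[i+2]
  | [], _, i, h => by simp at h
  | [_], _, i, h => by simp at h
  | [_, _], _, i, h => by simp at h
  | p :: c :: q :: B, hT, 0, h => hT.1
  | p :: c :: q :: B, hT, i + 1, h => by
    have := Tri_get (c :: q :: B) hT.2 i (by simp at h ⊢; omega)
    simpa using this

/-- last element removed -/
lemma Fan.dropLast (R : Rot E nx th ht) {D : Finset W} {c p q u : W} (h : Fan E nx D c p q)
    (hne : p ≠ q) (hu : nx c u = q) (hcu : E.Adj c u) : Fan E nx (D.erase q) c p u := by
  obtain ⟨L, h1, h2, h3, h4, h5⟩ := h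
  have hLne : L ≠ [] := by rintro rfl; simp at h3
  obtain ⟨L0, l, e⟩ := (List.eq_nil_or_concat L).resolve_left hLne
  rw [List.concat_eq_append] at e; subst e
  simp at h4; subst h4
  have hL0 : L0 ≠ [] := by rintro rfl; simp at h3; exact hne h3.symm
  obtain ⟨L1, y, e⟩ := (List.eq_nil_or_concat L0).resolve_left hL0
  rw [List.concat_eq_append] at e; subst e
  have hy : y = u := by
    rw [List.isChain_append] at h2
    have := h2.2.2 y (by simp) l (by simp)
    exact R.cancel ((h5 y).1 (by simp)).1 hcu (this.trans hu.symm)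
  subst hy
  have hnd := h1
  rw [List.nodup_append] at h1
  refine ⟨L1 ++ [y], h1.1, (List.isChain_append.1 h2).1, ?_, by simp, fun z => ?_⟩
  · cases L1 with
    | nil => simpa using h3
    | cons => simpa using h3
  · rw [Finset.mem_erase]
    constructor
    · intro hz
      exact ⟨((h5 z).1 (by simp only [List.mem_append] at hz ⊢; exact Or.inl hz)).1,
        h1.2.2 z hz l (by simp), ((h5 z).1 (by simp only [List.mem_append] at hz ⊢; exact Or.inl hz)).2⟩
    · rintro ⟨ha, hb, hc⟩
      have := (h5 z).2 ⟨ha, hc⟩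
      rcases List.mem_append.1 this with h | h
      · exact h
      · simp at h; exact absurd h hb

lemma Fan.tail {D : Finset W} {c p q u : W} (h : Fan E nx D c p q)
    (hne : p ≠ q) (hu : nx c p = u) : Fan E nx (D.erase p) c u q := by
  obtain ⟨L, h1, h2, h3, h4, h5⟩ := h
  match L, h1, h2, h3, h4, h5 with
  | [], h1, h2, h3, h4, h5 => simp at h3
  | [a], h1, h2, h3, h4, h5 => simp at h3 h4; exact absurd (h3.symm.trans h4) hne
  | a :: b :: L, h1, h2, h3, h4, h5 =>
    simp at h3; subst h3
    rw [List.isChain_cons_cons] at h2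
    rw [List.nodup_cons] at h1
    refine ⟨b :: L, h1.2, h2.2, by simp [← hu, h2.1], by simpa using h4, fun z => ?_⟩
    rw [Finset.mem_erase]
    constructor
    · intro hz
      exact ⟨((h5 z).1 (List.mem_cons_of_mem _ hz)).1, fun e => h1.1 (e ▸ hz),
        ((h5 z).1 (List.mem_cons_of_mem _ hz)).2⟩
    · rintro ⟨ha, hb, hc⟩
      exact (List.mem_cons.1 ((h5 z).2 ⟨ha, hc⟩)).resolve_left hb

lemma Rot.fanStar (R : Rot E nx th ht) {D : Finset W} {u c a b : W} (hc : E.Adj u c)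
    (hD : ∀ z, E.Adj u z → z ∈ D) (h1 : nx u c = a) (h2 : nx u b = c) (hb : E.Adj u b) (hac : a ≠ c) :
    Fan E nx (D.erase c) u a b := by
  obtain ⟨L, l1, l2, l3, l4, l5⟩ := R.star hc
  have hbc : c ≠ b := by rintro rfl; exact hac (h1.symm.trans h2)
  have : Fan E nx D u c b := by
    refine ⟨L, l1, l2, l3, ?_, fun z => ⟨fun h => ⟨(l4 z).1 h, hD z ((l4 z).1 h)⟩, fun h => (l4 z).2 h.1⟩⟩
    cases hl : L.getLast? with
    | none => rw [List.getLast?_eq_none_iff] at hl; subst hl; simp at l3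
    | some w =>
      have := l5 w hl
      have hw := (l4 w).1 (List.mem_of_getLast? hl)
      rw [R.cancel hw hb (this.trans h2.symm)]
  exact this.tail hbc h1

lemma Rot.fill (R : Rot E nx th ht) {D : Finset W} {c q qq : W} {B : List W} : ∀ (U : List W) (x p : W),
    (p :: (U ++ [q])).IsChain (fun a b => nx c a = b) → (∀ u ∈ p :: (U ++ [q]), E.Adj c u) →
    (∀ u ∈ U, ∀ z, E.Adj u z → z ∈ D) →
    (∀ y, (U ++ [q]).head? = some y → Fan E nx (D.erase c) p x y) →
    (∀ y, (p :: U).getLast? = some y → Fan E nx (D.erase c) q y qq) →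
    Tri E nx (D.erase c) (q :: qq :: B) → Tri E nx (D.erase c) (x :: p :: (U ++ q :: qq :: B))
  | [], x, p, hch, hadj, hD, hp, hq, hT => ⟨hp q (by simp), hq p (by simp), hT⟩
  | u :: U, x, p, hch, hadj, hD, hp, hq, hT => by
    simp only [List.cons_append] at hch hadj hp ⊢
    refine ⟨hp u (by simp), R.fill U p u (List.isChain_cons_cons.1 hch).2
      (fun v hv => hadj v (List.mem_cons_of_mem _ hv)) (fun v hv => hD v (List.mem_cons_of_mem _ hv)) ?_
      (fun y hy => hq y (by simpa using hy)) hT⟩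
    intro y hy
    have hcu := hadj u (by simp)
    have h1 := (List.isChain_cons_cons.1 hch).1
    have hup : nx u c = p := by rw [← h1]; exact R.inv' (hadj p (by simp))
    have huy : nx c u = y := by
      have := (List.isChain_cons_cons.1 hch).2
      rw [List.isChain_cons] at this
      exact this.1 y (by simp [hy])
    have hy' : E.Adj u y := huy ▸ R.adj' hcu
    refine R.fanStar hcu.symm (hD u (by simp)) hup ?_ hy' (hadj p (by simp)).ne'
    rw [← huy]; exact R.tri hcu

lemma chainF {c : W} {F Z : W → W → ZMod 2}
    (hF : ∀ u, E.Adj c u → F c (nx c u) = F c u + Z c (nx c u)) : ∀ (L : List W) (a b : W),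
    (a :: L).IsChain (fun a b => nx c a = b) → (∀ x ∈ a :: L, E.Adj c x) → (a :: L).getLast? = some b →
    F c b = F c a + (L.map (Z c)).sum
  | [], a, b, _, _, h => by simp at h; simp [h]
  | d :: L, a, b, hch, hadj, h => by
    have h1 := (List.isChain_cons_cons.1 hch)
    rw [chainF hF L d b h1.2 (fun x hx => hadj x (List.mem_cons_of_mem _ hx)) (by simpa using h),
      ← h1.1, hF a (hadj a (by simp))]
    simp [add_assoc]

def eZ (x y a b : W) : ZMod 2 := (if a = x ∧ b = y then 1 else 0) + (if a = y ∧ b = x then 1 else 0)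

lemma eZ_row (x y a : W) : ∑ b, eZ x y a b = (if a = x then 1 else 0) + (if a = y then 1 else 0) := by
  unfold eZ
  rw [Finset.sum_add_distrib]
  congr 1
  · by_cases h : a = x <;> simp [h]
  · by_cases h : a = y <;> simp [h]

lemma eZ_ne {x y a b : W} (h : eZ x y a b ≠ 0) : (a = x ∧ b = y) ∨ (a = y ∧ b = x) := by
  by_contra hc
  push Not at hc
  apply h; unfold eZ
  rw [if_neg (fun h => hc.1 h.1 h.2), if_neg (fun h => hc.2 h.1 h.2), add_zero]

lemma Rot.NC (R : Rot E nx th ht) {D : Finset W} {c : ℕ → W} {m : ℕ}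
    (hinj : ∀ i ≤ m, ∀ j ≤ m, c i = c j → i = j) (hcD : ∀ i ≤ m, c i ∈ D)
    (fan : ∀ s, s + 2 ≤ m → Fan E nx D (c (s+1)) (c s) (c (s+2))) {i k j l : ℕ}
    (hik : i < k) (hkj : k < j) (hjl : j < l) (hl : l ≤ m)
    (hij : E.Adj (c i) (c j)) (hkl : E.Adj (c k) (c l)) : False := by
  have hadj : ∀ s, s + 1 ≤ m → E.Adj (c s) (c (s+1)) := by
    intro s hs
    rcases Nat.lt_or_ge (s + 1) m with h | h
    · obtain ⟨L, -, -, h3, -, h5⟩ := fan s h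
      exact ((h5 (c s)).1 (List.mem_of_mem_head? (by simp [h3]))).1.symm
    · obtain ⟨s, rfl⟩ : ∃ s', s = s' + 1 := ⟨s - 1, by omega⟩
      obtain ⟨L, -, -, -, h4, h5⟩ := fan s hs
      exact ((h5 _).1 (List.mem_of_getLast? h4)).1
  let Z : W → W → ZMod 2 := fun a b => ∑ s ∈ Finset.Ico i j, eZ (c s) (c (s+1)) a b + eZ (c i) (c j) a b
  have Zne : ∀ a b, Z a b ≠ 0 → (∃ s, i ≤ s ∧ s < j ∧ ((a = c s ∧ b = c (s+1)) ∨ (a = c (s+1) ∧ b = c s))) ∨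
      ((a = c i ∧ b = c j) ∨ (a = c j ∧ b = c i)) := by
    intro a b h
    by_cases h1 : eZ (c i) (c j) a b = 0
    · left
      simp only [Z, h1, add_zero] at h
      obtain ⟨s, hs, hs'⟩ := Finset.exists_ne_zero_of_sum_ne_zero h
      rw [Finset.mem_Ico] at hs
      exact ⟨s, hs.1, hs.2, eZ_ne hs'⟩
    · exact Or.inr (eZ_ne h1)
  have Zs : ∀ a b, Z a b = Z b a := by
    intro a b
    have : ∀ x y, eZ x y a b = eZ x y b a := by
      intro x y; unfold eZ; rw [add_comm]; simp only [and_comm]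
    simp only [Z, this]
  have Z0 : ∀ a b, ¬ E.Adj a b → Z a b = 0 := by
    intro a b h
    by_contra hne
    apply h
    rcases Zne a b hne with ⟨s, h1, h2, ⟨rfl, rfl⟩ | ⟨rfl, rfl⟩⟩ | ⟨rfl, rfl⟩ | ⟨rfl, rfl⟩
    · exact hadj s (by omega)
    · exact (hadj s (by omega)).symm
    · exact hij
    · exact hij.symm
  have ZD : ∀ a b, Z a b ≠ 0 → b ∈ D := by
    intro a b hne
    rcases Zne a b hne with ⟨s, h1, h2, ⟨rfl, rfl⟩ | ⟨rfl, rfl⟩⟩ | ⟨rfl, rfl⟩ | ⟨rfl, rfl⟩ <;>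
    exact hcD _ (by omega)
  have two : ∀ x : ZMod 2, x + x = 0 := fun x => CharTwo.add_self_eq_zero x
  have Zr : ∀ a, ∑ b, Z a b = 0 := by
    intro a
    simp only [Z]
    rw [Finset.sum_add_distrib, Finset.sum_comm, eZ_row, Finset.sum_congr rfl (fun s _ => eZ_row _ _ a)]
    have tel : ∀ d, ∑ s ∈ Finset.Ico i (i + d), ((if a = c s then (1 : ZMod 2) else 0) + if a = c (s + 1) then 1 else 0)
        = (if a = c i then 1 else 0) + if a = c (i + d) then 1 else 0 := by
      intro d
      induction d with
      | zero => simp [two]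
      | succ d ih =>
        rw [← add_assoc, Finset.sum_Ico_succ_top (by omega), ih]
        generalize (if a = c (i + d) then (1 : ZMod 2) else 0) = z
        have := two z
        linear_combination this
    have := tel (j - i)
    rw [show i + (j - i) = j by omega] at this
    rw [this, two]
  obtain ⟨F, hF1, hF2⟩ := R.H1 _ Z Zs Z0 Zr le_rfl
  have hF : ∀ d u, E.Adj d u → F d (nx d u) = F d u + Z d (nx d u) := by
    intro d u hd
    have e1 := hF1 d u hd
    have e2 := hF1 u (nx d u) (R.adj' hd)
    rw [R.tri hd] at e2
    have e3 := hF2 d (nx d u) (R.adj hd)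
    have := two (F (nx d u) d)
    rw [e1, e2]
    linear_combination e3 - this
  have hO : ∀ s, s + 1 ≤ m → F (c s) (c (s+1)) = F (c 0) (c 1) := by
    intro s
    induction s with
    | zero => intro _; rfl
    | succ s ih =>
      intro hs
      rw [← ih (by omega)]
      obtain ⟨L, h1, h2, h3, h4, h5⟩ := fan s hs
      match L, h1, h2, h3, h4, h5 with
      | [], _, _, h3, _, _ => simp at h3
      | a :: L, h1, h2, h3, h4, h5 =>
        simp only [List.head?_cons, Option.some.injEq] at h3; subst h3
        have e := chainF (hF (c (s+1))) L _ _ h2 (fun x hx => ((h5 x).1 hx).1) h4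
        have e2 : ∑ b, Z (c (s+1)) b = ((c s :: L).map (Z (c (s+1)))).sum := by
          rw [← List.sum_toFinset _ h1]
          symm
          apply Finset.sum_subset (Finset.subset_univ _)
          intro x _ hx
          by_contra hne
          apply hx
          rw [List.mem_toFinset, h5]
          exact ⟨by by_contra h; exact hne (Z0 _ _ h), ZD _ _ hne⟩
        rw [Zr, List.map_cons, List.sum_cons] at e2
        have e3 := hF2 _ _ (hadj s (by omega))
        rw [Zs] at e3
        have := two (F (c s) (c (s+1)))
        rw [e]
        linear_combination -e2 + e3 - this
  -- value at `c l`
  have A1 : F (c l) (c k) = F (c 0) (c 1) := by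
    obtain ⟨l, rfl⟩ : ∃ l', l = l' + 1 := ⟨l - 1, by omega⟩
    have hz : ∀ x, Z (c (l+1)) x = 0 := by
      intro x; by_contra hne
      rcases Zne _ x hne with ⟨s, h1, h2, ⟨h, -⟩ | ⟨h, -⟩⟩ | ⟨h, -⟩ | ⟨h, -⟩ <;>
      · have := hinj _ (by omega) _ (by omega) h
        omega
    have := R.cyc (v := c (l+1)) (S := {u | E.Adj (c (l+1)) u ∧ F (c (l+1)) u = F (c (l+1)) (c l)})
      (fun u hu => hu.1) (fun u hu => ⟨R.adj hu.1, by rw [hF _ _ hu.1, hz, add_zero, hu.2]⟩)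
      ⟨c l, (hadj l hl).symm, rfl⟩ (c k) hkl.symm
    rw [this.2]
    have e := hF2 _ _ (hadj l hl).symm
    rw [hz, hO l hl] at e
    have := two (F (c 0) (c 1))
    linear_combination e - this
  have A2 : F (c k) (c l) = F (c 0) (c 1) + 1 := by
    obtain ⟨k, rfl⟩ : ∃ k', k = k' + 1 := ⟨k - 1, by omega⟩
    have hz : ∀ x, x ≠ c k → x ≠ c (k+2) → Z (c (k+1)) x = 0 := by
      intro x hx1 hx2; by_contra hne
      rcases Zne _ x hne with ⟨s, h1, h2, ⟨h, h'⟩ | ⟨h, h'⟩⟩ | ⟨h, -⟩ | ⟨h, -⟩ <;>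
        have := hinj _ (by omega) _ (by omega) h
      · subst this; exact hx2 h'
      · have : s = k := by omega
        subst this; exact hx1 h'
      · omega
      · omega
    have h1z : Z (c (k+1)) (c k) = 1 := by
      simp only [Z]
      rw [Finset.sum_eq_single k]
      · have a1 : c (k+1) ≠ c k := fun h => by have := hinj _ (by omega) _ (by omega) h; omega
        have a2 : c (k+1) ≠ c i := fun h => by have := hinj _ (by omega) _ (by omega) h; omega
        have a3 : c (k+1) ≠ c j := fun h => by have := hinj _ (by omega) _ (by omega) h; omega
        simp [eZ, a1, a2, a3]
      · intro s hs hsk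
        rw [Finset.mem_Ico] at hs
        by_contra hne
        rcases eZ_ne hne with ⟨h, h'⟩ | ⟨h, h'⟩
        · have := hinj _ (by omega) _ (by omega) h
          have := hinj _ (by omega) _ (by omega) h'
          omega
        · have := hinj _ (by omega) _ (by omega) h'
          omega
      · intro h; rw [Finset.mem_Ico] at h; omega
    obtain ⟨L, h1, h2, h3, h4, h5⟩ := fan k (by omega)
    have hlL := (h5 (c l)).2 ⟨hkl, hcD l hl⟩
    obtain ⟨L1, L2, rfl⟩ := List.append_of_mem hlL
    have e0 := hF2 _ _ (hadj k (by omega)).symm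
    rw [hO k (by omega), h1z] at e0
    have hlk : c l ≠ c k := fun h => by have := hinj _ (by omega) _ (by omega) h; omega
    have hlk2 : c l ≠ c (k+2) := fun h => by have := hinj _ (by omega) _ (by omega) h; omega
    match L1, h1, h2, h3, h4, h5 with
    | [], h1, h2, h3, h4, h5 => simp at h3; exact absurd h3 hlk
    | a :: L1, h1, h2, h3, h4, h5 =>
      simp only [List.cons_append, List.head?_cons, Option.some.injEq] at h3; subst h3
      rw [List.isChain_split] at h2
      have e := chainF (hF (c (k+1))) (L1 ++ [c l]) (c k) (c l) h2.1
        (fun x hx => ((h5 x).1 (by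
          simp only [List.cons_append, List.mem_cons, List.mem_append, List.not_mem_nil, or_false] at hx ⊢; tauto)).1)
        (by rw [← List.cons_append, List.getLast?_append]; simp)
      have hs : ((L1 ++ [c l]).map (Z (c (k+1)))).sum = 0 := by
        apply List.sum_eq_zero
        intro z hz'
        obtain ⟨x, hx, rfl⟩ := List.mem_map.1 hz'
        rw [List.nodup_append] at h1
        rcases List.mem_append.1 hx with hx | hx
        · apply hz
          · rintro rfl; exact (List.nodup_cons.1 h1.1).1 hx
          · have : c (k+2) ∈ c l :: L2 := by
              rw [List.getLast?_append] at h4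
              cases h' : (c l :: L2).getLast? with
              | none => simp at h'
              | some a =>
                rw [h'] at h4; simp at h4
                have h2 := List.mem_of_getLast? h'
                rwa [h4] at h2
            exact h1.2.2 x (List.mem_cons_of_mem _ hx) _ this
        · simp at hx; subst hx; exact hz _ hlk hlk2
      rw [hs, add_zero] at e
      have := two (F (c 0) (c 1))
      rw [e]; linear_combination e0 - this
  have e := hF2 _ _ hkl
  have hZkl : Z (c k) (c l) = 0 := by
    by_contra hne
    rcases Zne _ _ hne with ⟨s, h1, h2, ⟨h, h'⟩ | ⟨h, h'⟩⟩ | ⟨h, -⟩ | ⟨h, -⟩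
    · have := hinj _ (by omega) _ (by omega) h'
      omega
    · have := hinj _ (by omega) _ (by omega) h'
      omega
    · have := hinj _ (by omega) _ (by omega) h
      omega
    · have := hinj _ (by omega) _ (by omega) h
      omega
  rw [A1, A2, hZkl] at e
  have := two (F (c 0) (c 1))
  have h10 : (1 : ZMod 2) = 0 := by linear_combination e - this
  exact one_ne_zero h10

end

end FP


namespace FP

noncomputable section

open Classical

variable {W : Type*} [Fintype W] {E : SimpleGraph W} {nx : W → W → W} {th : W → W → ℝ} {ht : W → ℝ}

structure StC (E : SimpleGraph W) (nx : W → W → W) (f0 f1 t : W) (D : Finset W) (C : List W) : Prop where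
  nd : C.Nodup
  hd : C.head? = some f0
  lt : C.getLast? = some f1
  sub : ∀ x ∈ C, x ∈ D
  tri : Tri E nx D (f1 :: (C ++ [f0]))
  int : ∀ z ∈ D, z ∉ C → ∀ u, E.Adj z u → u ∈ D
  top : t ∉ D ∨ C = [f0, t, f1]

lemma StC.chordless (R : Rot E nx th ht) {f0 f1 t : W} {D : Finset W} {C : List W}
    (S : StC E nx f0 f1 t D C) (h01 : E.Adj f0 f1) (hC : 3 ≤ C.length) :
    ∃ C1 p c q C2, C = C1 ++ p :: c :: q :: C2 ∧ ∀ z ∈ C, E.Adj c z → z = p ∨ z = q := by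
  obtain ⟨m, hm⟩ : ∃ m, C.length = m + 1 := ⟨C.length - 1, by omega⟩
  let c : ℕ → W := fun i => C.getD i f0
  have hc : ∀ i (h : i < C.length), c i = C[i] := fun i h => by simp [c, h]
  have hinj : ∀ i ≤ m, ∀ j ≤ m, c i = c j → i = j := by
    intro i hi j hj h
    rw [hc i (by omega), hc j (by omega)] at h
    exact (S.nd.getElem_inj_iff).1 h
  have hcD : ∀ i ≤ m, c i ∈ D := by
    intro i hi; rw [hc i (by omega)]; exact S.sub _ (List.getElem_mem _)
  have fan : ∀ s, s + 2 ≤ m → Fan E nx D (c (s+1)) (c s) (c (s+2)) := by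
    intro s hs
    have := Tri_get _ S.tri (s+1) (by simp; omega)
    simp only [List.getElem_cons_succ] at this
    rw [List.getElem_append_left (by omega), List.getElem_append_left (by omega),
      List.getElem_append_left (by omega)] at this
    rw [hc _ (by omega), hc _ (by omega), hc _ (by omega)]
    exact this
  have c0 : c 0 = f0 := by
    have := S.hd; rw [List.head?_eq_getElem?] at this; simp [c, this]
  have cm : c m = f1 := by
    have := S.lt; rw [List.getLast?_eq_getElem?, hm] at this; simp at this; simp [c, this]
  let P : ℕ → Prop := fun d => ∃ a, a + (d + 2) ≤ m ∧ E.Adj (c a) (c (a + (d+2)))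
  have hex : ∃ d, P d := ⟨m - 2, 0, by omega, by
    rw [show 0 + (m - 2 + 2) = m by omega, c0, cm]; exact h01⟩
  obtain ⟨a, ha, hab⟩ := Nat.find_spec hex
  have hmin := fun d hd => Nat.find_min hex (m := d) hd
  generalize Nat.find hex = d at ha hab hmin
  have key : ∀ z ≤ m, E.Adj (c (a+1)) (c z) → z = a ∨ z = a + 2 := by
    intro z hz hadj
    have hzne : z ≠ a + 1 := by rintro rfl; exact hadj.ne rfl
    by_contra hcon
    push Not at hcon
    rcases Nat.lt_or_ge z a with h | h
    · exact R.NC hinj hcD fan h (show a < a + 1 by omega) (show a + 1 < a + (d+2) by omega) ha hadj.symm hab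
    rcases Nat.lt_or_ge (a + (d+2)) z with h' | h'
    · exact R.NC hinj hcD fan (show a < a + 1 by omega) (show a + 1 < a + (d+2) by omega) h' hz hab hadj
    refine hmin (z - (a + 3)) (by omega) ⟨a + 1, by omega, ?_⟩
    rw [show a + 1 + (z - (a+3) + 2) = z by omega]; exact hadj
  refine ⟨C.take a, c a, c (a+1), c (a+2), C.drop (a+3), ?_, ?_⟩
  · rw [hc _ (by omega), hc _ (by omega), hc _ (by omega), ← List.drop_eq_getElem_cons, ← List.drop_eq_getElem_cons,
      ← List.drop_eq_getElem_cons, List.take_append_drop]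
  · intro z hz hadj
    obtain ⟨i, hi, rfl⟩ := List.getElem_of_mem hz
    rw [← hc i hi] at hadj ⊢
    rcases key i (by omega) hadj with rfl | rfl
    · exact Or.inl rfl
    · exact Or.inr rfl

lemma StC.step (R : Rot E nx th ht) {f0 f1 t : W} {D : Finset W} {C1 C2 : List W} {p c q : W}
    (S : StC E nx f0 f1 t D (C1 ++ p :: c :: q :: C2))
    (hch : ∀ z ∈ C1 ++ p :: c :: q :: C2, E.Adj c z → z = p ∨ z = q) :
    ∃ U : List W, StC E nx f0 f1 t (D.erase c) (C1 ++ p :: (U ++ q :: C2)) ∧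
      ∀ z ∈ D, E.Adj c z → z ∈ p :: (U ++ [q]) := by
  have hnd := S.nd
  rw [List.nodup_append] at hnd
  obtain ⟨nd1, nd2, nd3⟩ := hnd
  simp only [List.nodup_cons, List.mem_cons, not_or] at nd2
  obtain ⟨⟨hpc, hpq, hp2⟩, ⟨hcq, hc2⟩, hq2, nd2⟩ := nd2
  have hp1 : p ∉ C1 := fun h => nd3 p h p (by simp) rfl
  have hc1 : c ∉ C1 := fun h => nd3 c h c (by simp) rfl
  have hq1 : q ∉ C1 := fun h => nd3 q h q (by simp) rfl
  have h12 : ∀ x ∈ C1, x ∉ C2 := fun x h h' => nd3 x h x (by simp [h']) rfl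
  obtain ⟨A, pp, hA⟩ := (List.eq_nil_or_concat (f1 :: C1)).resolve_left (by simp)
  rw [List.concat_eq_append] at hA
  obtain ⟨qq, B, hB⟩ : ∃ qq B, C2 ++ [f0] = qq :: B := List.exists_cons_of_ne_nil (by simp)
  have e1 : f1 :: (C1 ++ p :: c :: q :: C2 ++ [f0]) = A ++ pp :: p :: (c :: q :: (qq :: B)) := by
    rw [← hB]; simp only [List.append_assoc, List.cons_append]
    rw [← List.cons_append, hA]; simp
  have hT := S.tri
  rw [e1, Tri_split] at hT
  obtain ⟨T1, F1, F2, F3, T2⟩ := hT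
  have hf1c : f1 ≠ c := by
    have := S.lt
    rintro rfl
    rw [List.getLast?_append] at this
    simp only [List.getLast?_cons_cons] at this
    cases h' : (q :: C2).getLast? with
    | none => simp at h'
    | some a =>
      rw [h'] at this; simp at this
      have h2 := List.mem_of_getLast? h'
      rw [this, List.mem_cons] at h2
      exact h2.elim hcq hc2
  have hf0c : f0 ≠ c := by
    rintro rfl
    have := S.hd
    cases C1 with
    | nil => simp at this; exact hpc this
    | cons a C1 => simp at this; exact hc1 (by simp [this])
  have hppc : pp ≠ c := by
    have : pp ∈ f1 :: C1 := by rw [hA]; simp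
    rintro rfl
    rcases List.mem_cons.1 this with h | h
    · exact hf1c h.symm
    · exact hc1 h
  have hqqc : qq ≠ c := by
    have : qq ∈ C2 ++ [f0] := by rw [hB]; simp
    rintro rfl
    rcases List.mem_append.1 this with h | h
    · exact hc2 h
    · simp at h; exact hf0c h.symm
  obtain ⟨L, l1, l2, l3, l4, l5⟩ := F2
  obtain ⟨U, rfl⟩ : ∃ U, L = p :: (U ++ [q]) := by
    match L, l3, l4 with
    | [], l3, l4 => simp at l3
    | a :: L, l3, l4 =>
      simp at l3; subst l3
      rcases List.eq_nil_or_concat L with rfl | ⟨U, y, rfl⟩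
      · simp at l4; exact absurd l4 hpq
      · rw [List.concat_eq_append] at l4 ⊢
        rw [← List.cons_append, List.getLast?_append] at l4
        simp at l4; subst l4
        exact ⟨U, rfl⟩
  have ladj : ∀ u ∈ p :: (U ++ [q]), E.Adj c u := fun u hu => ((l5 u).1 hu).1
  have hUC : ∀ u ∈ U, u ∉ C1 ++ p :: c :: q :: C2 := by
    intro u hu hC
    have hnd := l1
    rw [List.nodup_cons, List.nodup_append] at hnd
    rcases hch u hC (ladj u (by simp [hu])) with rfl | rfl
    · exact hnd.1 (by simp [hu])
    · exact hnd.2.2.2 u hu u (by simp) rfl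
  have hUD : ∀ u ∈ U, u ∈ D := fun u hu => ((l5 u).1 (by simp [hu])).2
  have hUnd : U.Nodup := by
    rw [List.nodup_cons, List.nodup_append] at l1; exact l1.2.1
  refine ⟨U, ⟨?_, ?_, ?_, ?_, ?_, ?_, ?_⟩, fun z hz hc => (l5 z).2 ⟨hc, hz⟩⟩
  · simp only [List.mem_append, List.mem_cons, not_or] at hUC
    rw [List.nodup_append, List.nodup_cons, List.nodup_append, List.nodup_cons]
    refine ⟨nd1, ⟨?_, hUnd, ⟨hq2, nd2⟩, ?_⟩, ?_⟩
    · simp only [List.mem_append, List.mem_cons, not_or]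
      exact ⟨fun h => (hUC p h).2.1 rfl, hpq, hp2⟩
    · rintro a ha b hb rfl
      rcases List.mem_cons.1 hb with h | h
      · exact (hUC a ha).2.2.2.1 h
      · exact (hUC a ha).2.2.2.2 h
    · rintro a ha b hb rfl
      simp only [List.mem_append, List.mem_cons] at hb
      rcases hb with h | h | h | h
      · exact hp1 (h ▸ ha)
      · exact (hUC a h).1 ha
      · exact hq1 (h ▸ ha)
      · exact h12 a ha h
  · have := S.hd
    cases C1 with
    | nil => simpa using this
    | cons a C1 => simpa using this
  · have := S.lt
    rw [List.getLast?_append] at this ⊢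
    rw [← List.cons_append, List.getLast?_append]
    simp only [List.getLast?_cons_cons] at this
    cases h' : (q :: C2).getLast? with
    | none => simp at h'
    | some a => rw [h'] at this; simpa using this
  · intro x hx
    rw [Finset.mem_erase]
    have hS := S.sub
    simp only [List.mem_append, List.mem_cons] at hx hS
    rcases hx with h | h | h | h | h
    · exact ⟨fun e => hc1 (e ▸ h), hS x (Or.inl h)⟩
    · exact ⟨fun e => hpc (h.symm.trans e), hS x (by simp [h])⟩
    · exact ⟨fun e => (ladj x (by simp [h])).ne e.symm, hUD x h⟩
    · exact ⟨fun e => hcq (e.symm.trans h), hS x (by simp [h])⟩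
    · exact ⟨fun e => hc2 (e ▸ h), hS x (by simp [h])⟩
  · have e2 : f1 :: (C1 ++ p :: (U ++ q :: C2) ++ [f0]) = A ++ pp :: p :: (U ++ q :: qq :: B) := by
      rw [← hB]; simp only [List.append_assoc, List.cons_append]
      rw [← List.cons_append, hA]; simp
    have hn1 : ∀ m ∈ C1, ¬ E.Adj m c := by
      intro m hm h
      rcases hch m (by simp [hm]) h.symm with rfl | rfl
      · exact hp1 hm
      · exact hq1 hm
    have hn2 : ∀ m ∈ C2, ¬ E.Adj m c := by
      intro m hm h
      rcases hch m (by simp [hm]) h.symm with rfl | rfl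
      · exact hp2 hm
      · exact hq2 hm
    rw [e2]
    have sp : Tri E nx (D.erase c) (A ++ pp :: p :: (U ++ q :: qq :: B)) ↔ _ := Tri_split A
    rw [sp]
    refine ⟨Tri_erase _ T1 ?_, R.fill U pp p l2 ladj ?_ ?_ ?_ (Tri_erase _ T2 ?_)⟩
    · have : A ++ [pp, p] = f1 :: (C1 ++ [p]) := by
        rw [← List.cons_append, hA]; simp
      rw [this]; simpa using hn1
    · intro u hu z hz
      exact S.int u (hUD u hu) (hUC u hu) z hz
    · intro y hy
      have hy' : y ∈ U ++ [q] := List.mem_of_mem_head? (by simp [hy])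
      have hpy : nx c p = y := by
        rw [List.isChain_cons] at l2; exact l2.1 y (by rw [hy]; simp)
      have hcp := ladj p (by simp)
      refine F1.dropLast R hppc (u := y) ?_ ?_
      · rw [← hpy]; exact R.tri hcp
      · rw [← hpy]; exact R.adj' hcp
    · intro y hy
      have hy' : y ∈ p :: U := List.mem_of_getLast? hy
      have hyq : nx c y = q := by
        rw [← List.cons_append, List.isChain_append] at l2
        exact l2.2.2 y (by rw [hy]; simp) q (by simp)
      refine F3.tail hqqc.symm ?_
      rw [← hyq]; exact R.inv' (ladj y (by rw [← List.cons_append]; simp only [List.mem_append]; exact Or.inl hy'))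
    · rw [← hB]; simpa using hn2
  · intro z hz hzC u hu
    rw [Finset.mem_erase] at hz ⊢
    have hzC' : z ∉ C1 ++ p :: c :: q :: C2 := by
      simp only [List.mem_append, List.mem_cons, not_or] at hzC ⊢
      exact ⟨hzC.1, hzC.2.1, hz.1, hzC.2.2.2.1, hzC.2.2.2.2⟩
    refine ⟨?_, S.int z hz.2 hzC' u hu⟩
    rintro rfl
    apply hzC
    have := (l5 z).2 ⟨hu.symm, hz.2⟩
    simp only [List.mem_append, List.mem_cons, List.not_mem_nil, or_false] at this ⊢
    tauto
  · left
    rw [Finset.mem_erase]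
    rcases S.top with h | h
    · exact fun h' => h h'.2
    · rintro ⟨h1, -⟩
      apply h1
      have hcm : c ∈ [f0, t, f1] := h ▸ (by simp)
      simp only [List.mem_cons, List.not_mem_nil, or_false] at hcm
      rcases hcm with h | h | h
      · exact absurd h.symm hf0c
      · exact h.symm
      · exact absurd h.symm hf1c

theorem StC.can (R : Rot E nx th ht) {f0 f1 t : W} (h01 : E.Adj f0 f1)
    (up : ∀ v, v ≠ t → ∃ u, E.Adj v u ∧ ht v < ht u) : ∀ (N : ℕ) (D : Finset W) (C : List W),
    D.card ≤ N → StC E nx f0 f1 t D C → ∃ (n : ℕ) (st : ℕ → Step W) (H : ℕ → List W), H 0 = [f0, f1] ∧ (∀ k < n, H k = (st k).pre) ∧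
      (∀ k < n, H (k+1) = (st k).post) ∧ (∀ k < n, ¬ dn f0 f1 st k (st k).w) ∧
      (∀ k < n, ∀ x, dn f0 f1 st k x → E.Adj (st k).w x → x ∈ (st k).B) ∧ H n = C ∧
      (∀ x, dn f0 f1 st n x ↔ x ∈ D) := by
  intro N
  induction N with
  | zero =>
    intro D C hD S
    have : f0 ∈ C := List.mem_of_mem_head? (by simp [S.hd])
    have := S.sub _ this
    rw [Finset.card_eq_zero.1 (Nat.le_zero.1 hD)] at this
    simp at this
  | succ N ih =>
    intro D C hD S
    by_cases hC : 3 ≤ C.length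
    · obtain ⟨C1, p, c, q, C2, rfl, hch⟩ := S.chordless R h01 hC
      obtain ⟨U, S', hU⟩ := S.step R hch
      have hcD : c ∈ D := S.sub c (by simp)
      have hcard := Finset.card_erase_lt_of_mem hcD
      obtain ⟨n, st, H, a0, a1, a2, a3, a4, a5, a6⟩ := ih _ _ (by omega) S'
      let st' : ℕ → Step W := fun k => if k < n then st k else ⟨C1, p, U, q, C2, c⟩
      let H' : ℕ → List W := fun k => if k ≤ n then H k else C1 ++ p :: c :: q :: C2
      have hst : ∀ k, k < n → st' k = st k := fun k hk => by simp [st', hk]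
      have hstn : st' n = ⟨C1, p, U, q, C2, c⟩ := by simp [st']
      have hH : ∀ k, k ≤ n → H' k = H k := fun k hk => by simp [H', hk]
      have hdn : ∀ k, k ≤ n → ∀ x, dn f0 f1 st' k x ↔ dn f0 f1 st k x := by
        intro k hk x
        unfold dn
        have : ∀ j, (j < k ∧ x = (st' j).w) ↔ (j < k ∧ x = (st j).w) := by
          intro j
          constructor
          · rintro ⟨h1, h2⟩; rw [hst j (by omega)] at h2; exact ⟨h1, h2⟩
          · rintro ⟨h1, h2⟩; rw [hst j (by omega)]; exact ⟨h1, h2⟩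
        simp only [this]
      refine ⟨n + 1, st', H', ?_, ?_, ?_, ?_, ?_, ?_, ?_⟩
      · rw [hH 0 (by omega), a0]
      · intro k hk
        rcases Nat.lt_succ_iff_lt_or_eq.1 hk with h | rfl
        · rw [hH k (by omega), hst k h, a1 k h]
        · rw [hH k le_rfl, hstn, a5]; rfl
      · intro k hk
        rcases Nat.lt_succ_iff_lt_or_eq.1 hk with h | rfl
        · rw [hH _ (by omega), hst k h, a2 k h]
        · rw [hstn]; simp [H', Step.post]
      · intro k hk
        rw [hdn k (by omega)]
        rcases Nat.lt_succ_iff_lt_or_eq.1 hk with h | rfl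
        · rw [hst k h]; exact a3 k h
        · rw [hstn, a6]; simp
      · intro k hk x
        rw [hdn k (by omega)]
        rcases Nat.lt_succ_iff_lt_or_eq.1 hk with h | rfl
        · rw [hst k h]; exact a4 k h x
        · rw [hstn, a6]
          intro hx hadj
          exact hU x (Finset.mem_of_mem_erase hx) hadj
      · simp [H']
      · intro x
        rw [dn_succ, hdn n le_rfl, a6, hstn, Finset.mem_erase]
        by_cases h : x = c
        · simp [h, hcD]
        · simp [h]
    · have hC2 : C = [f0, f1] := by
        have h1 := S.hd
        have h2 := S.lt
        match C, hC, h1, h2 with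
        | [], _, h1, _ => simp at h1
        | [a], _, h1, h2 => simp at h1 h2; exact absurd (h1.symm.trans h2) h01.ne
        | [a, b], _, h1, h2 => simp at h1 h2; rw [h1, h2]
        | a :: b :: d :: C, hC, _, _ => simp at hC
      subst hC2
      have htD : t ∉ D := S.top.resolve_right (by simp)
      have single : ∀ a b, Fan E nx D a b b → ∀ z ∈ D, E.Adj a z → z = b := by
        rintro a b ⟨L, l1, -, l3, l4, l5⟩ z hz haz
        have hzL := (l5 z).2 ⟨haz, hz⟩
        match L, l1, l3, l4, hzL with
        | [], _, l3, _, _ => simp at l3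
        | [x], _, l3, _, hzL => simp at l3 hzL; rw [hzL, l3]
        | x :: y :: L, l1, l3, l4, _ =>
          simp only [List.head?_cons, Option.some.injEq] at l3
          rw [List.getLast?_cons_cons] at l4
          have := List.mem_of_getLast? l4
          rw [← l3] at this
          exact absurd this (List.nodup_cons.1 l1).1
      obtain ⟨G1, G2, -⟩ := S.tri
      have hDs : ∀ x ∈ D, x = f0 ∨ x = f1 := by
        by_contra hcon
        push Not at hcon
        obtain ⟨z, hz, hzmax⟩ := Set.exists_max_image {x | x ∈ D ∧ x ≠ f0 ∧ x ≠ f1} ht (Set.toFinite _) hcon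
        obtain ⟨u, hu, hlt⟩ := up z (fun e => htD (e ▸ hz.1))
        have huD := S.int z hz.1 (by simp [hz.2.1, hz.2.2]) u hu
        by_cases h0 : u = f0
        · subst h0; exact hz.2.2 (single _ _ G1 z hz.1 hu.symm)
        by_cases h1 : u = f1
        · subst h1; exact hz.2.1 (single _ _ G2 z hz.1 hu.symm)
        linarith [hzmax u ⟨huD, h0, h1⟩]
      refine ⟨0, fun _ => ⟨[], f0, [], f0, [], f0⟩, fun _ => [f0, f1], rfl, by simp, by simp, by simp, by simp, rfl, ?_⟩
      intro x
      simp only [dn, Nat.not_lt_zero, false_and, exists_false, or_false]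
      constructor
      · rintro (rfl | rfl)
        · exact S.sub _ (by simp)
        · exact S.sub _ (by simp)
      · exact hDs x

theorem Rot.isCan (R : Rot E nx th ht) {f0 f1 t : W} (h01 : E.Adj f0 f1) (h0t : E.Adj f0 t) (h1t : E.Adj f1 t)
    (n0 : nx f0 t = f1) (nt : nx t f1 = f0) (n1 : nx f1 f0 = t)
    (up : ∀ v, v ≠ t → ∃ u, E.Adj v u ∧ ht v < ht u) : ∃ n st H, IsCan E f0 f1 n st H := by
  have fan : ∀ a b d, E.Adj a b → E.Adj a d → nx a d = b → Fan E nx Finset.univ a b d := by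
    intro a b d hab had h
    obtain ⟨L, l1, l2, l3, l4, l5⟩ := R.star hab
    refine ⟨L, l1, l2, l3, ?_, fun z => by simp [l4]⟩
    cases hl : L.getLast? with
    | none => rw [List.getLast?_eq_none_iff] at hl; subst hl; simp at l3
    | some w =>
      have hw := (l4 w).1 (List.mem_of_getLast? hl)
      rw [R.cancel hw had ((l5 w hl).trans h.symm)]
  have S : StC E nx f0 f1 t Finset.univ [f0, t, f1] := by
    refine ⟨by simp [h01.ne, h0t.ne, h1t.ne'], rfl, rfl, by simp, ?_, by simp, Or.inr rfl⟩
    exact ⟨fan _ _ _ h01 h0t n0, fan _ _ _ h0t.symm h1t.symm nt, fan _ _ _ h1t h01.symm n1, trivial⟩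
  obtain ⟨n, st, H, a0, a1, a2, a3, a4, a5, a6⟩ := S.can R h01 up _ _ _ le_rfl
  exact ⟨n, st, H, h01.ne, a0, a1, a2, a3, a4, fun x => (a6 x).2 (by simp)⟩

end

end FP


namespace FP

noncomputable section

open Classical

def cr (d e : ℝ × ℝ) : ℝ := d.1 * e.2 - d.2 * e.1

def pa (d : ℝ × ℝ) : ℝ := if 0 < d.2 then Real.exp (-(d.1 / d.2)) else -Real.exp (d.1 / d.2)

lemma pa_neg {d : ℝ × ℝ} (h : d.2 ≠ 0) : d.2 < 0 ↔ pa d < 0 := by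
  unfold pa
  rcases lt_or_gt_of_ne h with h | h
  · rw [if_neg (by linarith)]; simp [h, Real.exp_pos]
  · rw [if_pos h]
    exact ⟨fun h' => by linarith, fun h' => absurd h' (not_lt.2 (Real.exp_pos _).le)⟩

lemma pa_lt {d e : ℝ × ℝ} (hd : d.2 ≠ 0) (he : e.2 ≠ 0) :
    pa d < pa e ↔ (d.2 < 0 ∧ 0 < e.2) ∨ (0 < d.2 * e.2 ∧ 0 < cr d e) := by
  unfold pa cr
  rcases lt_or_gt_of_ne hd with h | h <;> rcases lt_or_gt_of_ne he with h' | h'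
  · rw [if_neg (by linarith), if_neg (by linarith), neg_lt_neg_iff, Real.exp_lt_exp,
      ← neg_div_neg_eq e.1, ← neg_div_neg_eq d.1, div_lt_div_iff₀ (neg_pos.2 h') (neg_pos.2 h)]
    simp only [mul_pos_of_neg_of_neg h h', not_lt.2 h'.le, and_false, false_or, true_and]
    constructor <;> intro <;> nlinarith
  · rw [if_neg (by linarith), if_pos h']
    have := Real.exp_pos (d.1 / d.2)
    have := Real.exp_pos (-(e.1 / e.2))
    simp only [h, h', and_self, true_or, iff_true]; linarith
  · rw [if_pos h, if_neg (by linarith)]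
    have := Real.exp_pos (e.1 / e.2)
    have := Real.exp_pos (-(d.1 / d.2))
    have : d.2 * e.2 < 0 := mul_neg_of_pos_of_neg h h'
    constructor
    · intro; linarith
    · rintro (h | h) <;> linarith
  · rw [if_pos h, if_pos h', Real.exp_lt_exp, neg_lt_neg_iff, div_lt_div_iff₀ h' h]
    simp only [mul_pos h h', not_lt.2 h.le, false_and, false_or, true_and]
    constructor <;> intro <;> nlinarith

def cyc3 (a b c : ℝ) : Prop := (a < b ∧ b < c) ∨ (c < a ∧ a < b) ∨ (b < c ∧ c < a)

lemma cyc3_asymm {a b c : ℝ} (h : cyc3 a b c) (h' : cyc3 a c b) : False := by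
  unfold cyc3 at h h'
  rcases h with h | h | h <;> rcases h' with h' | h' | h' <;> linarith [h.1, h.2, h'.1, h'.2]

lemma cyc3_rot {a b c : ℝ} (h : cyc3 a b c) : cyc3 b c a := by
  unfold cyc3 at *
  rcases h with h | h | h
  · exact Or.inr (Or.inl h)
  · exact Or.inr (Or.inr h)
  · exact Or.inl h

lemma cr_id (a x b : ℝ × ℝ) : cr a x * b.2 + cr x b * a.2 = cr a b * x.2 := by
  unfold cr; ring

lemma pa_S1 {a x b : ℝ × ℝ} (ha : a.2 ≠ 0) (hx : x.2 ≠ 0) (hb : b.2 ≠ 0) (hab : 0 < cr a b)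
    (h : cyc3 (pa a) (pa x) (pa b)) : 0 < cr a x ∧ 0 < cr x b := by
  have id := cr_id a x b
  have neg : ¬ 0 < cr b a := by unfold cr at *; linarith
  unfold cyc3 at h
  rw [pa_lt ha hx, pa_lt hx hb, pa_lt hb ha] at h
  rcases h with ⟨h1, h2⟩ | ⟨h1, h2⟩ | ⟨h1, h2⟩
  · rcases h1 with ⟨h1, h1'⟩ | ⟨h1, h1'⟩ <;> rcases h2 with ⟨h2, h2'⟩ | ⟨h2, h2'⟩
    · linarith
    · have hb' : 0 < b.2 := pos_of_mul_pos_right h2 h1'.le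
      refine ⟨?_, h2'⟩
      by_contra hc
      nlinarith [mul_pos hab h1', mul_pos h2' (neg_pos.2 h1), mul_nonneg (neg_nonneg.2 (not_lt.1 hc)) hb'.le]
    · have ha' : a.2 < 0 := by
        by_contra hc; nlinarith [mul_nonneg (not_lt.1 hc) (neg_pos.2 h2).le]
      refine ⟨h1', ?_⟩
      by_contra hc
      nlinarith [mul_pos hab (neg_pos.2 h2), mul_pos h1' h2', mul_nonneg (neg_nonneg.2 (not_lt.1 hc)) (neg_pos.2 ha').le]
    · exact ⟨h1', h2'⟩
  · rcases h1 with ⟨h1, h1'⟩ | ⟨h1, h1'⟩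
    · rcases h2 with ⟨h2, h2'⟩ | ⟨h2, h2'⟩
      · linarith
      · have hx' : 0 < x.2 := pos_of_mul_pos_right h2 h1'.le
        refine ⟨h2', ?_⟩
        by_contra hc
        nlinarith [mul_pos hab hx', mul_pos h2' (neg_pos.2 h1), mul_nonneg (neg_nonneg.2 (not_lt.1 hc)) h1'.le]
    · exact absurd h1' neg
  · rcases h2 with ⟨h2, h2'⟩ | ⟨h2, h2'⟩
    · rcases h1 with ⟨h1, h1'⟩ | ⟨h1, h1'⟩
      · linarith
      · have hx' : x.2 < 0 := by
          by_contra hc; nlinarith [mul_nonneg (not_lt.1 hc) (neg_pos.2 h2).le]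
        refine ⟨?_, h1'⟩
        by_contra hc
        nlinarith [mul_pos hab (neg_pos.2 hx'), mul_pos h1' h2', mul_nonneg (neg_nonneg.2 (not_lt.1 hc)) (neg_pos.2 h2).le]
    · exact absurd h2' neg

lemma pa_S3 {a x b : ℝ × ℝ} (ha : a.2 ≠ 0) (hx : x.2 ≠ 0) (hb : b.2 ≠ 0) (hab : 0 < cr a b)
    (h1 : 0 < cr a x) (h2 : 0 < cr x b) : cyc3 (pa a) (pa x) (pa b) := by
  have id := cr_id a x b
  unfold cyc3
  rw [pa_lt ha hx, pa_lt hx hb, pa_lt hb ha]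
  rcases lt_or_gt_of_ne ha with ha' | ha' <;> rcases lt_or_gt_of_ne hx with hx' | hx' <;>
    rcases lt_or_gt_of_ne hb with hb' | hb'
  · exact Or.inl ⟨Or.inr ⟨mul_pos_of_neg_of_neg ha' hx', h1⟩, Or.inr ⟨mul_pos_of_neg_of_neg hx' hb', h2⟩⟩
  · exact Or.inl ⟨Or.inr ⟨mul_pos_of_neg_of_neg ha' hx', h1⟩, Or.inl ⟨hx', hb'⟩⟩
  · exfalso; nlinarith [mul_pos hab hx', mul_pos h1 (neg_pos.2 hb'), mul_pos h2 (neg_pos.2 ha')]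
  · exact Or.inl ⟨Or.inl ⟨ha', hx'⟩, Or.inr ⟨mul_pos hx' hb', h2⟩⟩
  · exact Or.inr (Or.inr ⟨Or.inr ⟨mul_pos_of_neg_of_neg hx' hb', h2⟩, Or.inl ⟨hb', ha'⟩⟩)
  · exfalso; nlinarith [mul_pos hab (neg_pos.2 hx'), mul_pos h1 hb', mul_pos h2 ha']
  · exact Or.inr (Or.inl ⟨Or.inl ⟨hb', ha'⟩, Or.inr ⟨mul_pos ha' hx', h1⟩⟩)
  · exact Or.inl ⟨Or.inr ⟨mul_pos ha' hx', h1⟩, Or.inr ⟨mul_pos hx' hb', h2⟩⟩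

section nxt

variable {W : Type*} [Fintype W] {E : SimpleGraph W} {p : W → ℝ × ℝ}

def tht (p : W → ℝ × ℝ) (v u : W) : ℝ := pa (p u - p v)

def IsNx (E : SimpleGraph W) (p : W → ℝ × ℝ) (v u w : W) : Prop :=
  E.Adj v w ∧ (∀ z, E.Adj v z → tht p v u < tht p v z → tht p v u < tht p v w ∧ tht p v w ≤ tht p v z) ∧
    ((∀ z, E.Adj v z → tht p v z ≤ tht p v u) → ∀ z, E.Adj v z → tht p v w ≤ tht p v z)

lemma exists_isNx {v u : W} (h : E.Adj v u) : ∃ w, IsNx E p v u w := by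
  by_cases hm : ∃ z, E.Adj v z ∧ tht p v u < tht p v z
  · obtain ⟨w, hw, hmin⟩ := Set.exists_min_image {z | E.Adj v z ∧ tht p v u < tht p v z} (tht p v) (Set.toFinite _) hm
    refine ⟨w, hw.1, fun z hz hlt => ⟨hw.2, hmin z ⟨hz, hlt⟩⟩, fun hall => ?_⟩
    linarith [hw.2, hall w hw.1]
  · push Not at hm
    obtain ⟨w, hw, hmin⟩ := Set.exists_min_image {z | E.Adj v z} (tht p v) (Set.toFinite _) ⟨u, h⟩
    exact ⟨w, hw, fun z hz hlt => by linarith [hm z hz], fun _ z hz => hmin z hz⟩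

def nxf (E : SimpleGraph W) (p : W → ℝ × ℝ) (v u : W) : W :=
  if h : ∃ w, IsNx E p v u w then h.choose else v

lemma nxf_spec {v u : W} (h : E.Adj v u) : IsNx E p v u (nxf E p v u) := by
  unfold nxf
  rw [dif_pos (exists_isNx h)]
  exact (exists_isNx h).choose_spec

lemma tht_inj (hP : PlaneD E p) (hy : Function.Injective (fun v => (p v).2)) {v u w : W} (hu : E.Adj v u)
    (hw : E.Adj v w) (h : tht p v u = tht p v w) : u = w := by
  have key : ∀ u w : W, E.Adj v u → E.Adj v w → tht p v u = tht p v w →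
      |(p u).2 - (p v).2| ≤ |(p w).2 - (p v).2| → u = w := by
    intro u w hu hw h hle
    have h1 : (p u - p v).2 ≠ 0 := by
      simp only [Prod.snd_sub]; intro e; exact hu.ne' (hy (sub_eq_zero.1 e))
    have h2 : (p w - p v).2 ≠ 0 := by
      simp only [Prod.snd_sub]; intro e; exact hw.ne' (hy (sub_eq_zero.1 e))
    have n1 := pa_neg h1
    have n2 := pa_neg h2
    have l1 := pa_lt h1 h2
    have l2 := pa_lt h2 h1
    unfold tht at h
    rw [h] at n1 l1 l2
    simp only [lt_irrefl, false_iff, not_or, not_and] at l1 l2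
    have hsgn : 0 < (p u - p v).2 * (p w - p v).2 := by
      rcases lt_or_gt_of_ne h1 with a | a
      · exact mul_pos_of_neg_of_neg a (n2.2 (n1.1 a))
      · refine mul_pos a ((lt_or_gt_of_ne h2).resolve_left fun b => ?_)
        linarith [n1.2 (n2.1 b)]
    have c1 := l1.2 hsgn
    have c2 := l2.2 (by rwa [mul_comm])
    simp only [cr, Prod.snd_sub, Prod.fst_sub] at c1 c2 h1 h2 hsgn
    set t := ((p u).2 - (p v).2) / ((p w).2 - (p v).2) with ht
    have ht0 : 0 < t := by
      rw [ht]
      rcases lt_or_gt_of_ne h2 with a | a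
      · exact div_pos_of_neg_of_neg (by nlinarith) a
      · exact div_pos (by nlinarith) a
    have ht1 : t ≤ 1 := by
      rw [← abs_of_pos ht0, ht, abs_div]
      exact div_le_one_of_le₀ hle (abs_nonneg _)
    have e2 : (p u).2 - (p v).2 = t * ((p w).2 - (p v).2) := by rw [ht]; field_simp
    have e1 : (p u).1 - (p v).1 = t * ((p w).1 - (p v).1) := by
      rw [ht]; field_simp; linarith
    have := hP.2.1 v w u hw (mem_seg_iff.2 ⟨t, ht0.le, ht1, by linarith, by linarith⟩)
    exact this.resolve_left hu.ne'
  rcases le_total |(p u).2 - (p v).2| |(p w).2 - (p v).2| with h' | h'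
  · exact key u w hu hw h h'
  · exact (key w u hw hu h.symm h').symm

lemma isNx_cyc (hP : PlaneD E p) (hy : Function.Injective (fun v => (p v).2)) {v u w z : W} (hu : E.Adj v u)
    (hw : IsNx E p v u w) (hz : E.Adj v z) (hzu : z ≠ u) (hzw : z ≠ w) :
    cyc3 (tht p v u) (tht p v w) (tht p v z) := by
  have n1 : tht p v z ≠ tht p v u := fun e => hzu (tht_inj hP hy hz hu e)
  have n2 : tht p v w ≠ tht p v z := fun e => hzw (tht_inj hP hy hw.1 hz e).symm
  rcases lt_or_gt_of_ne n1 with h | h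
  · by_cases hm : ∀ x, E.Adj v x → tht p v x ≤ tht p v u
    · exact Or.inr (Or.inr ⟨lt_of_le_of_ne (hw.2.2 hm z hz) n2, h⟩)
    · push Not at hm
      obtain ⟨x, hx, hlt⟩ := hm
      exact Or.inr (Or.inl ⟨h, (hw.2.1 x hx hlt).1⟩)
  · obtain ⟨a, b⟩ := hw.2.1 z hz h
    exact Or.inl ⟨a, lt_of_le_of_ne b n2⟩

lemma d2 (hy : Function.Injective (fun v => (p v).2)) {v u : W} (h : E.Adj v u) : (p u - p v).2 ≠ 0 := by
  simp only [Prod.snd_sub]; intro e; exact h.ne' (hy (sub_eq_zero.1 e))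

/-- no neighbour inside the wedge identifies the successor -/
lemma nx_eq (hP : PlaneD E p) (hy : Function.Injective (fun v => (p v).2)) {v u w : W} (hu : E.Adj v u)
    (hw : E.Adj v w) (hpos : 0 < cr (p u - p v) (p w - p v))
    (hno : ∀ z, E.Adj v z → ¬ (0 < cr (p u - p v) (p z - p v) ∧ 0 < cr (p z - p v) (p w - p v))) :
    nxf E p v u = w := by
  by_contra hne
  have hs := nxf_spec (p := p) hu
  have hwu : w ≠ u := by rintro rfl; unfold cr at hpos; linarith
  have := isNx_cyc hP hy hu hs hw hwu (Ne.symm hne)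
  exact hno _ hs.1 (pa_S1 (d2 hy hu) (d2 hy hs.1) (d2 hy hw) hpos this)

lemma nx_wedge (hP : PlaneD E p) (hy : Function.Injective (fun v => (p v).2)) {v u z : W} (hu : E.Adj v u)
    (hz : E.Adj v z) (hpos : 0 < cr (p u - p v) (p z - p v)) :
    0 < cr (p u - p v) (p (nxf E p v u) - p v) ∧ ∀ x, E.Adj v x → ¬ (0 < cr (p u - p v) (p x - p v) ∧
      0 < cr (p x - p v) (p (nxf E p v u) - p v)) := by
  have hs := nxf_spec (p := p) hu
  have hzu : z ≠ u := by rintro rfl; unfold cr at hpos; linarith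
  have h1 : 0 < cr (p u - p v) (p (nxf E p v u) - p v) := by
    by_cases hzw : z = nxf E p v u
    · rw [← hzw]; exact hpos
    · exact (pa_S1 (d2 hy hu) (d2 hy hs.1) (d2 hy hz) hpos (isNx_cyc hP hy hu hs hz hzu hzw)).1
  refine ⟨h1, ?_⟩
  rintro x hx ⟨a, b⟩
  have hxu : x ≠ u := by rintro rfl; unfold cr at a; linarith
  have hxw : x ≠ nxf E p v u := by intro e; rw [← e] at b; unfold cr at b; linarith
  exact cyc3_asymm (pa_S3 (d2 hy hu) (d2 hy hx) (d2 hy hs.1) h1 a b) (isNx_cyc hP hy hu hs hx hxu hxw)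

lemma nx_outer (hP : PlaneD E p) (hy : Function.Injective (fun v => (p v).2)) {v a b : W} (ha : E.Adj v a)
    (hb : E.Adj v b) (hpos : 0 < cr (p a - p v) (p b - p v))
    (hin : ∀ z, E.Adj v z → z ≠ a → z ≠ b → 0 < cr (p a - p v) (p z - p v) ∧ 0 < cr (p z - p v) (p b - p v)) :
    nxf E p v b = a := by
  by_contra hne
  have hs := nxf_spec (p := p) hb
  have hab : a ≠ b := by rintro rfl; unfold cr at hpos; linarith
  have h1 := isNx_cyc hP hy hb hs ha hab (Ne.symm hne)
  have hwb : nxf E p v b ≠ b := by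
    intro e; rw [e] at h1; unfold cyc3 at h1
    rcases h1 with h | h | h <;> linarith [h.1, h.2]
  obtain ⟨c1, c2⟩ := hin _ hs.1 hne hwb
  have h2 := pa_S3 (d2 hy ha) (d2 hy hs.1) (d2 hy hb) hpos c1 c2
  exact cyc3_asymm (cyc3_rot (cyc3_rot h2)) h1

end nxt

end

end FP


namespace FP

noncomputable section

open Classical

variable {W : Type*} [Fintype W] {E : SimpleGraph W} {p : W → ℝ × ℝ}

def Free (E : SimpleGraph W) (p : W → ℝ × ℝ) (u v : W) : Prop :=
  u ≠ v ∧ (∀ x, p x ∈ segment ℝ (p u) (p v) → x = u ∨ x = v) ∧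
  ∀ a b, E.Adj a b → a ≠ u → a ≠ v → b ≠ u → b ≠ v → ∀ q, q ∈ segment ℝ (p u) (p v) →
    q ∈ segment ℝ (p a) (p b) → False

lemma exists_coord {o e1 e2 : ℝ × ℝ} (h : cr (e1 - o) (e2 - o) ≠ 0) :
    ∃ f : (ℝ × ℝ) →ᵃ[ℝ] (ℝ × ℝ), Function.Injective f ∧ f o = (0, 0) ∧ f e1 = (1, 0) ∧ f e2 = (0, 1) ∧
      ∀ x, f x = (cr (x - o) (e2 - o) / cr (e1 - o) (e2 - o), cr (e1 - o) (x - o) / cr (e1 - o) (e2 - o)) := by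
  let L : (ℝ × ℝ) →ₗ[ℝ] (ℝ × ℝ) :=
    { toFun := fun x => (cr x (e2 - o) / cr (e1 - o) (e2 - o), cr (e1 - o) x / cr (e1 - o) (e2 - o))
      map_add' := fun x y => by ext <;> simp [cr] <;> ring
      map_smul' := fun x y => by ext <;> simp [cr] <;> ring }
  let f : (ℝ × ℝ) →ᵃ[ℝ] (ℝ × ℝ) :=
    { toFun := fun x => L (x - o)
      linear := L
      map_vadd' := fun x y => by rw [vadd_eq_add, vadd_eq_add, add_comm y, ← map_add]; congr 1; abel }
  have hf : ∀ x, f x = (cr (x - o) (e2 - o) / cr (e1 - o) (e2 - o), cr (e1 - o) (x - o) / cr (e1 - o) (e2 - o)) :=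
    fun x => rfl
  refine ⟨f, ?_, ?_, ?_, ?_, hf⟩
  · intro x y hxy
    rw [hf, hf, Prod.mk.injEq, div_left_inj' h, div_left_inj' h] at hxy
    obtain ⟨h1, h2⟩ := hxy
    simp only [cr, Prod.fst_sub, Prod.snd_sub] at h h1 h2
    ext
    · apply mul_left_cancel₀ h; linear_combination (e1.1 - o.1) * h1 + (e2.1 - o.1) * h2
    · apply mul_left_cancel₀ h; linear_combination (e1.2 - o.2) * h1 + (e2.2 - o.2) * h2
  · rw [hf]; simp [cr]
  · rw [hf]; ext
    · exact div_self h
    · simp [cr]; left; ring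
  · rw [hf]; ext
    · simp [cr]; left; ring
    · exact div_self h

lemma aff_seg {f : (ℝ × ℝ) →ᵃ[ℝ] (ℝ × ℝ)} (hf : Function.Injective f) {x a b : ℝ × ℝ} :
    f x ∈ segment ℝ (f a) (f b) ↔ x ∈ segment ℝ a b := by
  rw [← image_segment]; exact hf.mem_set_image

lemma Free.of_aff {f : (ℝ × ℝ) →ᵃ[ℝ] (ℝ × ℝ)} (hf : Function.Injective f) {u v : W}
    (h : Free E (fun x => f (p x)) u v) : Free E p u v :=
  ⟨h.1, fun x hx => h.2.1 x ((aff_seg hf).2 hx), fun a b hab h1 h2 h3 h4 q hq hq' =>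
    h.2.2 a b hab h1 h2 h3 h4 (f q) ((aff_seg hf).2 hq) ((aff_seg hf).2 hq')⟩

lemma exit2 {a1 a2 b1 b2 : ℝ} (h1 : 0 < a1) (h2 : 0 < a2) (hb : b1 < 0 ∨ b2 < 0) :
    ∃ τ, 0 < τ ∧ τ < 1 ∧ (((1 - τ) * a1 + τ * b1 = 0 ∧ 0 ≤ (1 - τ) * a2 + τ * b2) ∨
      (0 ≤ (1 - τ) * a1 + τ * b1 ∧ (1 - τ) * a2 + τ * b2 = 0)) := by
  have key : ∀ a1 a2 b1 b2 : ℝ, 0 < a1 → 0 < a2 → b1 < 0 → a1 * b2 - a2 * b1 ≥ 0 →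
      ∃ τ, 0 < τ ∧ τ < 1 ∧ ((1 - τ) * a1 + τ * b1 = 0 ∧ 0 ≤ (1 - τ) * a2 + τ * b2) := by
    intro a1 a2 b1 b2 h1 h2 hb hc
    have hd : 0 < a1 - b1 := by linarith
    refine ⟨a1 / (a1 - b1), by positivity, by rw [div_lt_one hd]; linarith, by field_simp; ring, ?_⟩
    have : (1 - a1 / (a1 - b1)) * a2 + a1 / (a1 - b1) * b2 = (a1 * b2 - a2 * b1) / (a1 - b1) := by
      field_simp; ring
    rw [this]; positivity
  by_cases hc : a1 * b2 - a2 * b1 ≥ 0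
  · by_cases hb1 : b1 < 0
    · obtain ⟨τ, x, y, z⟩ := key a1 a2 b1 b2 h1 h2 hb1 hc
      exact ⟨τ, x, y, Or.inl z⟩
    · have hb2 := hb.resolve_left hb1
      nlinarith [mul_pos h1 (neg_pos.2 hb2), mul_nonneg h2.le (not_lt.1 hb1)]
  · by_cases hb2 : b2 < 0
    · obtain ⟨τ, x, y, z⟩ := key a2 a1 b2 b1 h2 h1 hb2 (by linarith)
      exact ⟨τ, x, y, Or.inr ⟨z.2, z.1⟩⟩
    · have hb1 := hb.resolve_right hb2
      nlinarith [mul_pos h2 (neg_pos.2 hb1), mul_nonneg h1.le (not_lt.1 hb2)]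

lemma seg_sub {a b q r : ℝ × ℝ} {τ : ℝ} (hq : q ∈ segment ℝ a b) (h0 : 0 ≤ τ) (h1 : τ ≤ 1)
    (e1 : r.1 = (1 - τ) * q.1 + τ * a.1) (e2 : r.2 = (1 - τ) * q.2 + τ * a.2) : r ∈ segment ℝ a b := by
  obtain ⟨t, t0, t1, ex, ey⟩ := mem_seg_iff.1 hq
  refine mem_seg_iff.2 ⟨(1 - τ) * t, mul_nonneg (by linarith) t0, by nlinarith, ?_, ?_⟩
  · rw [e1, ex]; ring
  · rw [e2, ey]; ring

lemma cvx_contra {t A B c : ℝ} (t0 : 0 ≤ t) (t1 : t ≤ 1) (hA : c < A) (hB : c < B)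
    (h : (1 - t) * A + t * B = c) : False := by
  rcases eq_or_lt_of_le t0 with rfl | ht
  · linarith
  · nlinarith [mul_pos ht (sub_pos.2 hB), mul_nonneg (sub_nonneg.2 t1) (sub_pos.2 hA).le]

section A

variable {v u w : W}

lemma normA_core (hP : PlaneD E p) (hv : p v = (0, 0)) (hu1 : p u = (1, 0)) (hw1 : p w = (0, 1))
    (hu : E.Adj v u) (hw : E.Adj v w) {a b : W} (hab : E.Adj a b) (ha : a ≠ v) (hb : b ≠ v) {q : ℝ × ℝ}
    (hq : q ∈ segment ℝ (p a) (p b)) (q1 : 0 < q.1) (q2 : 0 < q.2) (hφ : q.1 + q.2 ≤ 1)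
    (haq : (p a).1 + (p a).2 ≤ q.1 + q.2) (hneg : (p a).1 < 0 ∨ (p a).2 < 0)
    (hx : q.1 + q.2 < 1 ∨ (a ≠ u ∧ a ≠ w ∧ b ≠ u ∧ b ≠ w)) : False := by
  obtain ⟨τ, t0, t1, hτ⟩ := exit2 q1 q2 hneg
  have hr := seg_sub (r := ((1 - τ) * q.1 + τ * (p a).1, (1 - τ) * q.2 + τ * (p a).2)) hq t0.le t1.le rfl rfl
  have hrφ : ((1 - τ) * q.1 + τ * (p a).1) + ((1 - τ) * q.2 + τ * (p a).2) ≤ q.1 + q.2 := by nlinarith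
  have hset : ∀ y, ({a, b} : Set W) ≠ {v, y} := by
    intro y e
    have : v ∈ ({a, b} : Set W) := e ▸ (by simp)
    rcases this with h | h
    · exact ha h.symm
    · exact hb h.symm
  have fin : ∀ y, (y = u ∨ y = w) → (p y).1 + (p y).2 = 1 → E.Adj v y →
      ((1 - τ) * q.1 + τ * (p a).1, (1 - τ) * q.2 + τ * (p a).2) ∈ segment ℝ (p v) (p y) → False := by
    intro y hy hy1 hvy hseg
    obtain ⟨x, hx1, hx2, hx3⟩ := hP.isPlane.2.2 a b v y hab hvy (hset y) _ hr hseg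
    rcases hx2 with rfl | rfl
    · rcases hx1 with h | h
      · exact ha h.symm
      · exact hb h.symm
    · rw [← hx3] at hy1
      simp only at hy1
      rcases hx with h | ⟨h1, h2, h3, h4⟩
      · linarith
      · rcases hy with rfl | rfl <;> rcases hx1 with h | h
        · exact h1 h.symm
        · exact h3 h.symm
        · exact h2 h.symm
        · exact h4 h.symm
  rcases hτ with ⟨e, h⟩ | ⟨h, e⟩
  · refine fin w (Or.inr rfl) (by rw [hw1]; norm_num) hw (mem_seg_iff.2 ⟨(1 - τ) * q.2 + τ * (p a).2, h, by linarith, ?_, ?_⟩)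
    · rw [hv, hw1]; simp only; linarith
    · rw [hv, hw1]; simp only; ring
  · refine fin u (Or.inl rfl) (by rw [hu1]; norm_num) hu (mem_seg_iff.2 ⟨(1 - τ) * q.1 + τ * (p a).1, h, by linarith, ?_, ?_⟩)
    · rw [hv, hu1]; simp only; ring
    · rw [hv, hu1]; simp only; linarith

lemma normA (hP : PlaneD E p) (hmax : ∀ u v, Free E p u v → E.Adj u v)
    (hv : p v = (0, 0)) (hu1 : p u = (1, 0)) (hw1 : p w = (0, 1))
    (hu : E.Adj v u) (hw : E.Adj v w) (hno : ∀ x, E.Adj v x → ¬ (0 < (p x).1 ∧ 0 < (p x).2)) :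
    E.Adj u w ∧ ∀ z, E.Adj u z → ¬ (0 < (p z).2 ∧ (p z).1 + (p z).2 < 1) := by
  have hpos : ∀ x, x ≠ v → x ≠ u → x ≠ w → 0 ≤ (p x).1 → 0 ≤ (p x).2 → (p x).1 + (p x).2 ≤ 1 →
      0 < (p x).1 ∧ 0 < (p x).2 := by
    intro x xv xu xw h1 h2 h3
    constructor
    · refine lt_of_le_of_ne h1 (fun e => ?_)
      rcases hP.2.1 v w x hw (mem_seg_iff.2 ⟨(p x).2, h2, by linarith, by rw [hv, hw1]; simp [← e],
        by rw [hv, hw1]; simp⟩) with h | h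
      · exact xv h
      · exact xw h
    · refine lt_of_le_of_ne h2 (fun e => ?_)
      rcases hP.2.1 v u x hu (mem_seg_iff.2 ⟨(p x).1, h1, by linarith, by rw [hv, hu1]; simp,
        by rw [hv, hu1]; simp [← e]⟩) with h | h
      · exact xv h
      · exact xu h
  have notv : ∀ {a b : W}, E.Adj a b → ∀ {y q}, a ≠ y → b ≠ y → q ∈ segment ℝ (p a) (p b) → q ≠ p y := by
    rintro a b hab y q h1 h2 hq rfl
    rcases hP.2.1 a b y hab hq with h | h
    · exact h1 h.symm
    · exact h2 h.symm
  have hemp : ∀ x, x ≠ v → x ≠ u → x ≠ w → 0 ≤ (p x).1 → 0 ≤ (p x).2 → (p x).1 + (p x).2 ≤ 1 → False := by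
    intro x xv xu xw h1 h2 h3
    obtain ⟨z, hz, hmin⟩ := Set.exists_min_image {x | (0 < (p x).1 ∧ 0 < (p x).2) ∧ (p x).1 + (p x).2 ≤ 1}
      (fun x => (p x).1 + (p x).2) (Set.toFinite _) ⟨x, hpos x xv xu xw h1 h2 h3, h3⟩
    obtain ⟨⟨z1, z2⟩, z3⟩ := hz
    refine hno z (hmax v z ⟨?_, ?_, ?_⟩) ⟨z1, z2⟩
    · rintro rfl; rw [hv] at z1; simp at z1
    · intro y hy
      obtain ⟨s, s0, s1, ex, ey⟩ := mem_seg_iff.1 hy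
      simp only [hv, mul_zero, zero_add] at ex ey
      rcases eq_or_lt_of_le s0 with rfl | s0
      · left; apply hP.1; rw [hv]; ext <;> simp [ex, ey]
      · right
        have := hmin y ⟨⟨by rw [ex]; positivity, by rw [ey]; positivity⟩, by rw [ex, ey]; nlinarith⟩
        simp only [ex, ey] at this
        have : s = 1 := by nlinarith
        subst this
        apply hP.1; ext <;> simp [ex, ey]
    · intro a b hab av az bv bz q hq hq'
      obtain ⟨s, s0, s1, ex, ey⟩ := mem_seg_iff.1 hq
      simp only [hv, mul_zero, zero_add] at ex ey
      have s0' : 0 < s := lt_of_le_of_ne s0 (by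
        rintro rfl; exact notv hab av bv hq' (by rw [hv]; ext <;> simp [ex, ey]))
      have s1' : s < 1 := lt_of_le_of_ne s1 (by
        rintro rfl; exact notv hab az bz hq' (by ext <;> simp [ex, ey]))
      have q1 : 0 < q.1 := by rw [ex]; positivity
      have q2 : 0 < q.2 := by rw [ey]; positivity
      have hφ : q.1 + q.2 < (p z).1 + (p z).2 := by rw [ex, ey]; nlinarith
      have go : ∀ a b, E.Adj a b → a ≠ v → b ≠ v → q ∈ segment ℝ (p a) (p b) →
          (p a).1 + (p a).2 ≤ q.1 + q.2 → False := by
        intro a b hab av bv hq' haq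
        refine normA_core hP hv hu1 hw1 hu hw hab av bv hq' q1 q2 (by linarith) haq ?_ (Or.inl (by linarith))
        by_contra hc
        push Not at hc
        have au : a ≠ u := by rintro rfl; rw [hu1] at haq; norm_num at haq; linarith
        have aw : a ≠ w := by rintro rfl; rw [hw1] at haq; norm_num at haq; linarith
        have := hmin a ⟨hpos a av au aw hc.1 hc.2 (by linarith), by linarith⟩
        linarith
      obtain ⟨t, t0, t1, fx, fy⟩ := mem_seg_iff.1 hq'
      by_cases h : (p a).1 + (p a).2 ≤ q.1 + q.2
      · exact go a b hab av bv hq' h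
      · refine go b a hab.symm bv av (by rwa [segment_symm]) ?_
        by_contra h'
        push Not at h h'
        exact cvx_contra t0 t1 h h' (by linarith)
  have hfin : Free E p u w := by
    refine ⟨?_, ?_, ?_⟩
    · rintro rfl; rw [hu1] at hw1; simp at hw1
    · intro x hx
      obtain ⟨s, s0, s1, ex, ey⟩ := mem_seg_iff.1 hx
      simp only [hu1, hw1, mul_zero, mul_one, zero_add, add_zero] at ex ey
      by_contra hc
      push Not at hc
      refine hemp x ?_ hc.1 hc.2 (by linarith) (by linarith) (by linarith)
      rintro rfl; rw [hv] at ex ey; simp only at ex ey; linarith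
    · intro a b hab au aw bu bw q hq hq'
      obtain ⟨s, s0, s1, ex, ey⟩ := mem_seg_iff.1 hq
      simp only [hu1, hw1, mul_zero, mul_one, zero_add, add_zero] at ex ey
      have s0' : 0 < s := lt_of_le_of_ne s0 (by
        rintro rfl; exact notv hab au bu hq' (by rw [hu1]; ext <;> simp [ex, ey]))
      have s1' : s < 1 := lt_of_le_of_ne s1 (by
        rintro rfl; exact notv hab aw bw hq' (by rw [hw1]; ext <;> simp [ex, ey]))
      have go0 : ∀ b, E.Adj v b → q ∈ segment ℝ (p v) (p b) → False := by
        intro b hb hq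
        obtain ⟨t, t0, t1, fx, fy⟩ := mem_seg_iff.1 hq
        simp only [hv, mul_zero, zero_add] at fx fy
        refine hno b hb ⟨pos_of_mul_pos_right (a := t) (by linarith) t0, pos_of_mul_pos_right (a := t) (by linarith) t0⟩
      by_cases av : a = v
      · subst av; exact go0 b hab hq'
      by_cases bv : b = v
      · subst bv; exact go0 a hab.symm (by rwa [segment_symm])
      have go : ∀ a b, E.Adj a b → a ≠ v → b ≠ v → a ≠ u → a ≠ w → b ≠ u → b ≠ w → q ∈ segment ℝ (p a) (p b) →
          (p a).1 + (p a).2 ≤ 1 → False := by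
        intro a b hab av bv au aw bu bw hq' haq
        refine normA_core hP hv hu1 hw1 hu hw hab av bv hq' (by linarith) (by linarith) (by linarith) (by linarith) ?_
          (Or.inr ⟨au, aw, bu, bw⟩)
        by_contra hc
        push Not at hc
        exact hemp a av au aw hc.1 hc.2 haq
      obtain ⟨t, t0, t1, fx, fy⟩ := mem_seg_iff.1 hq'
      by_cases h : (p a).1 + (p a).2 ≤ 1
      · exact go a b hab av bv au aw bu bw hq' h
      · refine go b a hab.symm bv av bu bw au aw (by rwa [segment_symm]) ?_
        by_contra h'
        push Not at h h'
        exact cvx_contra t0 t1 h h' (by linarith)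
  refine ⟨hmax u w hfin, ?_⟩
  rintro z hz ⟨h2, h3⟩
  have zv : z ≠ v := by rintro rfl; rw [hv] at h2; simp at h2
  have zw : z ≠ w := by rintro rfl; rw [hw1] at h3; simp at h3
  rcases le_or_gt 0 (p z).1 with h1 | h1
  · exact hemp z zv hz.ne' zw h1 h2.le h3.le
  · have hd : 0 < 1 - (p z).1 := by linarith
    have hr2 : 1 / (1 - (p z).1) * (p z).2 ≤ 1 := by
      rw [div_mul_eq_mul_div, div_le_one hd]; linarith
    refine hP.2.2 u z v w hz hw hu.ne' hfin.1 zv zw (0, 1 / (1 - (p z).1) * (p z).2)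
      (mem_seg_iff.2 ⟨1 / (1 - (p z).1), by positivity, by rw [div_le_one hd]; linarith, ?_, ?_⟩)
      (mem_seg_iff.2 ⟨1 / (1 - (p z).1) * (p z).2, by positivity, hr2, ?_, ?_⟩)
    · rw [hu1]; field_simp; ring
    · rw [hu1]; simp
    · rw [hv, hw1]; simp
    · rw [hv, hw1]; simp

theorem claimA (hP : PlaneD E p) (hmax : ∀ u v, Free E p u v → E.Adj u v)
    (hu : E.Adj v u) (hw : E.Adj v w) (hpos : 0 < cr (p u - p v) (p w - p v))
    (hno : ∀ x, E.Adj v x → ¬ (0 < cr (p u - p v) (p x - p v) ∧ 0 < cr (p x - p v) (p w - p v))) :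
    E.Adj u w ∧ ∀ z, E.Adj u z → ¬ (0 < cr (p w - p u) (p z - p u) ∧ 0 < cr (p z - p u) (p v - p u)) := by
  obtain ⟨f, hf, f0, f1, f2, hfx⟩ := exists_coord hpos.ne'
  have := normA (p := fun x => f (p x)) (hP.affine f hf) (fun u v h => hmax u v (Free.of_aff hf h)) f0 f1 f2 hu hw
    (by
      rintro x hx ⟨h1, h2⟩
      rw [hfx] at h1 h2
      exact hno x hx ⟨(div_pos_iff_of_pos_right hpos).1 h2, (div_pos_iff_of_pos_right hpos).1 h1⟩)
  refine ⟨this.1, ?_⟩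
  rintro z hz ⟨h1, h2⟩
  refine this.2 z hz ⟨?_, ?_⟩
  · rw [hfx]
    refine div_pos ?_ hpos
    simp only [cr, Prod.fst_sub, Prod.snd_sub] at h2 ⊢; linarith
  · rw [hfx]; simp only
    rw [← add_div, div_lt_one hpos]
    simp only [cr, Prod.fst_sub, Prod.snd_sub] at h1 ⊢; linarith

end A

end

end FP


namespace FP

noncomputable section

open Classical

variable {W : Type*} [Fintype W] {E : SimpleGraph W} {p : W → ℝ × ℝ} {v a b : W}

lemma not_on (hP : PlaneD E p) {a b : W} (hab : E.Adj a b) {y : W} {q : ℝ × ℝ} (h1 : a ≠ y) (h2 : b ≠ y)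
    (hq : q ∈ segment ℝ (p a) (p b)) : q ≠ p y := by
  rintro rfl
  rcases hP.2.1 a b y hab hq with h | h
  · exact h1 h.symm
  · exact h2 h.symm

lemma normB_core (hP : PlaneD E p) (ha1 : p a = (0, 1)) (hab : E.Adj a b)
    (hq : ((1 : ℝ), (0 : ℝ)) ∈ segment ℝ (p a) (p b)) (hnv : ∀ x, p x ≠ (1, 0))
    {c d : W} (hcd : E.Adj c d) {q r : ℝ × ℝ} (hq0 : q ∈ segment ℝ (p c) (p d))
    (hqφ : q.1 + q.2 < 1) (hr : r ∈ segment ℝ (p c) (p d)) (r1 : 0 < r.1) (r2 : 0 ≤ r.2)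
    (hrφ : r.1 + r.2 = 1) : False := by
  have hr' : r ∈ segment ℝ (p a) (p b) := seg_sub (τ := r.2) hq r2 (by linarith)
    (by rw [ha1]; simp only; linarith) (by rw [ha1]; simp only; ring)
  obtain ⟨t, t0, t1, ex, ey⟩ := mem_seg_iff.1 hq
  simp only [ha1, mul_zero, zero_add, mul_one] at ex ey
  by_cases hs : ({c, d} : Set W) = {a, b}
  · have hqs : q ∈ segment ℝ (p a) (p b) := by
      rcases Set.pair_eq_pair_iff.1 hs with ⟨rfl, rfl⟩ | ⟨rfl, rfl⟩
      · exact hq0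
      · rwa [segment_symm]
    obtain ⟨s, s0, s1, fx, fy⟩ := mem_seg_iff.1 hqs
    simp only [ha1, mul_zero, zero_add, mul_one] at fx fy
    have ht : t ≠ 0 := by rintro rfl; simp at ex
    have hb : (p b).1 + (p b).2 = 1 := by apply mul_left_cancel₀ ht; linarith
    have : q.1 + q.2 = 1 := by rw [fx, fy]; linear_combination s * hb
    linarith
  · obtain ⟨w, -, hw, e⟩ := hP.isPlane.2.2 c d a b hcd hab hs r hr hr'
    rcases hw with rfl | rfl
    · rw [e, ha1] at r1; simp at r1
    · rw [e] at r1 r2 hrφ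
      have h1 : t = 1 := by nlinarith
      subst h1
      apply hnv w; ext <;> simp only <;> linarith

lemma normB (hP : PlaneD E p) (hmax : ∀ u v, Free E p u v → E.Adj u v)
    (hv : p v = (0, 0)) (ha1 : p a = (0, 1)) (hab : E.Adj a b)
    (hq : ((1 : ℝ), (0 : ℝ)) ∈ segment ℝ (p a) (p b)) (hnv : ∀ x, p x ≠ (1, 0))
    (hs : ∀ c d, E.Adj c d → c ≠ v → d ≠ v → ∀ s : ℝ, 0 ≤ s → s < 1 → (s, (0 : ℝ)) ∉ segment ℝ (p c) (p d))
    (hsv : ∀ x, x ≠ v → ∀ s : ℝ, 0 ≤ s → s ≤ 1 → p x ≠ (s, 0)) :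
    ∃ y, E.Adj v y ∧ 0 ≤ (p y).1 ∧ 0 ≤ (p y).2 := by
  let S : Set W := {x | x ≠ v ∧ 0 ≤ (p x).1 ∧ 0 ≤ (p x).2 ∧ (p x).1 + (p x).2 ≤ 1}
  have hS2 : ∀ x ∈ S, 0 < (p x).2 := by
    rintro x ⟨xv, h1, h2, h3⟩
    refine lt_of_le_of_ne h2 (fun e => hsv x xv (p x).1 h1 (by linarith) ?_)
    ext <;> simp [← e]
  have haS : a ∈ S := by
    refine ⟨?_, ?_⟩
    · rintro rfl; rw [hv] at ha1; simp at ha1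
    · simp [ha1]
  obtain ⟨y0, hy0, hmx⟩ := Set.exists_max_image S (fun x => (p x).1 / (p x).2) (Set.toFinite _) ⟨a, haS⟩
  obtain ⟨y, ⟨hy, hyr⟩, hmn⟩ := Set.exists_min_image {x | x ∈ S ∧ (p x).1 / (p x).2 = (p y0).1 / (p y0).2}
    (fun x => (p x).2) (Set.toFinite _) ⟨y0, hy0, rfl⟩
  have y2 := hS2 y hy
  have hmx' : ∀ x ∈ S, (p x).1 * (p y).2 ≤ (p y).1 * (p x).2 := by
    intro x hx
    have := hmx x hx
    rw [← hyr, div_le_div_iff₀ (hS2 x hx) y2] at this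
    exact this
  have hmn' : ∀ x ∈ S, (p x).1 * (p y).2 = (p y).1 * (p x).2 → (p y).2 ≤ (p x).2 := by
    intro x hx e
    refine hmn x ⟨hx, ?_⟩
    rw [← hyr, div_eq_div_iff (hS2 x hx).ne' y2.ne', e]
  clear hmx hmn hyr hy0 y0
  obtain ⟨yv, y1, -, yφ⟩ := hy
  refine ⟨y, hmax v y ⟨yv.symm, ?_, ?_⟩, y1, y2.le⟩
  · intro x hx
    obtain ⟨s, s0, s1, ex, ey⟩ := mem_seg_iff.1 hx
    simp only [hv, mul_zero, zero_add] at ex ey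
    by_cases xv : x = v
    · exact Or.inl xv
    right
    have hle := hmn' x ⟨xv, by rw [ex]; positivity, by rw [ey]; positivity, by rw [ex, ey]; nlinarith⟩
      (by rw [ex, ey]; ring)
    have : s = 1 := by rw [ey] at hle; nlinarith
    subst this
    apply hP.1; ext <;> simp [ex, ey]
  · intro c d hcd cv cy dv dy q hq0 hq'
    obtain ⟨s, s0, s1, ex, ey⟩ := mem_seg_iff.1 hq0
    simp only [hv, mul_zero, zero_add] at ex ey
    have s0' : 0 < s := lt_of_le_of_ne s0 (by
      rintro rfl; exact not_on hP hcd cv dv hq' (by rw [hv]; ext <;> simp [ex, ey]))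
    have s1' : s < 1 := lt_of_le_of_ne s1 (by
      rintro rfl; exact not_on hP hcd cy dy hq' (by ext <;> simp [ex, ey]))
    have q2 : 0 < q.2 := by rw [ey]; positivity
    have qy : q.2 < (p y).2 := by rw [ey]; nlinarith
    have qφ : q.1 + q.2 < 1 := by rw [ex, ey]; nlinarith
    have qψ : q.1 * (p y).2 = (p y).1 * q.2 := by rw [ex, ey]; ring
    clear s0 s1 s0' s1' ex ey hq0
    have key : ∀ c d, E.Adj c d → c ≠ v → c ≠ y → d ≠ v → d ≠ y → q ∈ segment ℝ (p c) (p d) →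
        ((p y).1 * (p c).2 < (p c).1 * (p y).2 ∨ ((p c).1 * (p y).2 = (p y).1 * (p c).2 ∧ q.2 ≤ (p c).2)) → False := by
      intro c d hcd cv cy dv dy hq' hc
      rcases hc with hc | ⟨hc, hc2⟩
      · have hout : (p c).2 < 0 ∨ 1 - ((p c).1 + (p c).2) < 0 := by
          by_contra hn
          push Not at hn
          have c1 : 0 < (p c).1 := pos_of_mul_pos_left (lt_of_le_of_lt (mul_nonneg y1 hn.1) hc) y2.le
          have := hmx' c ⟨cv, c1.le, hn.1, by linarith⟩
          linarith
        obtain ⟨τ, t0, t1, hτ⟩ := exit2 q2 (sub_pos.2 qφ) hout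
        have hr := seg_sub (r := ((1 - τ) * q.1 + τ * (p c).1, (1 - τ) * q.2 + τ * (p c).2)) hq' t0.le t1.le rfl rfl
        have hrψ : (p y).1 * ((1 - τ) * q.2 + τ * (p c).2) < ((1 - τ) * q.1 + τ * (p c).1) * (p y).2 := by
          nlinarith [mul_pos t0 (sub_pos.2 hc)]
        have h2 : 0 ≤ (1 - τ) * q.2 + τ * (p c).2 := by rcases hτ with ⟨e, h⟩ | ⟨h, e⟩ <;> linarith
        have h1 : 0 < (1 - τ) * q.1 + τ * (p c).1 :=
          pos_of_mul_pos_left (lt_of_le_of_lt (mul_nonneg y1 h2) hrψ) y2.le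
        by_cases hφ : ((1 - τ) * q.1 + τ * (p c).1) + ((1 - τ) * q.2 + τ * (p c).2) = 1
        · exact normB_core hP ha1 hab hq hnv hcd hq' qφ hr h1 h2 hφ
        · rcases hτ with ⟨e, h⟩ | ⟨h, e⟩
          · rw [e] at hr
            refine hs c d hcd cv dv _ h1.le (lt_of_le_of_ne (by linarith) (fun e' => hφ ?_)) hr
            rw [e, e']; norm_num
          · exact hφ (by linarith)
      · rcases lt_or_ge (p c).2 (p y).2 with h | h
        · have c1 : 0 ≤ (p c).1 := by
            by_contra hn
            nlinarith [mul_nonneg y1 (q2.le.trans hc2)]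
          have hle : (p c).1 ≤ (p y).1 := by
            by_contra hn
            push Not at hn
            nlinarith [mul_nonneg y1 (sub_pos.2 h).le]
          have := hmn' c ⟨cv, c1, q2.le.trans hc2, by linarith⟩ hc
          linarith
        · have hd : 0 < (p c).2 - q.2 := by linarith
          refine not_on hP hcd cy dy (seg_sub (r := p y) (τ := ((p y).2 - q.2) / ((p c).2 - q.2)) hq'
            (div_nonneg (by linarith) hd.le) (by rw [div_le_one hd]; linarith) ?_ ?_) rfl
          · have hτ : ((p y).2 - q.2) / ((p c).2 - q.2) * ((p c).2 - q.2) = (p y).2 - q.2 := div_mul_cancel₀ _ hd.ne'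
            generalize ((p y).2 - q.2) / ((p c).2 - q.2) = τ at hτ
            apply mul_left_cancel₀ y2.ne'
            linear_combination -(1 - τ) * qψ - τ * hc - (p y).1 * hτ
          · field_simp; ring
    obtain ⟨t, t0, t1, ex, ey⟩ := mem_seg_iff.1 hq'
    have hsym := (segment_symm ℝ (p c) (p d)) ▸ hq'
    by_cases hc : (p y).1 * (p c).2 < (p c).1 * (p y).2
    · exact key c d hcd cv cy dv dy hq' (Or.inl hc)
    by_cases hd : (p y).1 * (p d).2 < (p d).1 * (p y).2
    · exact key d c hcd.symm dv dy cv cy hsym (Or.inl hd)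
    push Not at hc hd
    have hav : (1 - t) * ((p y).1 * (p c).2 - (p c).1 * (p y).2) + t * ((p y).1 * (p d).2 - (p d).1 * (p y).2) = 0 := by
      rw [ex, ey] at qψ; linarith
    have ca : 0 ≤ (1 - t) * ((p y).1 * (p c).2 - (p c).1 * (p y).2) := mul_nonneg (by linarith) (by linarith)
    have da : 0 ≤ t * ((p y).1 * (p d).2 - (p d).1 * (p y).2) := mul_nonneg t0 (by linarith)
    rcases eq_or_lt_of_le t0 with rfl | t0'
    · refine key c d hcd cv cy dv dy hq' (Or.inr ⟨by linarith, by linarith⟩)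
    rcases eq_or_lt_of_le t1 with rfl | t1'
    · refine key d c hcd.symm dv dy cv cy hsym (Or.inr ⟨by linarith, by linarith⟩)
    have c0 : (p c).1 * (p y).2 = (p y).1 * (p c).2 := by
      rcases mul_eq_zero.1 (show (1 - t) * ((p y).1 * (p c).2 - (p c).1 * (p y).2) = 0 by linarith) with h | h <;> linarith
    have d0 : (p d).1 * (p y).2 = (p y).1 * (p d).2 := by
      rcases mul_eq_zero.1 (show t * ((p y).1 * (p d).2 - (p d).1 * (p y).2) = 0 by linarith) with h | h <;> linarith
    rcases le_or_gt q.2 (p c).2 with h | h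
    · exact key c d hcd cv cy dv dy hq' (Or.inr ⟨c0, h⟩)
    · refine key d c hcd.symm dv dy cv cy hsym (Or.inr ⟨d0, ?_⟩)
      by_contra h'
      push Not at h'
      exact cvx_contra (c := -q.2) t0 t1 (neg_lt_neg h) (neg_lt_neg h') (by linarith)


lemma seg_closed (x y : ℝ × ℝ) : IsClosed (segment ℝ x y) := by
  rw [← convexHull_pair]; exact ((Set.toFinite {x, y}).isCompact_convexHull ℝ).isClosed

theorem claimB (hP : PlaneD E p) (hmax : ∀ u v, Free E p u v → E.Adj u v) (l1 l2 : ℝ) {z : W}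
    (hz : l1 * (p v).1 + l2 * (p v).2 < l1 * (p z).1 + l2 * (p z).2) :
    ∃ y, E.Adj v y ∧ l1 * (p v).1 + l2 * (p v).2 < l1 * (p y).1 + l2 * (p y).2 := by
  let g : ℝ → ℝ × ℝ := fun s => ((1 - s) * (p v).1 + s * (p z).1, (1 - s) * (p v).2 + s * (p z).2)
  have hg : Continuous g := by fun_prop
  let B : Set (W × W) := {c | c.1 ≠ v ∧ c.2 ≠ v ∧ (c.1 = c.2 ∨ E.Adj c.1 c.2)}
  let O : Set ℝ := Set.Icc 0 1 ∩ ⋃ c ∈ B, g ⁻¹' segment ℝ (p c.1) (p c.2)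
  have hzv : z ≠ v := by rintro rfl; exact lt_irrefl _ hz
  have hO : IsCompact O := isCompact_Icc.inter_right
    ((Set.toFinite B).isClosed_biUnion (fun c _ => (seg_closed _ _).preimage hg))
  have hmO : ∀ s, 0 ≤ s → s ≤ 1 → ∀ c d, c ≠ v → d ≠ v → (c = d ∨ E.Adj c d) → g s ∈ segment ℝ (p c) (p d) → s ∈ O :=
    fun s h0 h1 c d hc hd hcd hm => ⟨⟨h0, h1⟩, Set.mem_biUnion (show (c, d) ∈ B from ⟨hc, hd, hcd⟩) hm⟩
  have hne : O.Nonempty := ⟨1, hmO 1 zero_le_one le_rfl z z hzv hzv (Or.inl rfl) (by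
    rw [segment_same]; ext <;> simp [g])⟩
  obtain ⟨s0, hs0, hleast⟩ := hO.exists_isLeast hne
  obtain ⟨⟨h0, h1⟩, hs0⟩ := hs0
  obtain ⟨⟨a, b⟩, ⟨av, bv, hab⟩, hq⟩ := Set.mem_iUnion₂.1 hs0
  simp only at av bv hab hq
  change g s0 ∈ segment ℝ (p a) (p b) at hq
  have h0' : 0 < s0 := lt_of_le_of_ne h0 (by
    rintro rfl
    have e : g 0 = p v := by ext <;> simp [g]
    rw [e] at hq
    rcases hab with rfl | hab
    · rw [segment_same] at hq; exact av (hP.1 hq).symm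
    · exact not_on hP hab av bv hq rfl)
  have hlow : ∀ s, 0 ≤ s → s < s0 → ∀ c d, c ≠ v → d ≠ v → (c = d ∨ E.Adj c d) → g s ∉ segment ℝ (p c) (p d) :=
    fun s h0 h c d hc hd hcd hm => absurd (hleast (hmO s h0 (by linarith) c d hc hd hcd hm)) (by linarith)
  have hgs : ∀ μ, g (s0 * μ) = ((1 - μ) * (p v).1 + μ * (g s0).1, (1 - μ) * (p v).2 + μ * (g s0).2) := by
    intro μ; ext <;> simp only [g] <;> ring
  have hlq : l1 * (p v).1 + l2 * (p v).2 < l1 * (g s0).1 + l2 * (g s0).2 := by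
    simp only [g]; nlinarith [mul_pos h0' (sub_pos.2 hz)]
  by_cases hy : ∃ y, g s0 = p y
  · obtain ⟨y, hy⟩ := hy
    rw [hy] at hlq hgs
    have yv : y ≠ v := by rintro rfl; exact lt_irrefl _ hlq
    refine ⟨y, hmax v y ⟨yv.symm, ?_, ?_⟩, hlq⟩
    · intro x hx
      obtain ⟨t, t0, t1, ex, ey⟩ := mem_seg_iff.1 hx
      by_contra hc
      push Not at hc
      refine hlow (s0 * t) (by positivity) ?_ x x hc.1 hc.1 (Or.inl rfl) ?_
      · have : t ≠ 1 := by rintro rfl; exact hc.2 (hP.1 (by ext <;> simp [ex, ey]))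
        nlinarith [lt_of_le_of_ne t1 this]
      · rw [hgs, segment_same]; ext <;> simp [ex, ey]
    · intro c d hcd cv cy dv dy q hq hq'
      obtain ⟨t, t0, t1, ex, ey⟩ := mem_seg_iff.1 hq
      refine hlow (s0 * t) (by positivity) ?_ c d cv dv (Or.inr hcd) ?_
      · have : t ≠ 1 := by rintro rfl; exact not_on hP hcd cy dy hq' (by ext <;> simp [ex, ey])
        nlinarith [lt_of_le_of_ne t1 this]
      · rw [hgs, ← ex, ← ey]; exact hq'
  push Not at hy
  have hab : E.Adj a b := hab.resolve_left (by
    rintro rfl; rw [segment_same] at hq; exact hy a hq)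
  have main : ∀ a b, a ≠ v → b ≠ v → E.Adj a b → g s0 ∈ segment ℝ (p a) (p b) →
      l1 * (g s0).1 + l2 * (g s0).2 ≤ l1 * (p a).1 + l2 * (p a).2 →
      ∃ y, E.Adj v y ∧ l1 * (p v).1 + l2 * (p v).2 < l1 * (p y).1 + l2 * (p y).2 := by
    intro a b av bv hab hq hla
    by_cases hcr : cr (g s0 - p v) (p a - p v) = 0
    · exfalso
      simp only [cr, Prod.fst_sub, Prod.snd_sub] at hcr
      have hya := hy a
      have hyb := hy b
      have hgb : ∀ μ, (p b).1 = (1 - μ) * (p v).1 + μ * (g s0).1 → (p b).2 = (1 - μ) * (p v).2 + μ * (g s0).2 →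
          0 ≤ μ → μ < 1 → False := fun μ e1 e2 m0 m1 =>
        hlow (s0 * μ) (by positivity) (by nlinarith) b b bv bv (Or.inl rfl) (by
          rw [hgs, segment_same]; ext <;> simp [e1, e2])
      obtain ⟨t, t0, t1, ex, ey⟩ := mem_seg_iff.1 hq
      generalize g s0 = q at *
      obtain ⟨lam, hlam⟩ : ∃ lam, lam * (l1 * (q.1 - (p v).1) + l2 * (q.2 - (p v).2)) =
          l1 * ((p a).1 - (p v).1) + l2 * ((p a).2 - (p v).2) := ⟨_, div_mul_cancel₀ _ (by linarith)⟩
      have hL : 0 < l1 * (q.1 - (p v).1) + l2 * (q.2 - (p v).2) := by linarith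
      have A1 : (p a).1 - (p v).1 = lam * (q.1 - (p v).1) := by
        apply mul_left_cancel₀ hL.ne'; linear_combination -(q.1 - (p v).1) * hlam - l2 * hcr
      have A2 : (p a).2 - (p v).2 = lam * (q.2 - (p v).2) := by
        apply mul_left_cancel₀ hL.ne'; linear_combination -(q.2 - (p v).2) * hlam + l1 * hcr
      have l1' : 1 ≤ lam := by
        by_contra h; push Not at h
        nlinarith
      have ht0 : t ≠ 0 := by rintro rfl; exact hya (by ext <;> simp [ex, ey])
      have hl : 1 < lam := lt_of_le_of_ne l1' (by rintro rfl; exact hya (by ext <;> linarith))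
      have ht1 : t ≠ 1 := by rintro rfl; exact hyb (by ext <;> simp [ex, ey])
      have t0' := lt_of_le_of_ne t0 ht0.symm
      have t1' := lt_of_le_of_ne t1 ht1
      obtain ⟨μ, hμ⟩ : ∃ μ, t * μ = 1 - (1 - t) * lam := ⟨_, mul_div_cancel₀ _ ht0⟩
      have B1 : (p b).1 - (p v).1 = μ * (q.1 - (p v).1) := by
        apply mul_left_cancel₀ ht0; linear_combination -(q.1 - (p v).1) * hμ - (1 - t) * A1 - ex
      have B2 : (p b).2 - (p v).2 = μ * (q.2 - (p v).2) := by
        apply mul_left_cancel₀ ht0; linear_combination -(q.2 - (p v).2) * hμ - (1 - t) * A2 - ey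
      have m1 : μ < 1 := by
        by_contra h; push Not at h
        nlinarith [mul_pos (sub_pos.2 t1') (sub_pos.2 hl)]
      rcases le_or_gt 0 μ with m0 | m0
      · exact hgb μ (by linarith) (by linarith) m0 m1
      · have hd : 0 < lam - μ := by linarith
        have hτ : lam / (lam - μ) * (lam - μ) = lam := div_mul_cancel₀ _ hd.ne'
        refine not_on hP hab av bv (q := p v) (mem_seg_iff.2 ⟨lam / (lam - μ), by positivity,
          by rw [div_le_one hd]; linarith, ?_, ?_⟩) rfl
        · generalize lam / (lam - μ) = τ at *
          linear_combination -(1 - τ) * A1 - τ * B1 + (q.1 - (p v).1) * hτ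
        · generalize lam / (lam - μ) = τ at *
          linear_combination -(1 - τ) * A2 - τ * B2 + (q.2 - (p v).2) * hτ
    · obtain ⟨f, hf, f0, f1, f2, hfx⟩ := exists_coord hcr
      have hs1 : ∀ s : ℝ, f (g (s0 * s)) = (s, 0) := by
        intro s
        rw [hfx, hgs]
        ext
        · simp only; rw [div_eq_iff hcr]; simp only [cr, Prod.fst_sub, Prod.snd_sub]; ring
        · simp only; rw [div_eq_iff hcr]; simp only [cr, Prod.fst_sub, Prod.snd_sub]; ring
      obtain ⟨y, hvy, hy1, hy2⟩ := normB (p := fun x => f (p x)) (v := v) (a := a) (b := b) (hP.affine f hf)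
        (fun u v h => hmax u v (Free.of_aff hf h)) f0 f2 hab (by rw [← f1]; exact (aff_seg hf).2 hq)
        (fun x hx => by rw [← f1] at hx; exact hy x (hf hx).symm)
        (fun c d hcd cv dv s h0 h1 hm => by
          rw [← hs1, aff_seg hf] at hm
          exact hlow (s0 * s) (by positivity) (by nlinarith) c d cv dv (Or.inr hcd) hm)
        (fun x xv s h0 h1 hm => by
          rw [← hs1] at hm
          have hm := hf hm
          rcases eq_or_lt_of_le h1 with rfl | h1
          · rw [mul_one] at hm; exact hy x hm.symm
          · exact hlow (s0 * s) (by positivity) (by nlinarith) x x xv xv (Or.inl rfl) (by rw [segment_same]; exact hm.symm))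
      refine ⟨y, hvy, ?_⟩
      have hne : p y ≠ p v := fun e => hvy.ne (hP.1 e).symm
      have e1 : (f (p y)).1 * cr (g s0 - p v) (p a - p v) = cr (p y - p v) (p a - p v) := by
        rw [hfx]; exact div_mul_cancel₀ _ hcr
      have e2 : (f (p y)).2 * cr (g s0 - p v) (p a - p v) = cr (g s0 - p v) (p y - p v) := by
        rw [hfx]; exact div_mul_cancel₀ _ hcr
      generalize (f (p y)).1 = α at *
      generalize (f (p y)).2 = β at *
      simp only [cr, Prod.fst_sub, Prod.snd_sub] at hcr e1 e2
      have Y1 : (p y).1 - (p v).1 = α * ((g s0).1 - (p v).1) + β * ((p a).1 - (p v).1) := by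
        apply mul_left_cancel₀ hcr; linear_combination -((g s0).1 - (p v).1) * e1 - ((p a).1 - (p v).1) * e2
      have Y2 : (p y).2 - (p v).2 = α * ((g s0).2 - (p v).2) + β * ((p a).2 - (p v).2) := by
        apply mul_left_cancel₀ hcr; linear_combination -((g s0).2 - (p v).2) * e1 - ((p a).2 - (p v).2) * e2
      have hαβ : 0 < α ∨ 0 < β := by
        by_contra h
        push Not at h
        obtain rfl := le_antisymm h.1 hy1
        obtain rfl := le_antisymm h.2 hy2
        exact hne (by ext <;> linarith)
      have hsum : l1 * (p y).1 + l2 * (p y).2 - (l1 * (p v).1 + l2 * (p v).2) =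
          α * (l1 * (g s0).1 + l2 * (g s0).2 - (l1 * (p v).1 + l2 * (p v).2)) +
          β * (l1 * (p a).1 + l2 * (p a).2 - (l1 * (p v).1 + l2 * (p v).2)) := by
        linear_combination l1 * Y1 + l2 * Y2
      have hA := lt_of_lt_of_le hlq hla
      rcases hαβ with h | h
      · nlinarith [mul_pos h (sub_pos.2 hlq), mul_nonneg hy2 (sub_pos.2 hA).le]
      · nlinarith [mul_nonneg hy1 (sub_pos.2 hlq).le, mul_pos h (sub_pos.2 hA)]
  by_cases h : l1 * (g s0).1 + l2 * (g s0).2 ≤ l1 * (p a).1 + l2 * (p a).2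
  · exact main a b av bv hab hq h
  · refine main b a bv av hab.symm (by rwa [segment_symm]) ?_
    by_contra h'
    push Not at h h'
    obtain ⟨t, t0, t1, ex, ey⟩ := mem_seg_iff.1 hq
    exact cvx_contra t0 t1 (neg_lt_neg h) (neg_lt_neg h') (by rw [ex, ey]; ring)

end

end FP


namespace FP

noncomputable section

open Classical

variable {W : Type*} [Fintype W] {E : SimpleGraph W} {p : W → ℝ × ℝ}

def LeftOf (p : W → ℝ × ℝ) (f g : W) : Prop := ∀ x, x ≠ f → x ≠ g → 0 < cr (p g - p f) (p x - p f)

lemma LeftOf.free {f g : W} (h : LeftOf p f g) (hfg : f ≠ g) : Free E p f g := by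
  have z : ∀ q, q ∈ segment ℝ (p f) (p g) → cr (p g - p f) (q - p f) = 0 := by
    intro q hq
    obtain ⟨t, t0, t1, ex, ey⟩ := mem_seg_iff.1 hq
    simp only [cr, Prod.fst_sub, Prod.snd_sub, ex, ey]; ring
  refine ⟨hfg, ?_, ?_⟩
  · intro x hx
    by_contra hc
    push Not at hc
    exact (h x hc.1 hc.2).ne' (z _ hx)
  · intro a b hab af ag bf bg q hq hq'
    obtain ⟨t, t0, t1, ex, ey⟩ := mem_seg_iff.1 hq'
    have := z q hq
    refine cvx_contra t0 t1 (h a af ag) (h b bf bg) ?_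
    rw [← this]
    simp only [cr, Prod.fst_sub, Prod.snd_sub, ex, ey]; ring

lemma LeftOf.outer (hP : PlaneD E p) (hy : Function.Injective (fun v => (p v).2)) {f g h : W}
    (h1 : LeftOf p f g) (h2 : LeftOf p h f) (hfg : E.Adj f g) (hfh : E.Adj f h) (hgh : h ≠ g) : nxf E p f h = g := by
  refine nx_outer hP hy hfg hfh (h1 h hfh.ne' hgh) (fun z hz z1 z2 => ⟨h1 z hz.ne' z1, ?_⟩)
  have := h2 z z2 hz.ne'
  simp only [cr, Prod.fst_sub, Prod.snd_sub] at this ⊢; linarith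

theorem toCan (hP : PlaneD E p) (hy : Function.Injective (fun v => (p v).2)) (hmax : ∀ u v, Free E p u v → E.Adj u v)
    {f0 f1 t : W} (h01 : f0 ≠ f1) (h0t : f0 ≠ t) (h1t : f1 ≠ t)
    (S1 : LeftOf p f0 f1) (S2 : LeftOf p f1 t) (S3 : LeftOf p t f0) (hht : ∀ v, v ≠ t → (p v).2 < (p t).2) :
    ∃ n st H, IsCan E f0 f1 n st H := by
  have a01 := hmax _ _ (S1.free h01)
  have a1t := hmax _ _ (S2.free h1t)
  have at0 := hmax _ _ (S3.free h0t.symm)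
  have n0 := S1.outer hP hy S3 a01 at0.symm h1t.symm
  have n1 := S2.outer hP hy S1 a1t a01.symm h0t
  have nt := S3.outer hP hy S2 at0 a1t.symm h01.symm
  have hD : 0 < cr (p f1 - p f0) (p t - p f0) := S1 t h0t.symm h1t.symm
  have good : ∀ {v u}, E.Adj v u → (∃ z, 0 < cr (p u - p v) (p z - p v)) →
      E.Adj u (nxf E p v u) ∧ nxf E p u (nxf E p v u) = v := by
    rintro v u hvu ⟨z, hz⟩
    obtain ⟨y, hvy, hyl⟩ := claimB hP hmax (v := v) (z := z) (-(p u - p v).2) (p u - p v).1 (by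
      simp only [cr, Prod.fst_sub, Prod.snd_sub] at hz ⊢; linarith)
    obtain ⟨hw, hno⟩ := nx_wedge hP hy hvu hvy (by
      simp only [cr, Prod.fst_sub, Prod.snd_sub] at hyl ⊢; linarith)
    have hvw := (nxf_spec (p := p) hvu).1
    obtain ⟨huw, hno'⟩ := claimA hP hmax hvu hvw hw hno
    refine ⟨huw, nx_eq hP hy huw hvu.symm ?_ hno'⟩
    simp only [cr, Prod.fst_sub, Prod.snd_sub] at hw ⊢; linarith
  have intr : ∀ {v u} b, E.Adj v u → b ≠ f0 → b ≠ f1 → b ≠ t → ∃ z, 0 < cr (p u - p v) (p z - p b) := by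
    intro v u b hvu b0 b1 bt
    by_contra hc
    push Not at hc
    have l2 := S1 b b0 b1
    have l0 := S2 b b1 bt
    have l1 := S3 b bt b0
    have c0 := hc f0; have c1 := hc f1; have c2 := hc t
    have hid : cr (p t - p f1) (p b - p f1) * cr (p u - p v) (p f0 - p b) +
      cr (p f0 - p t) (p b - p t) * cr (p u - p v) (p f1 - p b) +
      cr (p f1 - p f0) (p b - p f0) * cr (p u - p v) (p t - p b) = 0 := by
      simp only [cr, Prod.fst_sub, Prod.snd_sub]; ring
    have m0 := mul_nonpos_of_nonneg_of_nonpos l0.le c0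
    have m1 := mul_nonpos_of_nonneg_of_nonpos l1.le c1
    have m2 := mul_nonpos_of_nonneg_of_nonpos l2.le c2
    have z0 := (mul_eq_zero.1 (show _ * _ = (0 : ℝ) from le_antisymm m0 (by linarith))).resolve_left l0.ne'
    have z1 := (mul_eq_zero.1 (show _ * _ = (0 : ℝ) from le_antisymm m1 (by linarith))).resolve_left l1.ne'
    have z2 := (mul_eq_zero.1 (show _ * _ = (0 : ℝ) from le_antisymm m2 (by linarith))).resolve_left l2.ne'
    have hd := d2 hy hvu
    refine mul_ne_zero hd hD.ne' ?_
    simp only [cr, Prod.fst_sub, Prod.snd_sub] at z0 z1 z2 ⊢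
    linear_combination ((p f1).2 - (p f0).2) * (z2 - z0) - ((p t).2 - (p f0).2) * (z1 - z0)
  have both : ∀ {v u}, E.Adj v u → E.Adj u (nxf E p v u) ∧ nxf E p u (nxf E p v u) = v := by
    intro v u hvu
    by_cases hz : ∃ z, 0 < cr (p u - p v) (p z - p v)
    · exact good hvu hz
    have hv : v = f0 ∨ v = f1 ∨ v = t := by
      by_contra hc; push Not at hc
      exact hz (intr v hvu hc.1 hc.2.1 hc.2.2)
    have hu : u = f0 ∨ u = f1 ∨ u = t := by
      by_contra hc; push Not at hc
      obtain ⟨z, h⟩ := intr u hvu hc.1 hc.2.1 hc.2.2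
      refine hz ⟨z, ?_⟩
      simp only [cr, Prod.fst_sub, Prod.snd_sub] at h ⊢; linarith
    rcases hv with rfl | rfl | rfl <;> rcases hu with rfl | rfl | rfl
    · exact absurd rfl hvu.ne
    · exact absurd ⟨t, hD⟩ hz
    · rw [n0, nt]; exact ⟨a1t.symm, rfl⟩
    · rw [n1, n0]; exact ⟨at0.symm, rfl⟩
    · exact absurd rfl hvu.ne
    · exact absurd ⟨f0, S2 f0 h01 h0t⟩ hz
    · exact absurd ⟨f1, S3 f1 h1t h01.symm⟩ hz
    · rw [nt, n1]; exact ⟨a01.symm, rfl⟩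
    · exact absurd rfl hvu.ne
  have R : Rot E (nxf E p) (tht p) (fun v => (p v).2) :=
    { adj := fun h => (nxf_spec h).1
      adj' := fun h => (both h).1
      tri := fun h => (both h).2
      inj := fun h h' e => tht_inj hP hy h h' e
      succ := fun h h' e => (nxf_spec h).2.1 _ h' e
      wrap := fun h => (nxf_spec h).2.2
      low := fun {v u} h => by
        have := pa_neg (d2 hy h)
        simp only [Prod.snd_sub, sub_neg] at this
        exact this
      hinj := hy }
  refine R.isCan a01 at0.symm a1t n0 nt n1 (fun v hv => ?_)
  obtain ⟨y, h1, h2⟩ := claimB hP hmax (v := v) (z := t) 0 1 (by linarith [hht v hv])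
  exact ⟨y, h1, by linarith⟩

lemma Free.add {u v : W} (hP : PlaneD E p) (h : Free E p u v) : PlaneD (E ⊔ SimpleGraph.edge u v) p := by
  have hadj : ∀ {a b}, (E ⊔ SimpleGraph.edge u v).Adj a b → E.Adj a b ∨ (a = u ∧ b = v) ∨ (a = v ∧ b = u) := by
    intro a b hab
    rw [SimpleGraph.sup_adj, SimpleGraph.edge_adj] at hab
    tauto
  refine ⟨hP.1, ?_, ?_⟩
  · intro a b w hab hw
    rcases hadj hab with hab | ⟨rfl, rfl⟩ | ⟨rfl, rfl⟩
    · exact hP.2.1 a b w hab hw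
    · exact h.2.1 w hw
    · exact (h.2.1 w (by rwa [segment_symm])).symm
  · intro a b c d hab hcd ac ad bc bd q hq hq'
    rcases hadj hab with hab' | ⟨rfl, rfl⟩ | ⟨rfl, rfl⟩ <;> rcases hadj hcd with hcd' | ⟨rfl, rfl⟩ | ⟨rfl, rfl⟩
    · exact hP.2.2 a b c d hab' hcd' ac ad bc bd q hq hq'
    · exact h.2.2 a b hab' ac ad bc bd q hq' hq
    · exact h.2.2 a b hab' ad ac bd bc q (by rwa [segment_symm]) hq
    · exact h.2.2 c d hcd' ac.symm bc.symm ad.symm bd.symm q hq hq'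
    · exact ac rfl
    · exact ad rfl
    · exact h.2.2 c d hcd' bc.symm ac.symm bd.symm ad.symm q (by rwa [segment_symm]) hq'
    · exact ad rfl
    · exact ac rfl

lemma exists_max (hP : PlaneD E p) : ∃ E', E ≤ E' ∧ PlaneD E' p ∧ ∀ u v, Free E' p u v → E'.Adj u v := by
  obtain ⟨M, hM, hmax⟩ := Set.Finite.exists_le_maximal (Set.toFinite {F : SimpleGraph W | PlaneD F p}) hP
  refine ⟨M, hM, hmax.1, fun u v h => ?_⟩
  have := hmax.2 (h.add hmax.1) le_sup_left
  exact this (by rw [SimpleGraph.sup_adj, SimpleGraph.edge_adj]; exact Or.inr ⟨Or.inl ⟨rfl, rfl⟩, h.1⟩)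

lemma exists_shear {V : Type*} [Finite V] {δ : V → ℝ × ℝ} (h : Function.Injective δ) :
    ∃ c : ℝ, Function.Injective (fun v => (δ v).2 + c * (δ v).1) := by
  obtain ⟨c, hc⟩ := (Set.finite_range (fun x : V × V => -((δ x.1).2 - (δ x.2).2) / ((δ x.1).1 - (δ x.2).1))).infinite_compl.nonempty
  refine ⟨c, fun u v e => h ?_⟩
  simp only at e
  by_cases hx : (δ u).1 = (δ v).1
  · rw [hx] at e; ext
    · exact hx
    · linarith
  · exact absurd ⟨(u, v), by rw [div_eq_iff (sub_ne_zero.2 hx)]; linear_combination -e⟩ hc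

lemma exists_aff (a b c d e f : ℝ) (h : a * d - b * c ≠ 0) : ∃ F : (ℝ × ℝ) →ᵃ[ℝ] (ℝ × ℝ), Function.Injective F ∧
    ∀ x, F x = (a * x.1 + b * x.2 + e, c * x.1 + d * x.2 + f) := by
  let L : (ℝ × ℝ) →ₗ[ℝ] (ℝ × ℝ) :=
    { toFun := fun x => (a * x.1 + b * x.2, c * x.1 + d * x.2)
      map_add' := fun x y => by ext <;> simp <;> ring
      map_smul' := fun x y => by ext <;> simp <;> ring }
  let F : (ℝ × ℝ) →ᵃ[ℝ] (ℝ × ℝ) :=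
    { toFun := fun x => (a * x.1 + b * x.2 + e, c * x.1 + d * x.2 + f)
      linear := L
      map_vadd' := fun x y => by ext <;> simp [L] <;> ring }
  have hF : ∀ x, F x = (a * x.1 + b * x.2 + e, c * x.1 + d * x.2 + f) := fun x => rfl
  refine ⟨F, fun x y hxy => ?_, hF⟩
  rw [hF, hF, Prod.mk.injEq] at hxy
  obtain ⟨h1, h2⟩ := hxy
  ext
  · apply mul_left_cancel₀ h; linear_combination d * h1 - b * h2
  · apply mul_left_cancel₀ h; linear_combination a * h2 - c * h1

theorem exists_can {V : Type*} [Fintype V] {G : SimpleGraph V} {δ : V → ℝ × ℝ} (hG : PlaneD G δ) :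
    ∃ (E : SimpleGraph (V ⊕ Fin 3)) (f0 f1 : V ⊕ Fin 3) (n : ℕ) (st : ℕ → Step (V ⊕ Fin 3)) (H : ℕ → List (V ⊕ Fin 3)),
      (∀ u v, G.Adj u v → E.Adj (Sum.inl u) (Sum.inl v)) ∧ IsCan E f0 f1 n st H := by
  obtain ⟨c, hc⟩ := exists_shear hG.1
  obtain ⟨M, hM0, hM⟩ : ∃ M : ℝ, 0 < M ∧ ∀ v, |(δ v).1| + |(δ v).2 + c * (δ v).1| < M := by
    obtain ⟨M, hM⟩ := (Set.finite_range (fun v => |(δ v).1| + |(δ v).2 + c * (δ v).1|)).bddAbove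
    exact ⟨max M 0 + 1, by positivity, fun v => by linarith [hM ⟨v, rfl⟩, le_max_left M 0]⟩
  obtain ⟨F, hF, hFx⟩ := exists_aff (1 / M) 0 (c / M) (1 / M) 0 0 (by rw [zero_mul, sub_zero]; positivity)
  have he := hG.affine F hF
  have hFx' : ∀ x, F x = (x.1 / M, (x.2 + c * x.1) / M) := by
    intro x; rw [hFx]; ext <;> simp only <;> ring
  generalize hee : (fun v => F (δ v)) = e1 at he
  have he1 : ∀ v, e1 v = ((δ v).1 / M, ((δ v).2 + c * (δ v).1) / M) := fun v => by rw [← hee]; exact hFx' _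
  have hb : ∀ v, |(e1 v).1| < 1 ∧ |(e1 v).2| < 1 := by
    intro v
    simp only [he1, abs_div, abs_of_pos hM0]
    rw [div_lt_one hM0, div_lt_one hM0]
    constructor <;> linarith [hM v, abs_nonneg (δ v).1, abs_nonneg ((δ v).2 + c * (δ v).1)]
  simp only [abs_lt] at hb
  have hyi : Function.Injective (fun v => (e1 v).2) := by
    intro u v h
    simp only [he1] at h
    exact hc ((div_left_inj' hM0.ne').1 h)
  let p : V ⊕ Fin 3 → ℝ × ℝ := Sum.elim e1 ![(-10, -9), (10, -10), (0, 10)]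
  have hpl : ∀ v, p (Sum.inl v) = e1 v := fun v => rfl
  have p0 : p (Sum.inr 0) = (-10, -9) := rfl
  have p1 : p (Sum.inr 1) = (10, -10) := rfl
  have p2 : p (Sum.inr 2) = (0, 10) := rfl
  have hall : ∀ P : V ⊕ Fin 3 → Prop, (∀ v, P (Sum.inl v)) → P (Sum.inr 0) → P (Sum.inr 1) → P (Sum.inr 2) → ∀ x, P x := by
    rintro P h h0 h1 h2 (v | i)
    · exact h v
    · fin_cases i
      · exact h0
      · exact h1
      · exact h2
  have hy : Function.Injective (fun v => (p v).2) := by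
    refine hall _ (fun v => ?_) ?_ ?_ ?_ <;> refine hall _ (fun w => ?_) ?_ ?_ ?_ <;> intro h <;>
      simp only [hpl, p0, p1, p2] at h
    · rw [hyi h]
    all_goals first | rfl | (exfalso; first | linarith [(hb v).2.1, (hb v).2.2] | linarith [(hb w).2.1, (hb w).2.2] | norm_num at h)
  have hp : PlaneD (G.map Function.Embedding.inl) p := by
    refine ⟨fun x y h => hy (by simp only [h]), ?_, ?_⟩
    · intro a b w hab hw
      obtain ⟨u, v, huv, rfl, rfl⟩ := (SimpleGraph.map_adj _ _ _ _).1 hab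
      simp only [Function.Embedding.inl_apply, hpl] at hw ⊢
      rcases w with w | i
      · rcases he.2.1 u v w huv hw with rfl | rfl
        · exact Or.inl rfl
        · exact Or.inr rfl
      · exfalso
        obtain ⟨t, t0, t1, -, ey⟩ := mem_seg_iff.1 hw
        have h1 : (p (Sum.inr i)).2 ≤ 1 := by
          nlinarith [mul_nonneg t0 (sub_pos.2 (hb v).2.2).le, mul_nonneg (sub_nonneg.2 t1) (sub_pos.2 (hb u).2.2).le]
        have h2 : -1 ≤ (p (Sum.inr i)).2 := by
          nlinarith [mul_nonneg t0 (sub_pos.2 (hb v).2.1).le, mul_nonneg (sub_nonneg.2 t1) (sub_pos.2 (hb u).2.1).le]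
        fin_cases i
        · have := p0; simp_all; linarith
        · have := p1; simp_all; linarith
        · have := p2; simp_all; linarith
    · intro a b c d hab hcd ac ad bc bd q hq hq'
      obtain ⟨u, v, huv, rfl, rfl⟩ := (SimpleGraph.map_adj _ _ _ _).1 hab
      obtain ⟨x, y, hxy, rfl, rfl⟩ := (SimpleGraph.map_adj _ _ _ _).1 hcd
      refine he.2.2 u v x y huv hxy ?_ ?_ ?_ ?_ q hq hq'
      all_goals (rintro rfl; first | exact ac rfl | exact ad rfl | exact bc rfl | exact bd rfl)
  obtain ⟨E, hGE, hE, hmax⟩ := exists_max hp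
  obtain ⟨n, st, H, h⟩ := toCan (f0 := Sum.inr 0) (f1 := Sum.inr 1) (t := Sum.inr 2) hE hy hmax (by simp) (by simp) (by simp)
    (hall _ (fun v _ _ => by simp only [cr, Prod.fst_sub, Prod.snd_sub, hpl, p0, p1]; linarith [hb v, (hb v).1.1, (hb v).1.2, (hb v).2.1, (hb v).2.2])
      (fun h => absurd rfl h) (fun _ h => absurd rfl h) (fun _ _ => by simp only [cr, Prod.fst_sub, Prod.snd_sub, p0, p1, p2]; norm_num))
    (hall _ (fun v _ _ => by simp only [cr, Prod.fst_sub, Prod.snd_sub, hpl, p1, p2]; linarith [hb v, (hb v).1.1, (hb v).1.2, (hb v).2.1, (hb v).2.2])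
      (fun _ _ => by simp only [cr, Prod.fst_sub, Prod.snd_sub, p0, p1, p2]; norm_num) (fun h => absurd rfl h) (fun _ h => absurd rfl h))
    (hall _ (fun v _ _ => by simp only [cr, Prod.fst_sub, Prod.snd_sub, hpl, p0, p2]; linarith [hb v, (hb v).1.1, (hb v).1.2, (hb v).2.1, (hb v).2.2])
      (fun _ h => absurd rfl h) (fun _ _ => by simp only [cr, Prod.fst_sub, Prod.snd_sub, p0, p1, p2]; norm_num) (fun h => absurd rfl h))
    (hall _ (fun v _ => by simp only [hpl, p2]; linarith [(hb v).2.2]) (fun _ => by simp only [p0, p2]; norm_num)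
      (fun _ => by simp only [p1, p2]; norm_num) (fun h => absurd rfl h))
  exact ⟨E, _, _, n, st, H, fun u v huv => hGE ((SimpleGraph.map_adj _ _ _ _).2 ⟨u, v, huv, rfl, rfl⟩), h⟩

end

end FP


namespace FP

noncomputable section

open Classical

lemma incf {V : Type*} (S : Finset V) (f g : V → ℝ) : ∃ c : V → ℕ,
    (∀ v ∈ S, 1 ≤ c v ∧ ∃ T ⊆ S, T.card = c v ∧ ∀ a ∈ T, ∀ b ∈ T, f a < f b → g a < g b) ∧
    ∀ u ∈ S, ∀ v ∈ S, f u < f v → g u < g v → c u < c v := by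
  let F : V → Finset (Finset V) := fun v => S.powerset.filter (fun T => v ∈ T ∧ (∀ a ∈ T, ∀ b ∈ T, f a < f b → g a < g b) ∧
    ∀ a ∈ T, a ≠ v → f a < f v ∧ g a < g v)
  have hF : ∀ v ∈ S, ∃ T ∈ F v, T.card = (F v).sup Finset.card := by
    intro v hv
    obtain ⟨T, hT, e⟩ := Finset.exists_mem_eq_sup (F v) ⟨{v}, by simp [F, hv]⟩ Finset.card
    exact ⟨T, hT, e.symm⟩
  refine ⟨fun v => (F v).sup Finset.card, ?_, ?_⟩
  · intro v hv
    obtain ⟨T, hT, e⟩ := hF v hv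
    have hT' := Finset.mem_filter.1 hT
    exact ⟨by simp only; rw [← e]; exact Finset.card_pos.2 ⟨v, hT'.2.1⟩, T, Finset.mem_powerset.1 hT'.1, e, hT'.2.2.1⟩
  · intro u hu v hv hf hg
    obtain ⟨T, hT, e⟩ := hF u hu
    obtain ⟨hTS, huT, hm, hl⟩ := Finset.mem_filter.1 hT
    have hl' : ∀ a ∈ T, f a < f v ∧ g a < g v := by
      intro a ha
      by_cases h : a = u
      · subst h; exact ⟨hf, hg⟩
      · exact ⟨(hl a ha h).1.trans hf, (hl a ha h).2.trans hg⟩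
    have hvT : v ∉ T := fun h => lt_irrefl _ (hl' v h).1
    have hin : insert v T ∈ F v := by
      refine Finset.mem_filter.2 ⟨Finset.mem_powerset.2 (Finset.insert_subset hv (Finset.mem_powerset.1 hTS)),
        Finset.mem_insert_self _ _, ?_, ?_⟩
      · intro a ha b hb hab
        rcases Finset.mem_insert.1 ha with rfl | ha' <;> rcases Finset.mem_insert.1 hb with rfl | hb'
        · exact absurd hab (lt_irrefl _)
        · exact absurd (hl' b hb').1 hab.not_gt
        · exact (hl' a ha').2
        · exact hm a ha' b hb' hab
      · intro a ha hav
        exact hl' a ((Finset.mem_insert.1 ha).resolve_left hav)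
    have := Finset.le_sup (f := Finset.card) hin
    rw [Finset.card_insert_of_notMem hvT] at this
    simp only
    omega

lemma erdos {V : Type*} (S : Finset V) (f g : V → ℝ) (hf : ∀ a ∈ S, ∀ b ∈ S, f a = f b → a = b)
    (hg : Function.Injective g) : ∃ T ⊆ S, S.card ≤ T.card ^ 2 ∧
      ((∀ a ∈ T, ∀ b ∈ T, f a < f b → g a < g b) ∨ (∀ a ∈ T, ∀ b ∈ T, f a < f b → -g a < -g b)) := by
  obtain ⟨c, hc1, hc2⟩ := incf S f g
  obtain ⟨d, hd1, hd2⟩ := incf S f (fun v => -g v)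
  by_contra hcon
  push Not at hcon
  have hb : ∀ T ⊆ S, ((∀ a ∈ T, ∀ b ∈ T, f a < f b → g a < g b) ∨ (∀ a ∈ T, ∀ b ∈ T, f a < f b → -g a < -g b)) →
      T.card ≤ Nat.sqrt (S.card - 1) := by
    intro T hT h
    by_contra hn
    have : S.card ≤ T.card ^ 2 := by
      by_contra h'
      apply hn
      rw [Nat.le_sqrt']
      omega
    obtain ⟨⟨a, ha, b, hb, h1, h2⟩, ⟨a', ha', b', hb', h1', h2'⟩⟩ := hcon T hT this
    rcases h with h | h
    · exact absurd (h a ha b hb h1) h2.not_gt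
    · exact absurd (h a' ha' b' hb' h1') h2'.not_gt
  have hS : S.Nonempty := by
    by_contra h
    rw [Finset.not_nonempty_iff_eq_empty] at h
    subst h
    obtain ⟨⟨a, ha, -⟩, -⟩ := hcon ∅ (Finset.Subset.refl _) (by simp)
    simp at ha
  have key : ∀ u ∈ S, ∀ v ∈ S, f u < f v → (c u, d u) ≠ (c v, d v) := by
    intro u hu v hv huv e
    rw [Prod.mk.injEq] at e
    rcases lt_trichotomy (g u) (g v) with h | h | h
    · exact (hc2 u hu v hv huv h).ne e.1
    · rw [hg h] at huv; exact lt_irrefl _ huv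
    · exact (hd2 u hu v hv huv (neg_lt_neg h)).ne e.2
  have := Finset.card_le_card_of_injOn (s := S)
    (t := Finset.Icc 1 (Nat.sqrt (S.card - 1)) ×ˢ Finset.Icc 1 (Nat.sqrt (S.card - 1))) (fun v => (c v, d v))
    (fun v hv => by
      obtain ⟨h1, T, hT, e, hm⟩ := hc1 v hv
      obtain ⟨h1', T', hT', e', hm'⟩ := hd1 v hv
      simp only [Finset.coe_product, Set.mem_prod, Finset.mem_coe, Finset.mem_Icc]
      exact ⟨⟨h1, e ▸ hb T hT (Or.inl hm)⟩, ⟨h1', e' ▸ hb T' hT' (Or.inr hm')⟩⟩)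
    (fun u hu v hv e => by
      rcases lt_trichotomy (f u) (f v) with h | h | h
      · exact absurd e (key u hu v hv h)
      · exact hf u hu v hv h
      · exact absurd e.symm (key v hv u hu h))
  rw [Finset.card_product, Nat.card_Icc] at this
  have h2 := Nat.sqrt_le (S.card - 1)
  have := hS.card_pos
  simp only [Nat.add_sub_cancel] at *
  omega

section flex

variable {W : Type*} [Fintype W] {E : SimpleGraph W} {f0 f1 : W} {n : ℕ} {st : ℕ → Step W} {H : ℕ → List W}

def Flex (E : SimpleGraph W) (S : Finset W) (key : W → ℝ) : Prop :=
  (∀ a ∈ S, ∀ b ∈ S, key a = key b → a = b) ∧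
  ∀ T ⊆ S, ∀ q : W → ℝ × ℝ, (∀ a ∈ T, ∀ b ∈ T, key a < key b → (q a).1 < (q b).1) →
    ∃ δ, PlaneD E δ ∧ ∀ v ∈ T, δ v = q v

lemma path_idx (hc : IsCan E f0 f1 n st H) {N : ℕ} {y : ℕ → W} {σ : ℕ → ℕ} (hp : IsPath f0 f1 n st N y σ) :
    ∃ idx : W → ℝ, ∀ i < N, idx (y (i + 1)) = (i + 1 : ℕ) := by
  have hne : ∀ i j, i < j → j < N → y (i + 1) ≠ y (j + 1) := by
    intro i j hij hj e
    rw [hp.yw i (by omega), hp.yw j hj] at e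
    exact hc.wnew _ (hp.lt j hj) (Or.inr (Or.inr ⟨σ i, hp.smono hc hij hj, e.symm⟩))
  refine ⟨fun v => if h : ∃ i, i < N ∧ y (i + 1) = v then (h.choose + 1 : ℕ) else 0, fun i hi => ?_⟩
  have h : ∃ i', i' < N ∧ y (i' + 1) = y (i + 1) := ⟨i, hi, rfl⟩
  simp only [dif_pos h]
  have hs := h.choose_spec
  rcases lt_trichotomy h.choose i with h' | h' | h'
  · exact absurd hs.2 (hne _ _ h' hi)
  · rw [h']
  · exact absurd hs.2.symm (hne _ _ h' hs.1)

lemma flex_path {I : Finset ℕ} {N : ℕ} {y : ℕ → W} {idx : W → ℝ} (hI : ∀ i ∈ I, i < N)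
    (hidx : ∀ i < N, idx (y (i + 1)) = (i + 1 : ℕ))
    (hd : ∀ (g : ℝ → ℝ), StrictMono g → ∀ s : ℕ → ℝ, ∃ δ, PlaneD E δ ∧ ∀ i ∈ I, δ (y (i + 1)) = (g (i + 1 : ℕ), s i)) :
    ∃ S : Finset W, I.card ≤ S.card ∧ ∃ key, Flex E S key := by
  have hinj : ∀ i ∈ I, ∀ j ∈ I, idx (y (i + 1)) = idx (y (j + 1)) → i = j := by
    intro i hi j hj e
    rw [hidx i (hI i hi), hidx j (hI j hj)] at e
    have := Nat.cast_injective e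
    omega
  refine ⟨I.image (fun i => y (i + 1)), ?_, idx, ?_, ?_⟩
  · rw [Finset.card_image_of_injOn]
    intro i hi j hj e
    exact hinj i hi j hj (congrArg idx e)
  · intro a ha b hb e
    obtain ⟨i, hi, rfl⟩ := Finset.mem_image.1 ha
    obtain ⟨j, hj, rfl⟩ := Finset.mem_image.1 hb
    rw [hinj i hi j hj e]
  · intro T hT q hq
    obtain ⟨g, hg, hgv⟩ := ext_mono T idx (fun v => (q v).1) (by
      intro a ha b hb e
      obtain ⟨i, hi, rfl⟩ := Finset.mem_image.1 (hT ha)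
      obtain ⟨j, hj, rfl⟩ := Finset.mem_image.1 (hT hb)
      rw [hinj i hi j hj e]) hq
    obtain ⟨δ, h1, h2⟩ := hd g hg (fun i => (q (y (i + 1))).2)
    refine ⟨δ, h1, fun v hv => ?_⟩
    obtain ⟨i, hi, rfl⟩ := Finset.mem_image.1 (hT hv)
    have := hgv _ hv
    rw [hidx i (hI i hi)] at this
    rw [h2 i hi, this]

lemma flex_left (hc : IsCan E f0 f1 n st H) {N : ℕ} {y : ℕ → W} {σ : ℕ → ℕ}
    (hp : IsPath f0 f1 n st N y σ) (hy : y 0 ≠ f1) (hl : ∀ j < N, y j = (st (σ j)).l) :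
    ∃ S : Finset W, N ≤ S.card ∧ ∃ key, Flex E S key := by
  obtain ⟨idx, hidx⟩ := path_idx hc hp
  have := flex_path (E := E) (I := Finset.range N) (y := y) (fun i hi => Finset.mem_range.1 hi) hidx (fun g hg s => by
    obtain ⟨δ, h1, h2⟩ := drawC hc hp hy hl (fun i => (g (i + 1 : ℕ), s i)) (fun i i' h _ => hg (by simpa using h))
    exact ⟨δ, h1, fun i hi => h2 i (Finset.mem_range.1 hi)⟩)
  rwa [Finset.card_range] at this

theorem exists_flex (hc : IsCan E f0 f1 n st H) (K : ℕ) (hK : K * (2 * K + 1) * K ≤ Fintype.card W) (hK0 : 0 < K) :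
    ∃ S : Finset W, K ≤ S.card + 1 ∧ ∃ key, Flex E S key := by
  rcases tricho hc K with ⟨Ψ, hΨ, hΨb⟩ | ⟨N, y, σ, hp, hN⟩ | ⟨N, y, σ, hp, hN, hy, hl⟩ | ⟨N, y, σ, hp, hN, hy, hr⟩
  · obtain ⟨ξ, hξ⟩ := xi_exists hc
    obtain ⟨m, -, hm⟩ := Finset.exists_le_card_fiber_of_mul_le_card_of_maps_to (s := (Finset.univ : Finset W))
      (t := Finset.range (K * (2 * K + 1))) (f := Ψ) (n := K) (fun x _ => Finset.mem_range.2 (hΨb x))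
      ⟨0, Finset.mem_range.2 (by positivity)⟩ (by rw [Finset.card_range, Finset.card_univ]; exact hK)
    refine ⟨_, hm.trans (Nat.le_succ _), ξ, fun a _ b _ e => hξ.inj a b (hc.all a) (hc.all b) e, ?_⟩
    intro T hT q hq
    obtain ⟨δ, c0, h1, h2⟩ := drawA hc hξ hΨ T m (fun v hv => (Finset.mem_filter.1 (hT hv)).2) q hq
    obtain ⟨F, hF, hFx⟩ := exists_aff 1 0 0 1 0 (-c0) (by norm_num)
    refine ⟨_, h1.affine F hF, fun v hv => ?_⟩
    simp only [hFx, h2 v hv]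
    ext <;> simp
  · obtain ⟨idx, hidx⟩ := path_idx hc hp
    have := flex_path (E := E) (I := (Finset.range N).filter (fun i => i + 1 ∈ midSet st N y σ)) (y := y)
      (fun i hi => Finset.mem_range.1 (Finset.mem_filter.1 hi).1) hidx (fun g hg s => by
        obtain ⟨δ, h1, h2⟩ := drawB hc hp (fun j => g j) s (hg.comp Nat.strictMono_cast)
        obtain ⟨F, hF, hFx⟩ := exists_aff 0 1 1 0 0 0 (by norm_num)
        refine ⟨_, h1.affine F hF, fun i hi => ?_⟩
        obtain ⟨ha, hb⟩ := Finset.mem_filter.1 (Finset.mem_filter.1 hi).2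
        simp only [hFx, h2 i (Finset.mem_range.1 ha) hb]
        ext <;> simp)
    obtain ⟨S, hS, hk⟩ := this
    refine ⟨S, ?_, hk⟩
    have : midSet st N y σ ⊆ insert 0 (((Finset.range N).filter (fun i => i + 1 ∈ midSet st N y σ)).image (· + 1)) := by
      intro j hj
      rcases j with - | j
      · simp
      · refine Finset.mem_insert_of_mem (Finset.mem_image.2 ⟨j, Finset.mem_filter.2 ⟨?_, hj⟩, rfl⟩)
        have := Finset.mem_range.1 (Finset.mem_filter.1 hj).1
        exact Finset.mem_range.2 (by omega)
    have h1 := Finset.card_le_card this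
    have h2 := Finset.card_insert_le 0 (((Finset.range N).filter (fun i => i + 1 ∈ midSet st N y σ)).image (· + 1))
    have h3 := Finset.card_image_le (s := (Finset.range N).filter (fun i => i + 1 ∈ midSet st N y σ)) (f := (· + 1))
    omega
  · obtain ⟨S, hS, hk⟩ := flex_left hc hp hy hl
    exact ⟨S, by omega, hk⟩
  · obtain ⟨S, hS, hk⟩ := flex_left hc.mirror (N := N) (y := y) (σ := σ) ⟨hp.y0.symm, hp.lt, hp.yw, fun j hj => by
      have := hp.mem j hj
      simp only [Step.B, List.mem_cons, List.mem_append, List.mem_reverse, List.not_mem_nil] at this ⊢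
      tauto⟩ hy hr
    exact ⟨S, by omega, hk⟩

end flex

end

end FP


namespace FP

noncomputable section

open Classical

theorem main_big {V : Type*} [Fintype V] {G : SimpleGraph V} {δ0 δ : V → ℝ × ℝ} (h0 : PlaneD G δ0)
    (hδ : Function.Injective δ) (k : ℕ) (hk : (k + 4) * (2 * (k + 4) + 1) * (k + 4) ≤ Fintype.card V) :
    ∃ δ', PlaneD G δ' ∧ ∃ T : Finset V, k ≤ T.card ^ 2 ∧ ∀ v ∈ T, δ' v = δ v := by
  obtain ⟨E, f0, f1, n, st, H, hom, hc⟩ := exists_can h0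
  obtain ⟨S, hS, key, hki, hflex⟩ := exists_flex hc (k + 4)
    (by rw [Fintype.card_sum]; omega) (by omega)
  obtain ⟨S', hS'⟩ : ∃ S' : Finset V, S' = Finset.univ.filter (fun v => (Sum.inl v : V ⊕ Fin 3) ∈ S) := ⟨_, rfl⟩
  have hmem : ∀ v, v ∈ S' ↔ (Sum.inl v : V ⊕ Fin 3) ∈ S := by intro v; simp [hS']
  have hcard : k ≤ S'.card := by
    have h1 : S ⊆ S'.image Sum.inl ∪ (Finset.univ : Finset (Fin 3)).image Sum.inr := by
      intro x hx
      rcases x with v | i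
      · exact Finset.mem_union_left _ (Finset.mem_image_of_mem _ ((hmem v).2 hx))
      · exact Finset.mem_union_right _ (Finset.mem_image_of_mem _ (Finset.mem_univ _))
    have h2 := (Finset.card_le_card h1).trans (Finset.card_union_le _ _)
    have h3 : (S'.image (Sum.inl : V → V ⊕ Fin 3)).card ≤ S'.card := Finset.card_image_le
    have h4 : ((Finset.univ : Finset (Fin 3)).image (Sum.inr : Fin 3 → V ⊕ Fin 3)).card ≤ 3 := Finset.card_image_le
    omega
  obtain ⟨c, hcs⟩ := exists_shear hδ
  obtain ⟨T, hT, hTc, hTm⟩ := erdos S' (fun v => key (Sum.inl v)) (fun v => (δ v).2 + c * (δ v).1)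
    (fun a ha b hb h => Sum.inl_injective (hki _ ((hmem a).1 ha) _ ((hmem b).1 hb) h)) hcs
  obtain ⟨ε, hε, hm⟩ : ∃ ε : ℝ, ε * ε = 1 ∧ ∀ a ∈ T, ∀ b ∈ T, key (Sum.inl a) < key (Sum.inl b) →
      ε * ((δ a).2 + c * (δ a).1) < ε * ((δ b).2 + c * (δ b).1) := by
    rcases hTm with h | h
    · exact ⟨1, by norm_num, fun a ha b hb hab => by simpa using h a ha b hb hab⟩
    · exact ⟨-1, by norm_num, fun a ha b hb hab => by
        have := h a ha b hb hab
        rw [neg_one_mul, neg_one_mul]; exact this⟩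
  obtain ⟨δW, hW, hWq⟩ := hflex (T.image Sum.inl)
    (by
      intro x hx
      obtain ⟨v, hv, rfl⟩ := Finset.mem_image.1 hx
      exact (hmem v).1 (hT hv))
    (Sum.elim (fun v => (ε * ((δ v).2 + c * (δ v).1), (δ v).1)) (fun _ => 0))
    (by
      intro a ha b hb hab
      obtain ⟨v, hv, rfl⟩ := Finset.mem_image.1 ha
      obtain ⟨w, hw, rfl⟩ := Finset.mem_image.1 hb
      exact hm v hv w hw hab)
  obtain ⟨F, hF, hFe⟩ := exists_aff 0 1 ε (-c) 0 0 (by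
    intro h
    have : ε = 0 := by linarith
    rw [this] at hε; norm_num at hε)
  have hP := hW.affine F hF
  obtain ⟨p1, p2, p3⟩ := hP
  refine ⟨fun v => F (δW (Sum.inl v)), ⟨p1.comp Sum.inl_injective, ?_, ?_⟩, T, hcard.trans hTc, ?_⟩
  · intro u v w huv hw
    rcases p2 _ _ (Sum.inl w) (hom u v huv) hw with h | h
    · exact Or.inl (Sum.inl_injective h)
    · exact Or.inr (Sum.inl_injective h)
  · intro u v a b huv hab h1 h2 h3 h4 p hp hq
    exact p3 _ _ _ _ (hom u v huv) (hom a b hab) (fun h => h1 (Sum.inl_injective h))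
      (fun h => h2 (Sum.inl_injective h)) (fun h => h3 (Sum.inl_injective h))
      (fun h => h4 (Sum.inl_injective h)) p hp hq
  · intro v hv
    show F (δW (Sum.inl v)) = δ v
    rw [hWq _ (Finset.mem_image_of_mem _ hv), hFe]
    simp only [Sum.elim_inl]
    ext
    · simp
    · simp only
      linear_combination ((δ v).2 + c * (δ v).1) * hε

theorem two {V : Type*} {G : SimpleGraph V} {δ0 δ : V → ℝ × ℝ} (h0 : PlaneD G δ0)
    (hδ : Function.Injective δ) {u v : V} (huv : u ≠ v) :
    ∃ δ', PlaneD G δ' ∧ δ' u = δ u ∧ δ' v = δ v := by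
  have n1 : δ0 u ≠ δ0 v := fun h => huv (h0.1 h)
  have n2 : δ u ≠ δ v := fun h => huv (hδ h)
  generalize hx0 : δ0 u = P at n1
  generalize hx1 : δ0 v = Q at n1
  generalize hx2 : δ u = R at n2 ⊢
  generalize hx3 : δ v = U at n2 ⊢
  obtain ⟨p1, p2⟩ := P
  obtain ⟨q1, q2⟩ := Q
  obtain ⟨r1, r2⟩ := R
  obtain ⟨u1, u2⟩ := U
  have pos : ∀ a b c d : ℝ, (a, b) ≠ (c, d) → 0 < (c - a) ^ 2 + (d - b) ^ 2 := by
    intro a b c d h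
    by_contra hn
    have e1 : (c - a) ^ 2 = 0 := by nlinarith [sq_nonneg (c - a), sq_nonneg (d - b)]
    have e2 : (d - b) ^ 2 = 0 := by nlinarith [sq_nonneg (c - a), sq_nonneg (d - b)]
    have e1' := pow_eq_zero_iff (two_ne_zero) |>.1 e1
    have e2' := pow_eq_zero_iff (two_ne_zero) |>.1 e2
    exact h (by rw [Prod.mk.injEq]; constructor <;> linarith)
  have hN := pos _ _ _ _ n1
  have hM := pos _ _ _ _ n2
  obtain ⟨a, b, ha, hb⟩ : ∃ a b : ℝ, a * (q1 - p1) - b * (q2 - p2) = u1 - r1 ∧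
      b * (q1 - p1) + a * (q2 - p2) = u2 - r2 := by
    refine ⟨((u1 - r1) * (q1 - p1) + (u2 - r2) * (q2 - p2)) / ((q1 - p1) ^ 2 + (q2 - p2) ^ 2),
      ((q1 - p1) * (u2 - r2) - (q2 - p2) * (u1 - r1)) / ((q1 - p1) ^ 2 + (q2 - p2) ^ 2), ?_, ?_⟩
    · field_simp
      ring
    · field_simp
      ring
  have hd : a * a - -b * b ≠ 0 := by
    intro h
    have ha0 : a = 0 := by nlinarith [mul_self_nonneg a, mul_self_nonneg b]
    have hb0 : b = 0 := by nlinarith [mul_self_nonneg a, mul_self_nonneg b]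
    subst ha0 hb0
    rw [← ha, ← hb] at hM
    norm_num at hM
  obtain ⟨F, hF, hFe⟩ := exists_aff a (-b) b a (r1 - (a * p1 - b * p2)) (r2 - (b * p1 + a * p2)) hd
  refine ⟨_, h0.affine F hF, ?_, ?_⟩
  · show F (δ0 u) = _
    rw [hx0, hFe]
    ext <;> simp only <;> ring
  · show F (δ0 v) = _
    rw [hx1, hFe]
    ext <;> simp only
    · linear_combination ha
    · linear_combination hb

lemma num_aux (j : ℕ) : (j + 11) * (2 * (j + 11) + 1) * (j + 11) ≤ 2 ^ (2 * j + 13) := by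
  induction j with
  | zero => norm_num
  | succ j ih =>
    have : 2 ^ (2 * (j + 1) + 13) = 4 * 2 ^ (2 * j + 13) := by
      rw [show 2 * (j + 1) + 13 = (2 * j + 13) + 2 by ring, pow_add]; ring
    rw [this]
    refine le_trans ?_ (Nat.mul_le_mul_left 4 ih)
    exact Nat.le.intro (k := 6 * j ^ 3 + 195 * j ^ 2 + 2104 * j + 7532) (by ring)

lemma logb_ge {L : ℝ} (k : ℕ) (h : (2 : ℝ) ^ k ≤ L) : (k : ℝ) ≤ Real.logb 2 L := by
  rw [Real.le_logb_iff_rpow_le (by norm_num) (lt_of_lt_of_le (by positivity) h), Real.rpow_natCast]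
  exact h

lemma small_num {L : ℝ} (h2 : 2 ≤ L) (h13 : L ≤ 13) : (L - 1) / Real.logb 2 L ≤ 4 := by
  have h1 := logb_ge (L := L) 1 (by norm_num; exact h2)
  rw [div_le_iff₀ (by push_cast at h1; linarith)]
  push_cast at h1
  rcases le_total L 5 with h | h
  · linarith
  have h4 := logb_ge (L := L) 2 (by norm_num; linarith)
  push_cast at h4
  rcases le_total L 9 with h' | h'
  · linarith
  have h5 := logb_ge (L := L) 3 (by norm_num; linarith)
  push_cast at h5
  linarith

end

end FP

/-- Let `G` be a planar graph with `n ≥ 4` vertices.  Then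
`fix(G) ≥ √(((log₂ n) - 1) / (log₂ log₂ n))`: for every straight-line drawing `δ`
of `G` there is a plane straight-line drawing `δ'` fixing at least that many
vertices of `δ`. -/
theorem fix_planar_ge {V : Type*} [Fintype V] (G : SimpleGraph V)
    (hplanar : ∃ δ : V → ℝ × ℝ, IsPlaneDrawing G δ)
    (hn : 4 ≤ Fintype.card V)
    (δ : V → ℝ × ℝ) (hδ : Function.Injective δ) :
    ∃ δ' : V → ℝ × ℝ, IsPlaneDrawing G δ' ∧
      Real.sqrt ((Real.logb 2 (Fintype.card V) - 1) /
          Real.logb 2 (Real.logb 2 (Fintype.card V))) ≤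
        ({v : V | δ' v = δ v}.ncard : ℝ) := by
  obtain ⟨δ0, h0⟩ := hplanar
  have h0 := FP.PlaneD.of_isPlane h0
  have hL2 : (2 : ℝ) ≤ Real.logb 2 (Fintype.card V) := by
    have := FP.logb_ge (L := (Fintype.card V : ℝ)) 2 (by norm_num; exact_mod_cast hn)
    exact_mod_cast this
  by_cases hL : Real.logb 2 (Fintype.card V) ≤ 13
  · obtain ⟨u, v, huv⟩ := Fintype.exists_pair_of_one_lt_card (α := V) (by omega)
    obtain ⟨δ', h1, h2, h3⟩ := FP.two h0 hδ huv
    refine ⟨δ', h1.isPlane, ?_⟩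
    have hc : 2 ≤ {v : V | δ' v = δ v}.ncard := by
      rw [← Set.ncard_pair huv]
      apply Set.ncard_le_ncard _ (Set.toFinite _)
      rintro x (rfl | rfl)
      · exact h2
      · exact h3
    have : (2 : ℝ) ≤ ({v : V | δ' v = δ v}.ncard : ℝ) := by exact_mod_cast hc
    refine le_trans ?_ this
    rw [Real.sqrt_le_left (by norm_num)]
    have := FP.small_num hL2 hL
    linarith
  · have hL : (13 : ℝ) < Real.logb 2 (Fintype.card V) := not_le.1 hL
    have hn0 : Fintype.card V ≠ 0 := by omega
    have hm1 : 2 ^ Nat.log 2 (Fintype.card V) ≤ Fintype.card V := Nat.pow_log_le_self 2 hn0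
    have hm2 : Fintype.card V < 2 ^ (Nat.log 2 (Fintype.card V) + 1) :=
      Nat.lt_pow_succ_log_self (by norm_num) _
    generalize Nat.log 2 (Fintype.card V) = m at hm1 hm2
    have hLm : Real.logb 2 (Fintype.card V) < m + 1 := by
      rw [Real.logb_lt_iff_lt_rpow (by norm_num) (by exact_mod_cast Nat.pos_of_ne_zero hn0)]
      have : ((m : ℝ) + 1) = ((m + 1 : ℕ) : ℝ) := by push_cast; ring
      rw [this, Real.rpow_natCast]
      exact_mod_cast hm2
    have hm13 : 13 ≤ m := by
      have : (13 : ℝ) < (m + 1 : ℕ) := by push_cast; linarith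
      have : 13 < m + 1 := by exact_mod_cast this
      omega
    obtain ⟨j, hj1, hj2⟩ : ∃ j, m ≤ 2 * (j + 7) ∧ 2 * j + 13 ≤ m := ⟨(m + 1) / 2 - 7, by omega, by omega⟩
    obtain ⟨δ', h1, T, hT, hTe⟩ := FP.main_big h0 hδ (j + 7)
      ((FP.num_aux j).trans ((Nat.pow_le_pow_right (by norm_num) hj2).trans hm1))
    refine ⟨δ', h1.isPlane, ?_⟩
    have hc : T.card ≤ {v : V | δ' v = δ v}.ncard := by
      rw [← Set.ncard_coe_finset]
      exact Set.ncard_le_ncard (fun x hx => hTe x hx) (Set.toFinite _)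
    have hcR : (T.card : ℝ) ≤ ({v : V | δ' v = δ v}.ncard : ℝ) := by exact_mod_cast hc
    refine le_trans ?_ hcR
    rw [Real.sqrt_le_left (by positivity)]
    have hll := FP.logb_ge (L := Real.logb 2 (Fintype.card V)) 2 (by norm_num; linarith)
    push_cast at hll
    have hTR : ((j : ℝ) + 7) ≤ (T.card : ℝ) ^ 2 := by exact_mod_cast hT
    have hjR : (m : ℝ) ≤ 2 * (j + 7) := by exact_mod_cast hj1
    refine le_trans ?_ hTR
    rw [div_le_iff₀ (by linarith)]
    nlinarith
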